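/- arXiv:1304.2163 — 5 statements merged into one kernel-verified Lean document; each statement's English description precedes it below -/
import Mathlib

section
/- For m ∈ (0.5, 0.6), define g_{2,m}(y) = (1/89100)(3−10m)(3+35m)y¹² − (1/6300)(75−125m)^{2/3}(3−13m)y⁸ + (1/90)(3−10m)y⁶ − (1/25)(75−125m)^{2/3}y² + 1, g_{1,m}(y) = g_{2,m}'(y), g_{0,m}(y) = g_{2,m}''(y)/2 − (m/2)y⁵ g_{2,m}'(y) + (5/3)m y⁴ g_{2,m}(y), and V_m(x,y) = g_{0,m}(y) + g_{1,m}(y)x + g_{2,m}(y)x². Let 𝓤_m be the bounded connected component containing the origin of the set {(x,y) ∈ ℝ² : V_m(x,y) ≤ 0}. Then for every initial condition (x₀,y₀) ∈ 𝓤_m, the maximal solution of Bacciotti's system X_m starting at (x₀,y₀) is defined for all t ≥ 0 and converges to (0,0) as t → +∞; that is, 𝓤_m is contained in the basin of attraction of the origin. -/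
open Real Filter Set

noncomputable section

/-- Bacciotti's system `X_m(x,y) = (y³ − x³, −x + m·y⁵)`. -/
def bacciotti (m : ℝ) (p : ℝ × ℝ) : ℝ × ℝ :=
  (p.2 ^ 3 - p.1 ^ 3, -p.1 + m * p.2 ^ 5)

/-- A (global) solution of Bacciotti's system. -/
def IsSolution (m : ℝ) (γ : ℝ → ℝ × ℝ) : Prop :=
  ∀ t : ℝ, HasDerivAt γ (bacciotti m (γ t)) t

/-- A periodic orbit: a nonconstant `T`-periodic solution with `T > 0`. -/
def IsPeriodicOrbit (m : ℝ) (γ : ℝ → ℝ × ℝ) (T : ℝ) : Prop :=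
  IsSolution m γ ∧ (¬ ∃ c : ℝ × ℝ, ∀ t, γ t = c) ∧ 0 < T ∧ Function.Periodic γ T

/-- The saddle point `p_m^+ = (m^{−1/4}, m^{−1/4})`. -/
def pPlus (m : ℝ) : ℝ × ℝ := (m ^ (-(1 : ℝ) / 4), m ^ (-(1 : ℝ) / 4))

/-- The saddle point `p_m^− = (−m^{−1/4}, −m^{−1/4})`. -/
def pMinus (m : ℝ) : ℝ × ℝ := (-(m ^ (-(1 : ℝ) / 4)), -(m ^ (-(1 : ℝ) / 4)))

/-- A heteroclinic connection from `p_m^−` to `p_m^+`. -/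
def IsHeteroclinic (m : ℝ) (γ : ℝ → ℝ × ℝ) : Prop :=
  IsSolution m γ ∧ Tendsto γ atBot (nhds (pMinus m)) ∧ Tendsto γ atTop (nhds (pPlus m))

/-- The divergence of Bacciotti's system: `div X_m(x,y) = −3x² + 5m·y⁴`. -/
def divBacciotti (m : ℝ) (p : ℝ × ℝ) : ℝ :=
  -3 * p.1 ^ 2 + 5 * m * p.2 ^ 4

/-- `T` is the minimal period of `γ`. -/
def IsMinimalPeriod (γ : ℝ → ℝ × ℝ) (T : ℝ) : Prop :=
  0 < T ∧ Function.Periodic γ T ∧ ∀ T' : ℝ, 0 < T' → Function.Periodic γ T' → T ≤ T'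

/-- A forward solution of the vector field `X`, defined for all `t ≥ 0`. -/
def IsForwardSolution (X : ℝ × ℝ → ℝ × ℝ) (γ : ℝ → ℝ × ℝ) : Prop :=
  ∀ t ∈ Set.Ici (0 : ℝ), HasDerivWithinAt γ (X (γ t)) (Set.Ici (0 : ℝ)) t

/-- `g_{2,m}(y)`. -/
def g2 (m : ℝ) (y : ℝ) : ℝ :=
  (1 / 89100) * (3 - 10 * m) * (3 + 35 * m) * y ^ 12
    - (1 / 6300) * (75 - 125 * m) ^ ((2 : ℝ) / 3) * (3 - 13 * m) * y ^ 8
    + (1 / 90) * (3 - 10 * m) * y ^ 6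
    - (1 / 25) * (75 - 125 * m) ^ ((2 : ℝ) / 3) * y ^ 2 + 1

/-- `g_{1,m} = g_{2,m}'`. -/
def g1 (m : ℝ) : ℝ → ℝ := deriv (g2 m)

/-- `g_{0,m}(y) = g_{2,m}''(y)/2 − (m/2)y⁵g_{2,m}'(y) + (5/3)m·y⁴·g_{2,m}(y)`. -/
def g0 (m : ℝ) (y : ℝ) : ℝ :=
  deriv (deriv (g2 m)) y / 2 - (m / 2) * y ^ 5 * deriv (g2 m) y
    + (5 / 3) * m * y ^ 4 * g2 m y

/-- `V_m(x,y) = g_{0,m}(y) + g_{1,m}(y)·x + g_{2,m}(y)·x²`. -/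
def Vm (m : ℝ) (p : ℝ × ℝ) : ℝ :=
  g0 m p.2 + g1 m p.2 * p.1 + g2 m p.2 * p.1 ^ 2

/-- `𝓤_m`: the connected component containing the origin of `{V_m ≤ 0}`. -/
def Um (m : ℝ) : Set (ℝ × ℝ) :=
  connectedComponentIn {p : ℝ × ℝ | Vm m p ≤ 0} ((0, 0) : ℝ × ℝ)

theorem exists_forward_solution_of_lipschitzWith {E : Type*} [NormedAddCommGroup E]
    [NormedSpace ℝ E] [CompleteSpace E] {v : E → E} {K L : NNReal} (hv : LipschitzWith K v)
    (hL : ∀ x, ‖v x‖ ≤ L) (x₀ : E) :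
    ∃ γ : ℝ → E, γ 0 = x₀ ∧
      ∀ t ∈ Ici (0 : ℝ), HasDerivWithinAt γ (v (γ t)) (Ici (0 : ℝ)) t := by
  have hloc : ∀ n : ℕ, ∃ α : ℝ → E, α 0 = x₀ ∧
      ∀ t ∈ Icc (0 : ℝ) n, HasDerivWithinAt α (v (α t)) (Icc (0 : ℝ) n) t := by
    intro n
    have hpl : IsPicardLindelof (fun _ => v) (⟨0, le_rfl, n.cast_nonneg⟩ : Icc (0 : ℝ) n) x₀
        (L * n) 0 L K :=
      IsPicardLindelof.of_time_independent (fun x _ => hL x) hv.lipschitzOnWith (by simp)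
    exact hpl.exists_eq_forall_mem_Icc_hasDerivWithinAt₀
  choose α hα₀ hα using hloc
  have huniq : ∀ n k : ℕ, n ≤ k → EqOn (α n) (α k) (Icc 0 n) := by
    intro n k hnk
    have hnk' : (n : ℝ) ≤ k := by exact_mod_cast hnk
    have hcont : ∀ j : ℕ, ContinuousOn (α j) (Icc 0 j) :=
      fun j t ht => (hα j t ht).continuousWithinAt
    have hder : ∀ j : ℕ, (n : ℝ) ≤ j → ∀ t ∈ Ico (0 : ℝ) n,
        HasDerivWithinAt (α j) (v (α j t)) (Ici t) t := fun j hj t ht =>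
      (hα j t ⟨ht.1, ht.2.le.trans hj⟩).mono_of_mem_nhdsWithin
        (mem_of_superset (Icc_mem_nhdsGE (ht.2.trans_le hj)) (Icc_subset_Icc_left ht.1))
    exact ODE_solution_unique (v := fun _ => v) (fun _ => hv) (hcont n) (hder n le_rfl)
      ((hcont k).mono (Icc_subset_Icc_right hnk')) (hder k hnk') ((hα₀ n).trans (hα₀ k).symm)
  refine ⟨fun t => α (⌈t⌉₊ + 1) t, by simpa using hα₀ _, fun t ht => ?_⟩
  have hlt : t < ((⌈t⌉₊ + 1 : ℕ) : ℝ) := by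
    push_cast
    exact (Nat.le_ceil t).trans_lt (lt_add_one _)
  have heq : ∀ s ∈ Icc (0 : ℝ) ((⌈t⌉₊ + 1 : ℕ) : ℝ), α (⌈s⌉₊ + 1) s = α (⌈t⌉₊ + 1) s := by
    intro s hs
    have hs' : s ∈ Icc (0 : ℝ) ((⌈s⌉₊ + 1 : ℕ) : ℝ) :=
      ⟨hs.1, by push_cast; exact (Nat.le_ceil s).trans (lt_add_one _).le⟩
    rcases le_total (⌈s⌉₊ + 1) (⌈t⌉₊ + 1) with h | h
    · exact huniq _ _ h hs'
    · exact (huniq _ _ h hs).symm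
  refine ((hα _ t ⟨ht, hlt.le⟩).congr heq rfl).mono_of_mem_nhdsWithin ?_
  rw [← Ici_inter_Iic]
  exact inter_mem self_mem_nhdsWithin (mem_nhdsWithin_of_mem_nhds (Iic_mem_nhds hlt))

theorem tendsto_of_strict_lyapunov {E : Type*} [TopologicalSpace E] [T2Space E]
    {K : Set E} (hK : IsCompact K)
    {γ : ℝ → E} (hγ : ∀ t, 0 ≤ t → γ t ∈ K) {W D : E → ℝ} {x₀ : E}
    (hW : ContinuousOn W K) (hD : ContinuousOn D K) (hW₀ : W x₀ = 0)
    (hWpos : ∀ x ∈ K, x ≠ x₀ → 0 < W x) (hDneg : ∀ x ∈ K, x ≠ x₀ → D x < 0)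
    (hD₀ : D x₀ ≤ 0)
    (hder : ∀ t ∈ Ici (0 : ℝ), HasDerivWithinAt (fun s => W (γ s)) (D (γ t)) (Ici 0) t) :
    Tendsto γ atTop (nhds x₀) := by
  have hcont : ContinuousOn (fun s => W (γ s)) (Ici 0) :=
    fun t ht => (hder t ht).continuousWithinAt
  have hDnp : ∀ x ∈ K, D x ≤ 0 := fun x hx => by
    rcases eq_or_ne x x₀ with rfl | h
    · exact hD₀
    · exact (hDneg x hx h).le
  have hWnn : ∀ x ∈ K, 0 ≤ W x := fun x hx => by
    rcases eq_or_ne x x₀ with rfl | h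
    · exact hW₀.ge
    · exact (hWpos x hx h).le
  have hder' : ∀ t ∈ interior (Ici (0 : ℝ)),
      HasDerivWithinAt (fun s => W (γ s)) (D (γ t)) (interior (Ici (0 : ℝ))) t :=
    fun t ht => (hder t (interior_subset ht)).mono interior_subset
  have hanti : AntitoneOn (fun s => W (γ s)) (Ici 0) :=
    antitoneOn_of_hasDerivWithinAt_nonpos (convex_Ici 0) hcont hder'
      (fun t ht => hDnp _ (hγ t (interior_subset ht)))
  rw [tendsto_nhds]
  intro O hO hx₀
  rcases (K \ O).eq_empty_or_nonempty with hemp | hne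
  · filter_upwards [eventually_ge_atTop 0] with t ht
    by_contra h
    exact (hemp ▸ (⟨hγ t ht, h⟩ : γ t ∈ K \ O) : γ t ∈ (∅ : Set E))
  obtain ⟨z, hz, hzmin⟩ := (hK.diff hO).exists_isMinOn hne (hW.mono sdiff_subset)
  have hwz : 0 < W z := hWpos z hz.1 (fun h => hz.2 (h ▸ hx₀))
  obtain ⟨t₀, ht₀, hlt⟩ : ∃ t₀, 0 ≤ t₀ ∧ W (γ t₀) < W z := by
    by_contra! hcon
    have hS : IsCompact (K ∩ W ⁻¹' Ici (W z)) :=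
      hK.of_isClosed_subset
        (hW.preimage_isClosed_of_isClosed hK.isClosed isClosed_Ici) inter_subset_left
    obtain ⟨y, hy, hymax⟩ := hS.exists_isMaxOn ⟨γ 0, hγ 0 le_rfl, hcon 0 le_rfl⟩
      (hD.mono inter_subset_left)
    have hDy : D y < 0 := hDneg y hy.1 (fun h => by
      have := hy.2; rw [h, mem_preimage, hW₀] at this; exact absurd this (not_le.2 hwz))
    have hlin : ∀ t, 0 ≤ t → W (γ t) ≤ W (γ 0) + D y * t := by
      intro t ht
      have := (convex_Ici (0 : ℝ)).image_sub_le_mul_sub_of_deriv_le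
        (f := fun s => W (γ s)) hcont
        (fun s hs => (hder' s hs).differentiableWithinAt) (C := D y) (fun s hs => by
          have hs0 : (0 : ℝ) < s := by simpa using hs
          rw [((hder s hs0.le).hasDerivAt (Ici_mem_nhds hs0)).deriv]
          exact hymax ⟨hγ s hs0.le, hcon s hs0.le⟩) 0 self_mem_Ici t ht ht
      simp only [sub_zero] at this
      linarith
    have h1 := hlin (W (γ 0) / (-D y) + 1)
      (add_nonneg (div_nonneg (hWnn _ (hγ 0 le_rfl)) (by linarith)) zero_le_one)
    have h2 : D y * (W (γ 0) / (-D y) + 1) = - W (γ 0) + D y := by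
      have := hDy.ne
      field_simp
    have h3 := hWnn _ (hγ (W (γ 0) / (-D y) + 1)
      (add_nonneg (div_nonneg (hWnn _ (hγ 0 le_rfl)) (by linarith)) zero_le_one))
    linarith
  filter_upwards [eventually_ge_atTop t₀] with t ht
  by_contra h
  have h1 : W z ≤ W (γ t) := hzmin ⟨hγ t (ht₀.trans ht), h⟩
  have h2 : W (γ t) ≤ W (γ t₀) := hanti ht₀ (ht₀.trans ht) ht
  linarith

theorem forall_mem_of_barrier {E : Type*} [TopologicalSpace E] {γ : ℝ → E} {R I : Set E}
    {V V' : E → ℝ} {C : ℝ} (hγ : ContinuousOn γ (Ici 0)) (hR : IsClosed R) (hI : IsOpen I)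
    (hIR : I ⊆ R) (hV : Continuous V) (hVI : ∀ x ∈ R, V x ≤ 0 → x ∈ I)
    (h₀ : γ 0 ∈ R) (hV₀ : V (γ 0) ≤ 0)
    (hder : ∀ t ∈ Ici (0 : ℝ), γ t ∈ R →
      HasDerivWithinAt (fun s => V (γ s)) (V' (γ t)) (Ici 0) t)
    (hbound : ∀ x ∈ R, 0 < V x → V' x ≤ C * V x) :
    ∀ t, 0 ≤ t → γ t ∈ R ∧ V (γ t) ≤ 0 := by
  intro T hT
  have hcl : IsClosed (R ∩ V ⁻¹' Iic 0) := hR.inter (isClosed_Iic.preimage hV)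
  have hsub : Icc 0 T ⊆ γ ⁻¹' (R ∩ V ⁻¹' Iic 0) := by
    refine IsClosed.Icc_subset_of_forall_mem_nhdsWithin ?_ ⟨h₀, hV₀⟩ ?_
    · rw [inter_comm]
      exact (hγ.mono Icc_subset_Ici_self).preimage_isClosed_of_isClosed isClosed_Icc hcl
    · rintro t ⟨⟨htR, htV⟩, ht₀, -⟩
      have hmem : ∀ᶠ s in nhdsWithin t (Ici t), γ s ∈ I :=
        ((hγ t ht₀).mono (Ici_subset_Ici.2 ht₀)).eventually (hI.mem_nhds (hVI _ htR htV))
      obtain ⟨u, htu, hu⟩ := (mem_nhdsGE_iff_exists_Icc_subset).1 hmem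
      have hderV : ∀ s ∈ Icc t u, HasDerivWithinAt (fun s => V (γ s)) (V' (γ s)) (Ici 0) s :=
        fun s hs => hder s (ht₀.trans hs.1) (hIR (hu hs))
      have hle : ∀ η > 0, ∀ s ∈ Icc t u, V (γ s) ≤ η * exp ((C + 1) * (s - t)) := by
        intro η hη
        have hB : ∀ s, HasDerivAt (fun s => η * exp ((C + 1) * (s - t)))
            ((C + 1) * (η * exp ((C + 1) * (s - t)))) s := fun s => by
          have := ((((hasDerivAt_id s).sub_const t).const_mul (C + 1)).exp).const_mul η
          simp only [id, mul_one] at this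
          exact this.congr_deriv (by ring)
        refine image_le_of_deriv_right_lt_deriv_boundary' (f' := fun s => V' (γ s))
          (fun s hs => ((hderV s hs).continuousWithinAt).mono
            (fun r hr => ht₀.trans hr.1))
          (fun s hs => (hderV s ⟨hs.1, hs.2.le⟩).mono (Ici_subset_Ici.2 (ht₀.trans hs.1))) ?_
          (fun s _ => (hB s).continuousAt.continuousWithinAt)
          (fun s _ => (hB s).hasDerivWithinAt) ?_
        · simpa using le_trans htV hη.le
        · intro s hs hEq
          have hpos : 0 < V (γ s) := hEq ▸ mul_pos hη (exp_pos _)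
          have := hbound _ (hIR (hu ⟨hs.1, hs.2.le⟩)) hpos
          simp only [← hEq]
          linarith
      refine mem_of_superset (Icc_mem_nhdsGT htu) (fun s hs => ⟨hIR (hu hs), ?_⟩)
      change V (γ s) ≤ 0
      refine le_of_forall_pos_le_add fun η hη => ?_
      have := hle (η / exp ((C + 1) * (s - t))) (div_pos hη (exp_pos _)) s hs
      rw [div_mul_cancel₀ _ (exp_pos _).ne'] at this
      linarith
  exact hsub ⟨hT, le_rfl⟩

theorem scaled_derivative_nonpos {e X Y : ℝ} (he : 0 ≤ e) (he' : e ^ 2 ≤ 25 / 2)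
    (hX : |X| ≤ 13 / 50) (hY : |Y| ≤ 23 / 40) :
    -2 / 1875 + Y ^ 4 / 375 + (64 / 4375 - 634 / 984375 * e ^ 2 + 56 / 10546875 * e ^ 4) * Y ^ 6
      + X * Y ^ 7 * e * ((52 / 1875 - 1871 / 1968750 * e ^ 2 + 559 / 73828125 * e ^ 4)
        + (-988 / 12375 + 2539 / 618750 * e ^ 2 - 1504 / 23203125 * e ^ 4
          + 154 / 474609375 * e ^ 6) * Y ^ 4)
      + Y ^ 10 * ((-32 / 275 + 353 / 61875 * e ^ 2 - 388 / 4640625 * e ^ 4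
          + 4 / 10546875 * e ^ 6)
        + (-52 / 9375 + 377 / 1406250 * e ^ 2 - 221 / 52734375 * e ^ 4
          + 169 / 7910156250 * e ^ 6) * (e ^ 2 * Y ^ 2)
        + (988 / 61875 - 3211 / 3093750 * e ^ 2 + 8398 / 348046875 * e ^ 4
          - 4199 / 17402343750 * e ^ 6 + 1729 / 1957763671875 * e ^ 8) * (e ^ 2 * Y ^ 6)) ≤ 0 := by
  have hY2 : Y ^ 2 ≤ (23 / 40) ^ 2 :=
      sq_le_sq' (by linarith [neg_abs_le Y]) (by linarith [le_abs_self Y])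
  have hY4 : Y ^ 4 ≤ 1094 / 10000 := by nlinarith [sq_nonneg Y]
  have hY40 : 0 ≤ Y ^ 4 := by positivity
  have hY6 : Y ^ 6 ≤ 362 / 10000 := by nlinarith [sq_nonneg Y]
  have hY60 : 0 ≤ Y ^ 6 := by positivity
  have he4 : e ≤ 354 / 100 := by nlinarith
  have hXY : X * Y ≤ 1495 / 10000 := by
    have h1 := mul_le_mul hX hY (abs_nonneg _) (by norm_num)
    rw [← abs_mul] at h1
    linarith [le_abs_self (X * Y)]
  obtain ⟨u, hu⟩ : ∃ u, u = e ^ 2 := ⟨_, rfl⟩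
  have hu0 : 0 ≤ u := hu ▸ sq_nonneg e
  rw [← hu] at he'
  have e4 : e ^ 4 = u ^ 2 := by rw [hu]; ring
  have e6 : e ^ 6 = u ^ 3 := by rw [hu]; ring
  have e8 : e ^ 8 = u ^ 4 := by rw [hu]; ring
  rw [e4, e6, e8, ← hu]
  have hu2 : u ^ 2 ≤ 25 / 2 * u := by nlinarith
  have hu3 : u ^ 3 ≤ 25 / 2 * u ^ 2 := by nlinarith [mul_nonneg hu0 hu0]
  have hu4 : u ^ 4 ≤ 25 / 2 * u ^ 3 := by nlinarith [pow_nonneg hu0 3]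
  have hu30 : 0 ≤ u ^ 3 := by positivity
  have hu20 : 0 ≤ u ^ 2 := by positivity
  obtain ⟨b, hb⟩ : ∃ b, b = 52 / 1875 - 1871 / 1968750 * u + 559 / 73828125 * u ^ 2 := ⟨_, rfl⟩
  obtain ⟨d, hd⟩ : ∃ d, d = -988 / 12375 + 2539 / 618750 * u - 1504 / 23203125 * u ^ 2
          + 154 / 474609375 * u ^ 3 := ⟨_, rfl⟩
  have hbd : 0 ≤ b + d * Y ^ 4 := by
    have : -8 / 100 ≤ d := by linarith
    have : 1 / 100 ≤ b := by linarith
    nlinarith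
  have hdn : d ≤ 0 := by linarith
  have h1 : X * Y ^ 7 * e * (b + d * Y ^ 4) ≤ 1495 / 10000 * e * b * Y ^ 6 := by
    have h2 : X * Y * (e * Y ^ 6 * (b + d * Y ^ 4))
        ≤ 1495 / 10000 * (e * Y ^ 6 * (b + d * Y ^ 4)) :=
      mul_le_mul_of_nonneg_right hXY (by positivity)
    have h3 : e * Y ^ 6 * (d * Y ^ 4) ≤ 0 :=
      mul_nonpos_of_nonneg_of_nonpos (by positivity) (mul_nonpos_of_nonpos_of_nonneg hdn hY40)
    nlinarith
  have h4 : (64 / 4375 - 634 / 984375 * u + 56 / 10546875 * u ^ 2) + 1495 / 10000 * e * b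
      ≤ 214 / 10000 := by
    rw [hb, hu]
    nlinarith [sq_nonneg (e - 2), mul_nonneg he (sq_nonneg (e - 2)),
        mul_nonneg he (sq_nonneg (e - 3))]
  have h5 : Y ^ 10 * ((-32 / 275 + 353 / 61875 * u - 388 / 4640625 * u ^ 2
          + 4 / 10546875 * u ^ 3)
        + (-52 / 9375 + 377 / 1406250 * u - 221 / 52734375 * u ^ 2
          + 169 / 7910156250 * u ^ 3) * (u * Y ^ 2)
        + (988 / 61875 - 3211 / 3093750 * u + 8398 / 348046875 * u ^ 2
          - 4199 / 17402343750 * u ^ 3 + 1729 / 1957763671875 * u ^ 4) * (u * Y ^ 6)) ≤ 0 := by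
    refine mul_nonpos_of_nonneg_of_nonpos (by positivity) ?_
    have h6 : (-52 / 9375 + 377 / 1406250 * u - 221 / 52734375 * u ^ 2
          + 169 / 7910156250 * u ^ 3) * (u * Y ^ 2) ≤ 0 :=
      mul_nonpos_of_nonpos_of_nonneg (by linarith) (by positivity)
    have h7 : (988 / 61875 - 3211 / 3093750 * u + 8398 / 348046875 * u ^ 2
          - 4199 / 17402343750 * u ^ 3 + 1729 / 1957763671875 * u ^ 4) * (u * Y ^ 6)
          ≤ 2 / 100 * (25 / 2 * (362 / 10000)) := by
      apply mul_le_mul (by linarith) (by gcongr) (by positivity) (by positivity)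
    linarith
  rw [← hb, ← hd]
  nlinarith

/-- The coefficient of `X ^ 2` in `scaledV`. -/
def scaledG2 (u Y : ℝ) : ℝ :=
  1 - u * Y ^ 2 / 25 + Y ^ 6 * (-u / 30 + u ^ 2 / 1125)
    + Y ^ 8 * (2 / 2625 * u ^ 2 - 13 / 787500 * u ^ 3)
    + Y ^ 12 * (-2 / 2475 * u ^ 2 + 23 / 742500 * u ^ 3 - 7 / 27843750 * u ^ 4)

/-- The coefficient of `-e * Y * X` in `scaledV`. -/
def scaledG1 (u Y : ℝ) : ℝ :=
  2 / 25 + Y ^ 4 * (1 / 5 - 2 / 375 * u) - Y ^ 6 * (16 / 2625 * u - 26 / 196875 * u ^ 2)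
    + Y ^ 10 * (8 / 825 * u - 23 / 61875 * u ^ 2 + 14 / 4640625 * u ^ 3)

/-- The constant coefficient of `scaledV`. -/
def scaledG0 (u Y : ℝ) : ℝ :=
  -1 / 25 + Y ^ 4 / 2 + Y ^ 6 * (2 / 375 * u - 7 / 28125 * u ^ 2)
    - Y ^ 10 * (2 / 75 * u - 11 / 11250 * u ^ 2 + u ^ 3 / 140625)
    - Y ^ 12 * (2 / 1875 * u ^ 2 - 7 / 187500 * u ^ 3 + 13 / 42187500 * u ^ 4)
    + Y ^ 16 * (26 / 12375 * u ^ 2 - 403 / 3712500 * u ^ 3 + 481 / 278437500 * u ^ 4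
      - 91 / 10441406250 * u ^ 5)

/-- The function `V_m` in the coordinates `x = q ^ 2 * X`, `y = q * Y`, where `e = q ^ 3` and
`e ^ 2 = 75 - 125 * m`. -/
def scaledV (e X Y : ℝ) : ℝ :=
  scaledG0 (e ^ 2) Y - e * Y * scaledG1 (e ^ 2) Y * X + scaledG2 (e ^ 2) Y * X ^ 2

theorem scaledG_bounds {u Y : ℝ} (hu : 0 ≤ u) (hu' : u ≤ 25 / 2) (hY : |Y| ≤ 23 / 40) :
    (-1 / 25 + Y ^ 4 / 2 - 13 / 10000 * u * Y ^ 6 ≤ scaledG0 u Y) ∧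
    (0 ≤ scaledG1 u Y ∧ scaledG1 u Y ≤ 2 / 25 + Y ^ 4 * (1 / 5 - 49 / 10000 * u)) ∧
    1 - u * Y ^ 2 / 25 - u * Y ^ 6 / 30 ≤ scaledG2 u Y := by
  have hY2 : Y ^ 2 ≤ (23 / 40) ^ 2 :=
    sq_le_sq' (by linarith [neg_abs_le Y]) (by linarith [le_abs_self Y])
  have hY4 : Y ^ 4 ≤ 1094 / 10000 := by nlinarith [sq_nonneg Y]
  have hY40 : 0 ≤ Y ^ 4 := by positivity
  have hY6 : Y ^ 6 ≤ 362 / 10000 := by nlinarith [sq_nonneg Y]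
  have hY60 : 0 ≤ Y ^ 6 := by positivity
  have hu20 : 0 ≤ u ^ 2 := by positivity
  have hu30 : 0 ≤ u ^ 3 := by positivity
  have hu2 : u ^ 2 ≤ 25 / 2 * u := by nlinarith
  have hu3 : u ^ 3 ≤ 25 / 2 * u ^ 2 := by nlinarith
  have hu4 : u ^ 4 ≤ 25 / 2 * u ^ 3 := by nlinarith
  have hu40 : 0 ≤ u ^ 4 := by positivity
  have hu5 : u ^ 5 ≤ 25 / 2 * u ^ 4 := by nlinarith
  refine ⟨?_, ⟨?_, ?_⟩, ?_⟩
  · have h1 : Y ^ 4 * (2 / 75 * u - 11 / 11250 * u ^ 2 + u ^ 3 / 140625) ≤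
        1094 / 10000 * (2 / 75 * u) :=
      mul_le_mul hY4 (by linarith) (by linarith) (by norm_num)
    have h2 : Y ^ 6 * (2 / 1875 * u ^ 2 - 7 / 187500 * u ^ 3 + 13 / 42187500 * u ^ 4) ≤
        362 / 10000 * (2 / 1875 * (25 / 2 * u)) :=
      mul_le_mul hY6 (by linarith) (by linarith) (by norm_num)
    have h3 : 0 ≤ Y ^ 16 * (26 / 12375 * u ^ 2 - 403 / 3712500 * u ^ 3 + 481 / 278437500 * u ^ 4
      - 91 / 10441406250 * u ^ 5) := mul_nonneg (by positivity) (by linarith)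
    have h4 : 0 ≤ Y ^ 6 * ((2 / 375 * u - 7 / 28125 * u ^ 2)
        - Y ^ 4 * (2 / 75 * u - 11 / 11250 * u ^ 2 + u ^ 3 / 140625)
        - Y ^ 6 * (2 / 1875 * u ^ 2 - 7 / 187500 * u ^ 3 + 13 / 42187500 * u ^ 4)
        + 13 / 10000 * u) := mul_nonneg hY60 (by linarith)
    rw [scaledG0]
    linarith
  · have h1 : Y ^ 6 * (16 / 2625 * u - 26 / 196875 * u ^ 2)
        ≤ 362 / 10000 * (16 / 2625 * (25 / 2)) :=
      mul_le_mul hY6 (by linarith) (by linarith) (by norm_num)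
    have h2 : 0 ≤ Y ^ 4 * (1 / 5 - 2 / 375 * u) := mul_nonneg hY40 (by linarith)
    have h3 : 0 ≤ Y ^ 10 * (8 / 825 * u - 23 / 61875 * u ^ 2 + 14 / 4640625 * u ^ 3) :=
      mul_nonneg (by positivity) (by linarith)
    rw [scaledG1]
    linarith
  · have h1 : 0 ≤ Y ^ 6 * (16 / 2625 * u - 26 / 196875 * u ^ 2) :=
      mul_nonneg hY60 (by linarith)
    have h2 : Y ^ 6 * (8 / 825 * u - 23 / 61875 * u ^ 2 + 14 / 4640625 * u ^ 3) ≤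
        362 / 10000 * (8 / 825 * u) := mul_le_mul hY6 (by linarith) (by linarith) (by norm_num)
    have h3 := mul_le_mul_of_nonneg_left h2 hY40
    have h4 := mul_nonneg hY40 hu
    rw [scaledG1]
    nlinarith
  · have h1 : 0 ≤ Y ^ 8 * (2 / 2625 * u ^ 2 - 13 / 787500 * u ^ 3) :=
      mul_nonneg (by positivity) (by linarith)
    have h2 : 0 ≤ Y ^ 12 * (23 / 742500 * u ^ 3 - 7 / 27843750 * u ^ 4) :=
      mul_nonneg (by positivity) (by linarith)
    have h3 := mul_nonneg (mul_nonneg hY60 hu20) (show 0 ≤ 1 / 1125 - 2 / 2475 * Y ^ 6 by linarith)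
    rw [scaledG2]
    linarith

theorem scaledV_pos_of_abs_left_eq {e X Y E a b : ℝ} (he : 0 ≤ e) (heE : e ≤ E)
    (hE : E ^ 2 ≤ 25 / 2) (ha : 0 ≤ a) (hX : |X| = a) (hY : |Y| ≤ b) (hb : b ≤ 23 / 40)
    (h : ∀ y : ℝ, 0 ≤ y → y ≤ b → 0 < -1 / 25 + y ^ 4 / 2 - 13 / 10000 * E ^ 2 * y ^ 6
      - E * y * (2 / 25 + y ^ 4 / 5) * a
      + (1 - E ^ 2 * y ^ 2 / 25 - E ^ 2 * y ^ 6 / 30) * a ^ 2) : 0 < scaledV e X Y := by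
  have hE0 : 0 ≤ E := he.trans heE
  have hu : e ^ 2 ≤ E ^ 2 := by gcongr
  obtain ⟨h0, ⟨h1, h1'⟩, h2⟩ := scaledG_bounds (sq_nonneg e) (hu.trans hE) (hY.trans hb)
  have h := h |Y| (abs_nonneg Y) hY
  have e2 : |Y| ^ 2 = Y ^ 2 := sq_abs Y
  have e4 : |Y| ^ 4 = Y ^ 4 := by rw [show (4 : ℕ) = 2 * 2 from rfl, pow_mul, e2, ← pow_mul]
  have e6 : |Y| ^ 6 = Y ^ 6 := by rw [show (6 : ℕ) = 2 * 3 from rfl, pow_mul, e2, ← pow_mul]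
  rw [e2, e4, e6] at h
  have hXa : X ^ 2 = a ^ 2 := by rw [← hX, sq_abs]
  have h3 : e * Y * scaledG1 (e ^ 2) Y * X ≤ E * |Y| * (2 / 25 + Y ^ 4 / 5) * a := by
    have : e * Y * scaledG1 (e ^ 2) Y * X ≤ e * |Y| * scaledG1 (e ^ 2) Y * a := by
      refine (le_abs_self _).trans_eq ?_
      rw [abs_mul, abs_mul, abs_mul, hX, abs_of_nonneg he, abs_of_nonneg h1]
    refine this.trans ?_
    have h5 : scaledG1 (e ^ 2) Y ≤ 2 / 25 + Y ^ 4 / 5 := by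
      have : 0 ≤ Y ^ 4 * e ^ 2 := by positivity
      linarith
    gcongr
  have h4 : (1 - E ^ 2 * Y ^ 2 / 25 - E ^ 2 * Y ^ 6 / 30) * a ^ 2 ≤ scaledG2 (e ^ 2) Y * a ^ 2 := by
    refine mul_le_mul_of_nonneg_right (le_trans ?_ h2) (sq_nonneg a)
    gcongr
  have h6 : 13 / 10000 * e ^ 2 * Y ^ 6 ≤ 13 / 10000 * E ^ 2 * Y ^ 6 := by gcongr
  rw [scaledV, hXa]
  linarith

theorem scaledV_pos_of_abs_right_eq {e X Y b α β κ : ℝ} (he : 0 ≤ e) (he' : e ^ 2 ≤ 25 / 2)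
    (hY : |Y| = b) (hb : b ≤ 23 / 40) (hκ : 0 ≤ κ) (hβ : β ^ 2 < 4 * α * κ)
    (h0 : α ≤ -1 / 25 + b ^ 4 / 2 - 13 / 10000 * e ^ 2 * b ^ 6)
    (h1 : e * b * (2 / 25 + b ^ 4 * (1 / 5 - 49 / 10000 * e ^ 2)) ≤ β)
    (h2 : κ ≤ 1 - e ^ 2 * b ^ 2 / 25 - e ^ 2 * b ^ 6 / 30) : 0 < scaledV e X Y := by
  obtain ⟨g0, ⟨g1, g1'⟩, g2⟩ := scaledG_bounds (sq_nonneg e) he' (hY.le.trans hb)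
  have e2 : Y ^ 2 = b ^ 2 := by rw [← hY, sq_abs]
  have e4 : Y ^ 4 = b ^ 4 := by rw [show (4 : ℕ) = 2 * 2 from rfl, pow_mul, e2, ← pow_mul]
  have e6 : Y ^ 6 = b ^ 6 := by rw [show (6 : ℕ) = 2 * 3 from rfl, pow_mul, e2, ← pow_mul]
  rw [e4, e6] at g0
  rw [e4] at g1'
  rw [e2, e6] at g2
  have hb0 : 0 ≤ b := hY ▸ abs_nonneg Y
  have h3 : e * Y * scaledG1 (e ^ 2) Y * X ≤ β * |X| := by
    have : e * Y * scaledG1 (e ^ 2) Y * X ≤ e * b * scaledG1 (e ^ 2) Y * |X| := by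
      refine (le_abs_self _).trans_eq ?_
      rw [abs_mul, abs_mul, abs_mul, hY, abs_of_nonneg he, abs_of_nonneg g1]
    refine this.trans (mul_le_mul_of_nonneg_right (le_trans ?_ h1) (abs_nonneg X))
    gcongr
  have h4 : κ * |X| ^ 2 ≤ scaledG2 (e ^ 2) Y * X ^ 2 := by
    rw [sq_abs]
    exact mul_le_mul_of_nonneg_right (h2.trans g2) (sq_nonneg X)
  have h5 : 0 < α - β * |X| + κ * |X| ^ 2 := by
    have : 0 < κ * (α - β * |X| + κ * |X| ^ 2) := by nlinarith [sq_nonneg (2 * κ * |X| - β)]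
    exact pos_of_mul_pos_right this hκ
  rw [scaledV]
  linarith

theorem scaledV_pos_on_frontier_small {e X Y : ℝ} (he : 0 ≤ e) (he' : e ≤ 2)
    (hY : |Y| ≤ 11 / 20) (h : |X| = 23 / 100 ∨ |Y| = 11 / 20) :
    0 < scaledV e X Y := by
  rcases h with h | h
  · refine scaledV_pos_of_abs_left_eq he he' (by norm_num) (by norm_num) h hY (by norm_num) ?_
    intro y hy hy'
    have h4 : y ^ 4 ≤ 92 / 1000 := by
      calc y ^ 4 ≤ (11 / 20) ^ 4 := by gcongr
        _ ≤ _ := by norm_num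
    have h2 : y ^ 2 ≤ 11 / 20 * y := by nlinarith
    have h6 : y ^ 6 ≤ 92 / 1000 * y ^ 2 := by nlinarith [sq_nonneg y]
    nlinarith [sq_nonneg (y ^ 2 - 1 / 9), sq_nonneg (y - 1 / 3)]
  · have hu : e ^ 2 ≤ 4 := by nlinarith
    refine scaledV_pos_of_abs_right_eq (α := 55 / 10000) (β := 12 / 100) (κ := 9 / 10) he
      (by linarith) h (by norm_num) (by norm_num) (by norm_num)
      (by norm_num; linarith) (by norm_num; nlinarith [sq_nonneg e]) (by norm_num; linarith)

theorem scaledV_pos_on_frontier_large {e X Y : ℝ} (he : 0 ≤ e) (he' : e ^ 2 ≤ 25 / 2)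
    (hY : |Y| ≤ 23 / 40) (h : |X| = 13 / 50 ∨ |Y| = 23 / 40) :
    0 < scaledV e X Y := by
  have heE : e ≤ 35356 / 10000 := by nlinarith
  rcases h with h | h
  · have hs := Real.sq_sqrt (show (0 : ℝ) ≤ 25 / 2 by norm_num)
    have hs0 := Real.sqrt_nonneg (25 / 2 : ℝ)
    have hs1 : √(25 / 2 : ℝ) ≤ 3536 / 1000 := by nlinarith
    refine scaledV_pos_of_abs_left_eq he (Real.le_sqrt_of_sq_le he') hs.le (by norm_num) h hY
      (by norm_num) ?_
    intro y hy hy'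
    rw [hs]
    have h4 : y ^ 4 ≤ 1094 / 10000 := by
      calc y ^ 4 ≤ (23 / 40) ^ 4 := by gcongr
        _ ≤ _ := by norm_num
    have h6 : y ^ 6 ≤ 1094 / 10000 * y ^ 2 := by nlinarith [sq_nonneg y]
    have h5 : √(25 / 2 : ℝ) * (y * (2 / 25 + y ^ 4 / 5)) ≤
      3536 / 1000 * (y * (2 / 25 + y ^ 4 / 5)) := by gcongr
    have h7 : y ^ 5 ≤ 23 / 40 * y ^ 4 := by nlinarith [pow_nonneg hy 4]
    nlinarith [sq_nonneg (y ^ 2 - 17 / 100), sq_nonneg (y - 41 / 100)]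
  · refine scaledV_pos_of_abs_right_eq (α := 139 / 10000) (β := 2 / 10) (κ := 81 / 100) he
      he' h (by norm_num) (by norm_num) (by norm_num)
      (by norm_num; linarith) (by norm_num; nlinarith [sq_nonneg e]) (by norm_num; linarith)

/-- The numerator of the coefficient of `x ^ 2 * y ^ 4` in the derivative of the Lyapunov function
`lyapunovFn` along solutions, where `s = y ^ 6` and `t = x * y`. -/
def lyapunovCrossNumerator (m p α β s t : ℝ) : ℝ :=
  (2 * m - 1 + m ^ 2 * t) * ((1 + m * t) ^ 2 + (1 + t)) * (1 + t) * (1 + m * t)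
    - (1 + m * t) ^ 6 + m * (1 + t) ^ 4
    + p * ((1 + t) ^ 3 * (1 + m * t) ^ 5 * (6 * m * s - 6 * t - 2 * t ^ 2))
    + β * ((1 + m * t) ^ 5 * ((1 + m * t) * (1 - t) + 2 * (1 + t)))
    + α * ((1 + t) ^ 3 * (5 + (1 + m) * t - 3 * m * t ^ 2))

theorem crossNumerator_main_le {m t : ℝ} (hm : 1 / 2 ≤ m) (hm' : m ≤ 3 / 5) (ht : |t| ≤ 53 / 100) :
    (2 * m - 1 + m ^ 2 * t) * ((1 + m * t) ^ 2 + (1 + t)) * (1 + t) * (1 + m * t)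
    - (1 + m * t) ^ 6 + m * (1 + t) ^ 4 ≤ (5 * m - 3) + (10 * m ^ 2 - 3) * t
      + (10 * m ^ 3 - 5 * m ^ 2 + 3 * m - 1) * t ^ 2
      + (5 * m ^ 4 - 10 * m ^ 3 + 3 * m) * t ^ 3 := by
  obtain ⟨ht1, ht2⟩ := abs_le.1 ht
  have hm0 : 0 ≤ m := by linarith
  have h40 : 0 ≤ m ^ 4 := by positivity
  have h6 : 1 ≤ m ^ 3 * (10 - 365 / 100 * m) := by
    have : 3 / 4 * m - 1 / 4 ≤ m ^ 3 := by nlinarith [mul_nonneg hm0 (sq_nonneg (m - 1 / 2))]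
    nlinarith
  have h5 : -(5 * m ^ 4 * t) ≤ 5 * m ^ 4 * (53 / 100) := by nlinarith
  have hk : 1 - 10 * m ^ 3 + m ^ 4 - 5 * m ^ 4 * t - m ^ 5 * t ^ 2 ≤ 0 := by
    have : 0 ≤ m ^ 5 * t ^ 2 := by positivity
    nlinarith
  have : t ^ 4 * (m * (1 - 10 * m ^ 3 + m ^ 4 - 5 * m ^ 4 * t - m ^ 5 * t ^ 2)) ≤ 0 :=
    mul_nonpos_of_nonneg_of_nonpos (by positivity) (mul_nonpos_of_nonneg_of_nonpos hm0 hk)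
  linarith

theorem crossNumerator_alpha_le {m t : ℝ} (hm : 1 / 2 ≤ m)
    (ht : |t| ≤ 53 / 100) :
    (1 + t) ^ 3 * (5 + (1 + m) * t - 3 * m * t ^ 2) ≤
      5 + (16 + m) * t + 18 * t ^ 2 + (8 - 6 * m) * t ^ 3 := by
  obtain ⟨ht1, ht2⟩ := abs_le.1 ht
  have : t ^ 4 * (1 - 8 * m - 3 * m * t) ≤ 0 :=
    mul_nonpos_of_nonneg_of_nonpos (by positivity) (by nlinarith)
  linarith

theorem crossNumerator_beta_le {m t : ℝ} (hm : 1 / 2 ≤ m) (hm' : m ≤ 3 / 5)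
    (ht : |t| ≤ 53 / 100) :
    (1 + m * t) ^ 5 * ((1 + m * t) * (1 - t) + 2 * (1 + t)) ≤ 20 := by
  obtain ⟨ht1, ht2⟩ := abs_le.1 ht
  have h0 : 0 ≤ 1 + m * t := by nlinarith
  have h1 : 1 + m * t ≤ 132 / 100 := by nlinarith
  have h2 : (1 + m * t) ^ 5 ≤ (132 / 100) ^ 5 := by gcongr
  have h3 : (1 + m * t) * (1 - t) + 2 * (1 + t) ≤ 47 / 10 := by nlinarith
  calc _ ≤ (132 / 100 : ℝ) ^ 5 * (47 / 10) := by
        refine mul_le_mul h2 h3 ?_ (by positivity)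
        have : 0 ≤ (1 + m * t) * (1 - t) := mul_nonneg h0 (by linarith)
        linarith
    _ ≤ 20 := by norm_num

theorem crossNumerator_p_le_of_nonneg {m s t : ℝ} (hm : 1 / 2 ≤ m) (hm' : m ≤ 3 / 5)
    (hs : s ≤ 1 / 2) (ht0 : 0 ≤ t) (ht : t ≤ 53 / 100) :
    (1 + t) ^ 3 * (1 + m * t) ^ 5 * (6 * m * s - 6 * t - 2 * t ^ 2) ≤
      6 * m * s + (6 * m * s * (3 + 5 * m) - 6) * t
        + (6 * m * s * (3 + 15 * m + 10 * m ^ 2) - 6 * (3 + 5 * m) - 2) * t ^ 2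
        + (6 * m * s * (1 + 15 * m + 30 * m ^ 2 + 10 * m ^ 3) - 6 * (3 + 15 * m + 10 * m ^ 2)
          - 2 * (3 + 5 * m)) * t ^ 3 := by
  have hm0 : 0 ≤ m := by linarith
  obtain ⟨R, hR⟩ : ∃ R, R = 5 * m + 30 * m ^ 2 + 30 * m ^ 3 + 5 * m ^ 4
      + (10 * m ^ 2 + 30 * m ^ 3 + 15 * m ^ 4 + m ^ 5) * t
      + (10 * m ^ 3 + 15 * m ^ 4 + 3 * m ^ 5) * t ^ 2 + (5 * m ^ 4 + 3 * m ^ 5) * t ^ 3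
      + m ^ 5 * t ^ 4 := ⟨_, rfl⟩
  have hR0 : 0 ≤ R := by rw [hR]; positivity
  have hR1 : R ≤ 50 := by
    calc R ≤ 5 * (3 / 5) + 30 * (3 / 5) ^ 2 + 30 * (3 / 5) ^ 3 + 5 * (3 / 5) ^ 4
      + (10 * (3 / 5) ^ 2 + 30 * (3 / 5) ^ 3 + 15 * (3 / 5) ^ 4 + (3 / 5) ^ 5) * (53 / 100)
      + (10 * (3 / 5) ^ 3 + 15 * (3 / 5) ^ 4 + 3 * (3 / 5) ^ 5) * (53 / 100) ^ 2
      + (5 * (3 / 5) ^ 4 + 3 * (3 / 5) ^ 5) * (53 / 100) ^ 3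
      + (3 / 5) ^ 5 * (53 / 100) ^ 4 := by rw [hR]; gcongr
      _ ≤ 50 := by norm_num
  have h1 : 6 * m * s * R ≤ 9 / 5 * 50 := by
    have : 6 * m * s ≤ 9 / 5 := by nlinarith
    nlinarith
  have h2 : 15 ≤ 1 + 15 * m + 30 * m ^ 2 + 10 * m ^ 3 := by
    have : 0 ≤ m ^ 3 := by positivity
    nlinarith
  have h3 : t ^ 4 * (6 * m * s * R - 6 * (1 + 15 * m + 30 * m ^ 2 + 10 * m ^ 3 + R * t)
      - 2 * (3 + 15 * m + 10 * m ^ 2 + (1 + 15 * m + 30 * m ^ 2 + 10 * m ^ 3) * t + R * t ^ 2))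
          ≤ 0 := by
    refine mul_nonpos_of_nonneg_of_nonpos (by positivity) ?_
    have : 0 ≤ R * t := by positivity
    have : 0 ≤ 3 + 15 * m + 10 * m ^ 2 + (1 + 15 * m + 30 * m ^ 2 + 10 * m ^ 3) * t
      + R * t ^ 2 := by positivity
    linarith
  rw [hR] at h3
  linarith

theorem crossNumerator_p_le_of_nonpos {m s t : ℝ} (hm : 1 / 2 ≤ m) (hm' : m ≤ 3 / 5)
    (hs : 0 ≤ s) (ht0 : t ≤ 0) (ht : -53 / 100 ≤ t) :
    (1 + t) ^ 3 * (1 + m * t) ^ 5 * (6 * m * s - 6 * t - 2 * t ^ 2) ≤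
      (1 + (3 + 5 * m) * t + (3 + 15 * m + 10 * m ^ 2) * t ^ 2)
        * (6 * m * s - 6 * t - 2 * t ^ 2) := by
  have hm0 : 0 ≤ m := by linarith
  refine mul_le_mul_of_nonneg_right ?_ (by nlinarith [mul_nonneg hm0 hs])
  have hR : (1 + t) ^ 3 ≤ 1 + 3 * t + 3 * t ^ 2 := by
    nlinarith [pow_nonneg (neg_nonneg.2 ht0) 3]
  obtain ⟨r, hr⟩ : ∃ r, r = -(m * t) := ⟨_, rfl⟩
  have hr0 : 0 ≤ r := by nlinarith
  have hr1 : r ≤ 32 / 100 := by nlinarith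
  have hQ : (1 + m * t) ^ 5 ≤ 1 - 5 * r + 10 * r ^ 2 := by
    have : r ^ 3 * (-10 + 5 * r - r ^ 2) ≤ 0 :=
      mul_nonpos_of_nonneg_of_nonpos (by positivity) (by nlinarith)
    rw [show m * t = -r by linarith]
    linarith
  have h1 : (1 + t) ^ 3 * (1 + m * t) ^ 5 ≤ (1 + 3 * t + 3 * t ^ 2) * (1 - 5 * r + 10 * r ^ 2) :=
    mul_le_mul hR hQ (pow_nonneg (by linarith) 5) (by nlinarith [sq_nonneg (1 + 2 * t)])
  have h2 : (1 + 3 * t + 3 * t ^ 2) * (1 - 5 * r + 10 * r ^ 2) -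
     (1 + (3 + 5 * m) * t + (3 + 15 * m + 10 * m ^ 2) * t ^ 2) ≤ 0 := by
    have : t * r * (30 * r - 15 * t + 30 * t * r) ≤ 0 :=
      mul_nonpos_of_nonpos_of_nonneg (mul_nonpos_of_nonpos_of_nonneg ht0 hr0) (by nlinarith)
    subst hr
    nlinarith
  linarith

theorem crossNumerator_coeff_bounds {δ m : ℝ} (hm : m = (3 - δ) / 5) (h0 : 0 ≤ δ) (h1 : δ ≤ 1 / 2) :
    10 * m ^ 2 - 3 = 3 / 5 - 12 / 5 * δ + 2 / 5 * δ ^ 2 ∧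
    10 * m ^ 3 - 5 * m ^ 2 + 3 * m - 1 ≤ 29 / 25 - 13 / 10 * δ ∧
    288 / 1000 + 1 / 2 * δ ≤ 5 * m ^ 4 - 10 * m ^ 3 + 3 * m ∧
    5 * m ^ 4 - 10 * m ^ 3 + 3 * m ≤ 288 / 1000 + 7 / 10 * δ ∧
    3 + 15 * m + 10 * m ^ 2 = 78 / 5 - 27 / 5 * δ + 2 / 5 * δ ^ 2 ∧
    1 + 15 * m + 30 * m ^ 2 + 10 * m ^ 3 ≤ 23 := by
  subst hm
  have h2 : 0 ≤ δ ^ 2 := by positivity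
  have h3 : δ ^ 2 ≤ 1 / 2 * δ := by nlinarith
  have h4 : δ ^ 3 ≤ 1 / 2 * δ ^ 2 := by nlinarith
  have h5 : 0 ≤ δ ^ 3 := by positivity
  have h6 : 0 ≤ δ ^ 4 := by positivity
  have h7 : δ ^ 4 ≤ 1 / 2 * δ ^ 3 := by nlinarith
  exact ⟨by ring, by linarith, by linarith, by linarith, by ring, by linarith⟩

theorem crossNumerator_le_of_nonneg {δ p α w m s t : ℝ} (hm : m = (3 - δ) / 5) (hδ : 0 ≤ δ)
    (hδ' : δ ≤ 1 / 2) (hp : 0 ≤ p) (hα : 0 ≤ α) (hs : s ≤ 1 / 2) (hw0 : 0 ≤ w)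
    (hw : 6 * m * s ≤ w) (ht0 : 0 ≤ t) (ht : t ≤ 53 / 100) :
    lyapunovCrossNumerator m p (α * δ) (δ / 1000) s t ≤
      (-1 + 1 / 50 + 5 * α) * δ + p * w
      + (3 / 5 - 12 / 5 * δ + 2 / 5 * δ ^ 2 + 83 / 5 * α * δ + p * (w * (6 - δ) - 6)) * t
      + (29 / 25 - 13 / 10 * δ + 18 * α * δ + p * (w * (78 / 5) - 38 + 6 * δ)) * t ^ 2
      + (288 / 1000 + 7 / 10 * δ + 5 * α * δ + p * (23 * w - 528 / 5 + 172 / 5 * δ)) * t ^ 3 := by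
  have hm1 : 1 / 2 ≤ m := by linarith
  have hm2 : m ≤ 3 / 5 := by linarith
  have ht'' : |t| ≤ 53 / 100 := by rwa [abs_of_nonneg ht0]
  obtain ⟨k1, k2, -, k3, f2, f3⟩ := crossNumerator_coeff_bounds hm hδ hδ'
  have f1 : 3 + 5 * m = 6 - δ := by linarith
  have h1 := crossNumerator_main_le hm1 hm2 ht''
  have h2 := mul_le_mul_of_nonneg_left (crossNumerator_alpha_le hm1 ht'')
    (show 0 ≤ α * δ by positivity)
  have h3 := mul_le_mul_of_nonneg_left (crossNumerator_beta_le hm1 hm2 ht'')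
    (show 0 ≤ δ / 1000 by linarith)
  have h4 := mul_le_mul_of_nonneg_left
    (crossNumerator_p_le_of_nonneg hm1 hm2 (s := s) hs ht0 ht) hp
  have h5 : 6 * m * s + (6 * m * s * (3 + 5 * m) - 6) * t
        + (6 * m * s * (3 + 15 * m + 10 * m ^ 2) - 6 * (3 + 5 * m) - 2) * t ^ 2
        + (6 * m * s * (1 + 15 * m + 30 * m ^ 2 + 10 * m ^ 3) - 6 * (3 + 15 * m + 10 * m ^ 2)
          - 2 * (3 + 5 * m)) * t ^ 3 ≤ w + (w * (6 - δ) - 6) * t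
          + (w * (78 / 5) - 38 + 6 * δ) * t ^ 2 + (23 * w - 528 / 5 + 172 / 5 * δ) * t ^ 3 := by
    have g1 : 6 * m * s * (3 + 5 * m) ≤ w * (6 - δ) := by
      rw [f1]; exact mul_le_mul_of_nonneg_right hw (by linarith)
    have g2 : 6 * m * s * (3 + 15 * m + 10 * m ^ 2) ≤ w * (78 / 5) := by
      refine mul_le_mul hw ?_ (by positivity) hw0
      rw [f2]; nlinarith
    have g3 : 6 * m * s * (1 + 15 * m + 30 * m ^ 2 + 10 * m ^ 3) ≤ 23 * w := by
      rw [mul_comm 23]; exact mul_le_mul hw f3 (by positivity) hw0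
    refine add_le_add (add_le_add (add_le_add hw ?_) ?_) ?_ <;>
      refine mul_le_mul_of_nonneg_right ?_ (by positivity)
    · linarith
    · linarith
    · rw [f1, f2]; nlinarith
  have h6 := mul_le_mul_of_nonneg_left h5 hp
  have h7 := mul_le_mul_of_nonneg_right k2 (sq_nonneg t)
  have h8 := mul_le_mul_of_nonneg_right k3 (pow_nonneg ht0 3)
  have h9 : 0 ≤ α * δ * ((3 / 5 - m) * t) := by
    have : 0 ≤ 3 / 5 - m := by linarith
    positivity
  have h10 : 0 ≤ α * δ * ((6 * m - 3) * t ^ 3) := by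
    have : 0 ≤ 6 * m - 3 := by linarith
    positivity
  rw [k1] at h1
  rw [lyapunovCrossNumerator]
  linarith

theorem crossNumerator_le_of_nonpos {δ p α w m s r : ℝ} (hm : m = (3 - δ) / 5) (hδ : 0 ≤ δ)
    (hδ' : δ ≤ 1 / 2) (hp : 0 ≤ p) (hα : 0 ≤ α) (hs : 0 ≤ s)
    (hw : 6 * m * s ≤ w) (hr0 : 0 ≤ r) (hr : r ≤ 53 / 100) :
    lyapunovCrossNumerator m p (α * δ) (δ / 1000) s (-r) ≤
      (-1 + 1 / 50 + 5 * α) * δ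
      - (3 / 5 - 12 / 5 * δ + 2 / 5 * δ ^ 2 + 33 / 2 * α * δ) * r
      + (29 / 25 - 13 / 10 * δ + 18 * α * δ) * r ^ 2
      - (288 / 1000 + 1 / 2 * δ + 22 / 5 * α * δ) * r ^ 3
      + p * ((1 - (6 - δ) * r + (78 / 5 - 27 / 5 * δ + 2 / 5 * δ ^ 2) * r ^ 2)
        * (w + 6 * r - 2 * r ^ 2)) := by
  have hm1 : 1 / 2 ≤ m := by linarith
  have hm2 : m ≤ 3 / 5 := by linarith
  have ht'' : |-r| ≤ 53 / 100 := by rwa [abs_neg, abs_of_nonneg hr0]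
  obtain ⟨k1, k2, k3, -, f2, -⟩ := crossNumerator_coeff_bounds hm hδ hδ'
  have f1 : 3 + 5 * m = 6 - δ := by linarith
  have h1 := crossNumerator_main_le hm1 hm2 ht''
  have h2 := mul_le_mul_of_nonneg_left (crossNumerator_alpha_le hm1 ht'')
    (show 0 ≤ α * δ by positivity)
  have h3 := mul_le_mul_of_nonneg_left (crossNumerator_beta_le hm1 hm2 ht'')
    (show 0 ≤ δ / 1000 by linarith)
  have h4 := mul_le_mul_of_nonneg_left
    (crossNumerator_p_le_of_nonpos hm1 hm2 hs (neg_nonpos.2 hr0) (by linarith)) hp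
  have h5 : (1 + (3 + 5 * m) * (-r) + (3 + 15 * m + 10 * m ^ 2) * (-r) ^ 2)
        * (6 * m * s - 6 * (-r) - 2 * (-r) ^ 2) ≤
      (1 - (6 - δ) * r + (78 / 5 - 27 / 5 * δ + 2 / 5 * δ ^ 2) * r ^ 2)
        * (w + 6 * r - 2 * r ^ 2) := by
    rw [f1, f2]
    have : 0 ≤ 1 - (6 - δ) * r + (78 / 5 - 27 / 5 * δ + 2 / 5 * δ ^ 2) * r ^ 2 := by
      nlinarith [sq_nonneg (1 - 3 * r), mul_nonneg hδ hr0, mul_nonneg hδ (sq_nonneg r),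
        mul_nonneg (sub_nonneg.2 hδ') (sq_nonneg r), sq_nonneg (δ * r)]
    have h := mul_le_mul_of_nonneg_left (show 6 * m * s + 6 * r - 2 * r ^ 2 ≤
      w + 6 * r - 2 * r ^ 2 by linarith) this
    linarith
  have h6 := mul_le_mul_of_nonneg_left h5 hp
  have h7 := mul_le_mul_of_nonneg_right k2 (sq_nonneg r)
  have h8 := mul_le_mul_of_nonneg_right k3 (pow_nonneg hr0 3)
  have h9 : 0 ≤ α * δ * ((m - 1 / 2) * r) := by
    have : 0 ≤ m - 1 / 2 := by linarith
    positivity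
  have h10 : 0 ≤ α * δ * ((18 / 5 - 6 * m) * r ^ 3) := by
    have : 0 ≤ 18 / 5 - 6 * m := by linarith
    positivity
  rw [k1] at h1
  rw [lyapunovCrossNumerator]
  linarith

theorem crossPolynomial_small_of_nonneg {δ t : ℝ} (hδ : 0 < δ) (hδ' : δ ≤ 4 / 25) (h0 : 0 ≤ t) :
    (-1 + 1 / 50 + 5 * (13 / 100)) * δ + 1 / 10 * (5 / 2 * δ)
      + (3 / 5 - 12 / 5 * δ + 2 / 5 * δ ^ 2 + 83 / 5 * (13 / 100) * δ
          + 1 / 10 * ((5 / 2 * δ) * (6 - δ) - 6)) * t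
      + (29 / 25 - 13 / 10 * δ + 18 * (13 / 100) * δ
          + 1 / 10 * ((5 / 2 * δ) * (78 / 5) - 38 + 6 * δ)) * t ^ 2
      + (288 / 1000 + 7 / 10 * δ + 5 * (13 / 100) * δ
          + 1 / 10 * (23 * (5 / 2 * δ) - 528 / 5 + 172 / 5 * δ)) * t ^ 3 < 0 := by
  have h3 := mul_nonneg (show 0 ≤ 10 - 11 * δ by linarith) (pow_nonneg h0 3)
  have h2 := mul_nonneg (show 0 ≤ 4 / 25 - δ by linarith) (sq_nonneg t)
  have h1 := mul_nonneg (mul_nonneg hδ.le (show 0 ≤ 4 / 25 - δ by linarith)) h0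
  have h4 := pow_nonneg h0 3
  have h5 := mul_nonneg hδ.le h4
  nlinarith [sq_nonneg (t - 2 / 5 * δ)]

theorem crossPolynomial_small_of_nonpos {δ r : ℝ} (hδ : 0 < δ) (hδ' : δ ≤ 4 / 25) (hr0 : 0 ≤ r)
    (hr1 : r ≤ 254 / 1000) (hr2 : r ^ 2 ≤ 401 / 1000 * δ) :
    (-1 + 1 / 50 + 5 * (13 / 100)) * δ
      - (3 / 5 - 12 / 5 * δ + 2 / 5 * δ ^ 2 + 33 / 2 * (13 / 100) * δ) * r
      + (29 / 25 - 13 / 10 * δ + 18 * (13 / 100) * δ) * r ^ 2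
      - (288 / 1000 + 1 / 2 * δ + 22 / 5 * (13 / 100) * δ) * r ^ 3
      + 1 / 10 * ((1 - (6 - δ) * r + (78 / 5 - 27 / 5 * δ + 2 / 5 * δ ^ 2) * r ^ 2)
        * ((5 / 2 * δ) + 6 * r - 2 * r ^ 2)) < 0 := by
  have hδr : 0 ≤ δ * r := by positivity
  have hδr2 : 0 ≤ δ ^ 2 * r := by positivity
  have h2 : r ^ 2 * (-264 / 100 + 554 / 100 * δ + 10272 / 1000 * r
      - (135 / 100 - 1 / 10 * δ) * δ ^ 2 - (4512 / 1000 - 24 / 100 * δ) * (δ * r)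
      - (312 / 100 - 108 / 100 * δ + 8 / 100 * δ ^ 2) * r ^ 2)
      ≤ r ^ 2 * (-1753 / 1000 + 10272 / 1000 * r) := by
    refine mul_le_mul_of_nonneg_left ?_ (sq_nonneg r)
    have a1 : 0 ≤ (135 / 100 - 1 / 10 * δ) * δ ^ 2 := mul_nonneg (by linarith) (sq_nonneg _)
    have a2 : 0 ≤ (4512 / 1000 - 24 / 100 * δ) * (δ * r) := mul_nonneg (by linarith) hδr
    have a3 : 0 ≤ (312 / 100 - 108 / 100 * δ + 8 / 100 * δ ^ 2) * r ^ 2 :=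
        mul_nonneg (by nlinarith) (sq_nonneg _)
    linarith
  have h3 : r ^ 2 * (-1753 / 1000 + 10272 / 1000 * r) < 8 / 100 * δ + 1245 / 1000 * (δ * r) := by
    rcases le_total (-1753 / 1000 + 10272 / 1000 * r) 0 with h | h
    · have := mul_nonneg (sq_nonneg r) (neg_nonneg.2 h)
      linarith
    · have := mul_le_mul_of_nonneg_right hr2 h
      nlinarith
  linarith

theorem crossPolynomial_large_of_nonneg {δ t : ℝ} (hδ : 4 / 25 ≤ δ) (hδ' : δ ≤ 1 / 2) (h0 : 0 ≤ t)
    (ht : t ^ 2 ≤ 559 / 1000 * δ) :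
    (-1 + 1 / 50 + 5 * (42 / 1000)) * δ + 1 / 50 * (326 / 100 * δ - 108 / 100 * δ ^ 2)
      + (3 / 5 - 12 / 5 * δ + 2 / 5 * δ ^ 2 + 83 / 5 * (42 / 1000) * δ
          + 1 / 50 * ((326 / 100 * δ - 108 / 100 * δ ^ 2) * (6 - δ) - 6)) * t
      + (29 / 25 - 13 / 10 * δ + 18 * (42 / 1000) * δ
          + 1 / 50 * ((326 / 100 * δ - 108 / 100 * δ ^ 2) * (78 / 5) - 38 + 6 * δ)) * t ^ 2
      + (288 / 1000 + 7 / 10 * δ + 5 * (42 / 1000) * δ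
          + 1 / 50 * (23 * (326 / 100 * δ - 108 / 100 * δ ^ 2) - 528 / 5 + 172 / 5 * δ)) * t ^ 3
          < 0 := by
  have ht1 : t ≤ 1495 / 10000 + 935 / 1000 * δ := by
    nlinarith [sq_nonneg (δ - 4 / 25)]
  have hδ2 : δ ^ 2 ≤ 1 / 2 * δ := by nlinarith
  have hδt : 0 ≤ (δ * (1 / 2 - δ)) * t := mul_nonneg (by nlinarith) h0
  have hδt3 : 0 ≤ δ ^ 2 * (1 / 2 - δ) * t :=
      mul_nonneg (mul_nonneg (by positivity) (by linarith)) h0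
  have h3 : t ^ 2 * ((4 / 10 + 594 / 1000 * δ) + (-1824 / 1000 + 31 / 10 * δ) * t) ≤
      max 0 (559 / 1000 * δ * ((4 / 10 + 594 / 1000 * δ) + (-1824 / 1000 + 31 / 10 * δ) * t)) := by
    rcases le_total ((4 / 10 + 594 / 1000 * δ) + (-1824 / 1000 + 31 / 10 * δ) * t) 0 with h | h
    · exact (mul_nonpos_of_nonneg_of_nonpos (sq_nonneg _) h).trans (le_max_left _ _)
    · exact (mul_le_mul_of_nonneg_right ht h).trans (le_max_right _ _)
  have h4 : max 0 (559 / 1000 * δ * ((4 / 10 + 594 / 1000 * δ)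
      + (-1824 / 1000 + 31 / 10 * δ) * t)) <
      7048 / 10000 * δ + 216 / 10000 * δ ^ 2 - (48 / 100 - 13 / 10 * δ + 22 / 100 * δ ^ 2) * t := by
    refine max_lt ?_ ?_
    · have : (48 / 100 - 13 / 10 * δ + 22 / 100 * δ ^ 2) * t < 7048 / 10000 * δ := by
        rcases le_total (48 / 100 - 13 / 10 * δ + 22 / 100 * δ ^ 2) 0 with h | h
        · have := mul_nonneg (neg_nonneg.2 h) h0
          linarith
        · have := mul_le_mul_of_nonneg_left ht1 h
          nlinarith
      nlinarith
    · have : (48 / 100 - 2319 / 1000 * δ + 1954 / 1000 * δ ^ 2) * t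
          < 4812 / 10000 * δ - 311 / 1000 * δ ^ 2 := by
        rcases le_total (48 / 100 - 2319 / 1000 * δ + 1954 / 1000 * δ ^ 2) 0 with h | h
        · have := mul_nonneg (neg_nonneg.2 h) h0
          nlinarith
        · have := mul_le_mul_of_nonneg_left ht1 h
          nlinarith [mul_nonneg (sub_nonneg.2 hδ) (sub_nonneg.2 hδ'),
              mul_nonneg (mul_nonneg (sub_nonneg.2 hδ) (sub_nonneg.2 hδ')) (sub_nonneg.2 hδ')]
      nlinarith
  have h5 : 0 ≤ δ ^ 2 * t ^ 2 := by positivity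
  have h6 : 0 ≤ δ ^ 2 * t ^ 3 := by positivity
  have h7 : 0 ≤ δ * t ^ 3 := by positivity
  have h8 : 0 ≤ δ * t ^ 2 := by positivity
  have h9 : 0 ≤ δ * t := by positivity
  have h10 := h3.trans_lt h4
  nlinarith [h10]

theorem crossPolynomial_large_univariate {δ : ℝ} (hδ : 4 / 25 ≤ δ) (hδ' : δ ≤ 1 / 2) :
    (-48 / 100 + 13158 / 10000 * δ - 2052 / 10000 * δ ^ 2
      + 559 / 1000 * δ * (1824 / 1000 - 13728 / 10000 * δ + 48 / 1000 * δ ^ 2))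
        * (26435 / 100000 + 5287 / 10000 * δ)
      + 559 / 1000 * δ * (4 / 10 + 594 / 1000 * δ - 68 / 100 * δ ^ 2 + 15 / 100 * δ ^ 3
        - 559 / 1000 * δ * (624 / 1000 - 216 / 1000 * δ))
            < 7048 / 10000 * δ + 216 / 10000 * δ ^ 2 := by
  obtain ⟨u, hu⟩ : ∃ u, u = 1 / 2 - δ := ⟨_, rfl⟩
  have hu0 : 0 ≤ u := by linarith
  have hu1 : u ≤ 34 / 100 := by linarith
  have hu2 : u ^ 2 ≤ 34 / 100 * u := by nlinarith
  have hu3 : u ^ 3 ≤ 34 / 100 * u ^ 2 := by nlinarith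
  have hu4 : u ^ 4 ≤ 34 / 100 * u ^ 3 := by nlinarith [pow_nonneg hu0 3]
  rw [show δ = 1 / 2 - u by linarith]
  linarith

theorem crossPolynomial_large_of_nonpos {δ r : ℝ} (hδ : 4 / 25 ≤ δ) (hδ' : δ ≤ 1 / 2) (hr0 : 0 ≤ r)
    (hr1 : r ≤ 53 / 100) (hr2 : r ^ 2 ≤ 559 / 1000 * δ) :
    (-1 + 1 / 50 + 5 * (42 / 1000)) * δ
      - (3 / 5 - 12 / 5 * δ + 2 / 5 * δ ^ 2 + 33 / 2 * (42 / 1000) * δ) * r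
      + (29 / 25 - 13 / 10 * δ + 18 * (42 / 1000) * δ) * r ^ 2
      - (288 / 1000 + 1 / 2 * δ + 22 / 5 * (42 / 1000) * δ) * r ^ 3
      + 1 / 50 * ((1 - (6 - δ) * r + (78 / 5 - 27 / 5 * δ + 2 / 5 * δ ^ 2) * r ^ 2)
        * ((326 / 100 * δ - 108 / 100 * δ ^ 2) + 6 * r - 2 * r ^ 2)) < 0 := by
  have hδ0 : 0 ≤ δ := by linarith
  have ht1 : r ≤ 26435 / 100000 + 5287 / 10000 * δ := by
    nlinarith [sq_nonneg (δ - 1 / 2)]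
  obtain ⟨r2, hr2'⟩ : ∃ c, c = 4 / 10 + 594 / 1000 * δ - 68 / 100 * δ ^ 2 + 15 / 100 * δ ^ 3 :=
      ⟨_, rfl⟩
  obtain ⟨r3, hr3⟩ : ∃ c, c = 1824 / 1000 - 13728 / 10000 * δ + 48 / 1000 * δ ^ 2 := ⟨_, rfl⟩
  obtain ⟨r4, hr4⟩ : ∃ c, c = 624 / 1000 - 216 / 1000 * δ := ⟨_, rfl⟩
  have d2 : 0 ≤ δ ^ 2 := by positivity
  have d3 : 0 ≤ δ ^ 3 := by positivity
  have d4 : δ ^ 3 ≤ 1 / 2 * δ ^ 2 := by nlinarith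
  have d5 : δ ^ 2 ≤ 1 / 2 * δ := by nlinarith
  have d6 : 0 ≤ δ ^ 4 := by positivity
  have d7 : δ ^ 4 ≤ 1 / 2 * δ ^ 3 := by nlinarith only [mul_nonneg d3 (sub_nonneg.2 hδ')]
  have h34 : 0 ≤ r3 - r4 * r := by
    have : r4 * r ≤ 624 / 1000 * (53 / 100) := by
      refine mul_le_mul (by linarith) hr1 hr0 (by norm_num)
    linarith
  have h3 : r ^ 2 * (r * (r3 - r4 * r)) ≤ 559 / 1000 * δ * (r * (r3 - r4 * r)) :=
    mul_le_mul_of_nonneg_right hr2 (mul_nonneg hr0 h34)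
  have h24 : 0 ≤ r2 - 559 / 1000 * δ * r4 := by rw [hr2', hr4]; linarith
  have h2 := mul_le_mul_of_nonneg_right hr2 h24
  obtain ⟨c, hc⟩ : ∃ c, c = -48 / 100 + 13158 / 10000 * δ - 2052 / 10000 * δ ^ 2
      + 559 / 1000 * δ * r3 := ⟨_, rfl⟩
  have h5 : c * r + 559 / 1000 * δ * (r2 - 559 / 1000 * δ * r4)
      < 7048 / 10000 * δ + 216 / 10000 * δ ^ 2 := by
    rcases le_total c 0 with h | h
    · have := mul_nonneg (neg_nonneg.2 h) hr0
      rw [hr2', hr4]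
      linarith
    · have := mul_le_mul_of_nonneg_left ht1 h
      have := crossPolynomial_large_univariate hδ hδ'
      rw [hr2', hr4]
      rw [← hr3, ← hc] at this
      linarith
  have h6 : 0 ≤ δ ^ 3 * r := by positivity
  have h7 : r ^ 2 * (1 / 50 * ((326 / 100 * δ - 108 / 100 * δ ^ 2) * (78 / 5 - 27 / 5 * δ
      + 2 / 5 * δ ^ 2))) ≤ r ^ 2 * (10172 / 10000 * δ - 68 / 100 * δ ^ 2 + 15 / 100 * δ ^ 3) := by
    refine mul_le_mul_of_nonneg_left ?_ (sq_nonneg r)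
    linarith
  have h8 : 0 ≤ δ ^ 2 * r ^ 4 := by positivity
  have h9 : 0 ≤ δ * r ^ 2 := by positivity
  subst hc hr2' hr3 hr4
  linarith

theorem crossNumerator_neg_small {δ s t : ℝ} (hδ : 0 < δ) (hδ' : δ ≤ 4 / 25) (hs0 : 0 ≤ s)
    (hs : s ≤ 693 / 1000 * δ) (ht : t ^ 2 ≤ 401 / 1000 * δ) :
    lyapunovCrossNumerator ((3 - δ) / 5) (1 / 10) (13 / 100 * δ) (δ / 1000) s t < 0 := by
  have ht' : |t| ≤ 254 / 1000 := abs_le_of_sq_le_sq (by linarith) (by norm_num)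
  obtain ⟨ht1, ht2⟩ := abs_le.1 ht'
  have hw : 6 * ((3 - δ) / 5) * s ≤ 5 / 2 * δ := by nlinarith
  rcases le_total 0 t with h0 | h0
  · refine (crossNumerator_le_of_nonneg rfl hδ.le (by linarith) (by norm_num) (by norm_num)
      (by linarith) (by linarith) hw h0 (by linarith)).trans_lt ?_
    exact crossPolynomial_small_of_nonneg hδ hδ' h0
  · have h := crossNumerator_le_of_nonpos (p := 1 / 10) (α := 13 / 100) rfl hδ.le (by linarith)
      (by norm_num) (by norm_num) hs0 hw (neg_nonneg.2 h0) (by linarith)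
    rw [neg_neg] at h
    refine h.trans_lt ?_
    exact crossPolynomial_small_of_nonpos hδ hδ' (neg_nonneg.2 h0) (by linarith)
      (by rwa [neg_sq])

theorem crossNumerator_neg_large {δ s t : ℝ} (hδ : 4 / 25 ≤ δ) (hδ' : δ ≤ 1 / 2) (hs0 : 0 ≤ s)
    (hs : s ≤ 904 / 1000 * δ) (ht : t ^ 2 ≤ 559 / 1000 * δ) :
    lyapunovCrossNumerator ((3 - δ) / 5) (1 / 50) (42 / 1000 * δ) (δ / 1000) s t < 0 := by
  have ht' : |t| ≤ 53 / 100 := abs_le_of_sq_le_sq (by linarith) (by norm_num)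
  obtain ⟨ht1, ht2⟩ := abs_le.1 ht'
  have hw : 6 * ((3 - δ) / 5) * s ≤ 326 / 100 * δ - 108 / 100 * δ ^ 2 := by nlinarith
  rcases le_total 0 t with h0 | h0
  · refine (crossNumerator_le_of_nonneg rfl (by linarith) (by linarith) (by norm_num) (by norm_num)
      (by linarith) (by nlinarith) hw h0 (by linarith)).trans_lt ?_
    exact crossPolynomial_large_of_nonneg hδ hδ' h0 ht
  · have h := crossNumerator_le_of_nonpos (p := 1 / 50) (α := 42 / 1000) rfl (by linarith)
      (by linarith)
      (by norm_num) (by norm_num) hs0 hw (neg_nonneg.2 h0) (by linarith)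
    rw [neg_neg] at h
    refine h.trans_lt ?_
    exact crossPolynomial_large_of_nonpos hδ hδ' (neg_nonneg.2 h0) (by linarith)
      (by rwa [neg_sq])

theorem g2_eq {m q : ℝ} (hq : 0 ≤ q) (hm : m = 3 / 5 - q ^ 6 / 125) :
    g2 m = fun y => (1 / 89100) * (3 - 10 * m) * (3 + 35 * m) * y ^ 12
      - (1 / 6300) * q ^ 4 * (3 - 13 * m) * y ^ 8 + (1 / 90) * (3 - 10 * m) * y ^ 6
      - (1 / 25) * q ^ 4 * y ^ 2 + 1 := by
  have hc : (75 - 125 * m) ^ ((2 : ℝ) / 3) = q ^ 4 := by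
    rw [show 75 - 125 * m = q ^ (6 : ℝ) by rw [hm]; norm_num; ring, ← Real.rpow_mul hq,
      ← Real.rpow_natCast]
    norm_num
  funext y
  rw [g2, hc]

theorem hasDerivAt_g2 {m q : ℝ} (hq : 0 ≤ q) (hm : m = 3 / 5 - q ^ 6 / 125) (y : ℝ) :
    HasDerivAt (g2 m) ((1 / 7425) * (3 - 10 * m) * (3 + 35 * m) * y ^ 11
      - (2 / 1575) * q ^ 4 * (3 - 13 * m) * y ^ 7 + (1 / 15) * (3 - 10 * m) * y ^ 5
      - (2 / 25) * q ^ 4 * y) y := by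
  rw [g2_eq hq hm]
  refine (((((hasDerivAt_pow 12 y).const_mul _).sub ((hasDerivAt_pow 8 y).const_mul _)).add
    ((hasDerivAt_pow 6 y).const_mul _)).sub ((hasDerivAt_pow 2 y).const_mul _)
    |>.add_const 1).congr_deriv ?_
  norm_num
  ring

theorem g1_eq {m q : ℝ} (hq : 0 ≤ q) (hm : m = 3 / 5 - q ^ 6 / 125) :
    g1 m = fun y => (1 / 7425) * (3 - 10 * m) * (3 + 35 * m) * y ^ 11
      - (2 / 1575) * q ^ 4 * (3 - 13 * m) * y ^ 7 + (1 / 15) * (3 - 10 * m) * y ^ 5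
      - (2 / 25) * q ^ 4 * y :=
  funext fun y => (hasDerivAt_g2 hq hm y).deriv

theorem hasDerivAt_g1 {m q : ℝ} (hq : 0 ≤ q) (hm : m = 3 / 5 - q ^ 6 / 125) (y : ℝ) :
    HasDerivAt (g1 m) ((1 / 675) * (3 - 10 * m) * (3 + 35 * m) * y ^ 10
      - (2 / 225) * q ^ 4 * (3 - 13 * m) * y ^ 6 + (1 / 3) * (3 - 10 * m) * y ^ 4
      - (2 / 25) * q ^ 4) y := by
  rw [g1_eq hq hm]
  refine (((((hasDerivAt_pow 11 y).const_mul _).sub ((hasDerivAt_pow 7 y).const_mul _)).add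
    ((hasDerivAt_pow 5 y).const_mul _)).sub ((hasDerivAt_id' y).const_mul _)).congr_deriv ?_
  norm_num
  ring

theorem g0_eq {m q : ℝ} (hq : 0 ≤ q) (hm : m = 3 / 5 - q ^ 6 / 125) :
    g0 m = fun y => ((1 / 675) * (3 - 10 * m) * (3 + 35 * m) * y ^ 10
      - (2 / 225) * q ^ 4 * (3 - 13 * m) * y ^ 6 + (1 / 3) * (3 - 10 * m) * y ^ 4
      - (2 / 25) * q ^ 4) / 2 - (m / 2) * y ^ 5 * g1 m y + (5 / 3) * m * y ^ 4 * g2 m y := by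
  funext y
  rw [g0, ← (hasDerivAt_g1 hq hm y).deriv]
  rfl

theorem hasDerivAt_g0 {m q : ℝ} (hq : 0 ≤ q) (hm : m = 3 / 5 - q ^ 6 / 125) (y : ℝ) :
    HasDerivAt (g0 m) ((1 / 135) * (3 - 10 * m) * (3 + 35 * m) * y ^ 9
      - (2 / 75) * q ^ 4 * (3 - 13 * m) * y ^ 5 + (2 / 3) * (3 - 10 * m) * y ^ 3
      - (5 / 6) * m * y ^ 4 * g1 m y - (m / 2) * y ^ 5 *
        ((1 / 675) * (3 - 10 * m) * (3 + 35 * m) * y ^ 10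
        - (2 / 225) * q ^ 4 * (3 - 13 * m) * y ^ 6 + (1 / 3) * (3 - 10 * m) * y ^ 4
        - (2 / 25) * q ^ 4) + (20 / 3) * m * y ^ 3 * g2 m y) y := by
  have h2 : HasDerivAt (g2 m) (g1 m y) y := (hasDerivAt_g2 hq hm y).differentiableAt.hasDerivAt
  rw [g0_eq hq hm]
  refine ((((((((hasDerivAt_pow 10 y).const_mul _).sub ((hasDerivAt_pow 6 y).const_mul _)).add
    ((hasDerivAt_pow 4 y).const_mul _)).sub_const _).div_const 2).sub
    (((hasDerivAt_pow 5 y).const_mul _).mul (hasDerivAt_g1 hq hm y))).add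
    (((hasDerivAt_pow 4 y).const_mul _).mul h2)).congr_deriv ?_
  norm_num
  ring

theorem continuous_Vm {m q : ℝ} (hq : 0 ≤ q) (hm : m = 3 / 5 - q ^ 6 / 125) :
    Continuous (Vm m) := by
  have h0 : Continuous (g0 m) :=
    continuous_iff_continuousAt.2 fun y => (hasDerivAt_g0 hq hm y).continuousAt
  have h1 : Continuous (g1 m) :=
    continuous_iff_continuousAt.2 fun y => (hasDerivAt_g1 hq hm y).continuousAt
  have h2 : Continuous (g2 m) :=
    continuous_iff_continuousAt.2 fun y => (hasDerivAt_g2 hq hm y).continuousAt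
  unfold Vm
  fun_prop

theorem Vm_scaled {m q : ℝ} (hq : 0 ≤ q) (hm : m = 3 / 5 - q ^ 6 / 125) (X Y : ℝ) :
    Vm m (q ^ 2 * X, q * Y) = q ^ 4 * scaledV (q ^ 3) X Y := by
  simp only [Vm, g0_eq hq hm, g1_eq hq hm, g2_eq hq hm, scaledV, scaledG0, scaledG1, scaledG2]
  subst hm
  ring

/-- The derivative of `V_m` along a solution, up to a multiple of `V_m`, is a scaled polynomial
which has a sign near the origin. -/
theorem hasDerivWithinAt_Vm {m q t X Y : ℝ} (hq : 0 ≤ q) (hm : m = 3 / 5 - q ^ 6 / 125)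
    {γ : ℝ → ℝ × ℝ} {s : Set ℝ} (hγ : HasDerivWithinAt γ (bacciotti m (γ t)) s t)
    (hX : (γ t).1 = q ^ 2 * X) (hY : (γ t).2 = q * Y) :
    HasDerivWithinAt (fun r => Vm m (γ r)) (2 / 3 * divBacciotti m (γ t) * Vm m (γ t)
      + q ^ 14 * Y ^ 4 * (-2 / 1875 + Y ^ 4 / 375
      + (64 / 4375 - 634 / 984375 * (q ^ 3) ^ 2 + 56 / 10546875 * (q ^ 3) ^ 4) * Y ^ 6
      + X * Y ^ 7 * (q ^ 3) *
        ((52 / 1875 - 1871 / 1968750 * (q ^ 3) ^ 2 + 559 / 73828125 * (q ^ 3) ^ 4)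
        + (-988 / 12375 + 2539 / 618750 * (q ^ 3) ^ 2 - 1504 / 23203125 * (q ^ 3) ^ 4
          + 154 / 474609375 * (q ^ 3) ^ 6) * Y ^ 4)
      + Y ^ 10 * ((-32 / 275 + 353 / 61875 * (q ^ 3) ^ 2 - 388 / 4640625 * (q ^ 3) ^ 4
          + 4 / 10546875 * (q ^ 3) ^ 6)
        + (-52 / 9375 + 377 / 1406250 * (q ^ 3) ^ 2 - 221 / 52734375 * (q ^ 3) ^ 4
          + 169 / 7910156250 * (q ^ 3) ^ 6) * ((q ^ 3) ^ 2 * Y ^ 2)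
        + (988 / 61875 - 3211 / 3093750 * (q ^ 3) ^ 2 + 8398 / 348046875 * (q ^ 3) ^ 4
          - 4199 / 17402343750 * (q ^ 3) ^ 6 + 1729 / 1957763671875 * (q ^ 3) ^ 8)
          * ((q ^ 3) ^ 2 * Y ^ 6)))) s t := by
  have hx : HasDerivWithinAt (fun r => (γ r).1) (bacciotti m (γ t)).1 s t := hγ.fst
  have hy : HasDerivWithinAt (fun r => (γ r).2) (bacciotti m (γ t)).2 s t := hγ.snd
  have h0 := (hasDerivAt_g0 hq hm (γ t).2).comp_hasDerivWithinAt t hy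
  have h1 := (hasDerivAt_g1 hq hm (γ t).2).comp_hasDerivWithinAt t hy
  have h2 := (hasDerivAt_g2 hq hm (γ t).2).comp_hasDerivWithinAt t hy
  refine ((h0.add (h1.mul hx)).add (h2.mul (hx.pow 2))).congr_deriv ?_
  simp only [Vm, Function.comp_apply, bacciotti, divBacciotti, Pi.pow_apply, g0_eq hq hm,
    g1_eq hq hm, g2_eq hq hm, hX, hY]
  subst hm
  push_cast
  ring

/-- A strict Lyapunov function for Bacciotti's system near the origin. -/
def lyapunovFn (m p α β : ℝ) (z : ℝ × ℝ) : ℝ :=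
  (1 / 2 + β * (z.1 * z.2)) * z.1 ^ 2 / (1 + z.1 * z.2) ^ 2
    + (1 / 4 - α * (z.1 * z.2)) * z.2 ^ 4 / (1 + m * (z.1 * z.2)) ^ 4
    + p * (z.1 ^ 2 * z.2 ^ 6 + z.2 ^ 10 / 5)

/-- The derivative of `lyapunovFn` along solutions. -/
def lyapunovDot (m p α β : ℝ) (z : ℝ × ℝ) : ℝ :=
  -(β * z.1 ^ 4 / (1 + z.1 * z.2))
    + lyapunovCrossNumerator m p α β (z.2 ^ 6) (z.1 * z.2) * (z.1 ^ 2 * z.2 ^ 4)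
      / ((1 + z.1 * z.2) ^ 3 * (1 + m * (z.1 * z.2)) ^ 5)
    - (α - 2 * p * m * z.2 ^ 6 * (1 + m * (z.1 * z.2)) ^ 3) * z.2 ^ 8 / (1 + m * (z.1 * z.2)) ^ 3

theorem hasDerivWithinAt_lyapunovFn {m p α β t : ℝ} {γ : ℝ → ℝ × ℝ} {s : Set ℝ}
    (hγ : HasDerivWithinAt γ (bacciotti m (γ t)) s t) (hP : 1 + (γ t).1 * (γ t).2 ≠ 0)
    (hQ : 1 + m * ((γ t).1 * (γ t).2) ≠ 0) :
    HasDerivWithinAt (fun r => lyapunovFn m p α β (γ r)) (lyapunovDot m p α β (γ t)) s t := by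
  have hx : HasDerivWithinAt (fun r => (γ r).1) (bacciotti m (γ t)).1 s t := hγ.fst
  have hy : HasDerivWithinAt (fun r => (γ r).2) (bacciotti m (γ t)).2 s t := hγ.snd
  have hxy := hx.mul hy
  have hP' := (hxy.const_add 1).pow 2
  have hQ' := ((hxy.const_mul m).const_add 1).pow 4
  have h1 := (((hxy.const_mul β).const_add (1 / 2)).mul (hx.pow 2)).div hP' (pow_ne_zero 2 hP)
  have h2 := (((hxy.const_mul α).const_sub (1 / 4)).mul (hy.pow 4)).div hQ' (pow_ne_zero 4 hQ)
  have h3 := (((hx.pow 2).mul (hy.pow 6)).add ((hy.pow 10).div_const 5)).const_mul p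
  refine ((h1.add h2).add h3).congr_deriv ?_
  simp only [Pi.mul_apply, Pi.pow_apply, bacciotti, lyapunovDot,
    lyapunovCrossNumerator, Nat.cast_ofNat, Nat.reduceSub, pow_one]
  clear h1 h2 h3 hP' hQ' hxy hx hy
  generalize (γ t).1 = x at *
  generalize (γ t).2 = y at *
  obtain ⟨P, hP'⟩ : ∃ P, P = 1 + x * y := ⟨_, rfl⟩
  obtain ⟨Q, hQ'⟩ : ∃ Q, Q = 1 + m * (x * y) := ⟨_, rfl⟩
  rw [← hP'] at hP
  rw [← hQ'] at hQ
  simp only [← hP', ← hQ']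
  field_simp
  rw [hP', hQ']
  ring

theorem tendsto_zero_of_mem_box {m p α β A B : ℝ} (hm : 0 ≤ m) (hm' : m ≤ 3 / 5) (hp : 0 < p)
    (hα : 0 ≤ α) (hα' : α ≤ 1 / 4) (hβ : 0 < β) (hβ' : β ≤ 1 / 2)
    (ht : ∀ z ∈ Icc (-A) A ×ˢ Icc (-B) B, |z.1 * z.2| ≤ 53 / 100)
    (hN : ∀ z ∈ Icc (-A) A ×ˢ Icc (-B) B,
      lyapunovCrossNumerator m p α β (z.2 ^ 6) (z.1 * z.2) < 0)
    (hB : ∀ z ∈ Icc (-A) A ×ˢ Icc (-B) B,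
      2 * p * m * z.2 ^ 6 * (1 + m * (z.1 * z.2)) ^ 3 < α)
    {γ : ℝ → ℝ × ℝ} (hγ : IsForwardSolution (bacciotti m) γ)
    (hγ' : ∀ t, 0 ≤ t → γ t ∈ Icc (-A) A ×ˢ Icc (-B) B) :
    Tendsto γ atTop (nhds ((0, 0) : ℝ × ℝ)) := by
  have hP : ∀ z ∈ Icc (-A) A ×ˢ Icc (-B) B, 0 < 1 + z.1 * z.2 := fun z hz => by
    linarith [(abs_le.1 (ht z hz)).1]
  have hQ : ∀ z ∈ Icc (-A) A ×ˢ Icc (-B) B, 0 < 1 + m * (z.1 * z.2) := fun z hz => by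
    nlinarith [(abs_le.1 (ht z hz)).1]
  refine tendsto_of_strict_lyapunov (isCompact_Icc.prod isCompact_Icc) hγ'
    (W := lyapunovFn m p α β) (D := lyapunovDot m p α β) ?_ ?_ (by simp [lyapunovFn]) ?_ ?_
    (by simp [lyapunovDot]) fun t h => hasDerivWithinAt_lyapunovFn (hγ t h) (hP _ (hγ' t h)).ne'
      (hQ _ (hγ' t h)).ne'
  · intro z hz
    have h1 := (hP z hz).ne'
    have h2 := (hQ z hz).ne'
    refine ContinuousAt.continuousWithinAt ?_
    unfold lyapunovFn
    fun_prop (disch := positivity)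
  · intro z hz
    have h1 := (hP z hz).ne'
    have h2 := (hQ z hz).ne'
    refine ContinuousAt.continuousWithinAt ?_
    unfold lyapunovDot lyapunovCrossNumerator
    fun_prop (disch := positivity)
  · intro z hz hz0
    have h1 := hP z hz
    have h2 := hQ z hz
    obtain ⟨h3, h4⟩ := abs_le.1 (ht z hz)
    have h5 : 0 < 1 / 2 + β * (z.1 * z.2) := by nlinarith
    have h6 : 0 < 1 / 4 - α * (z.1 * z.2) := by nlinarith
    rw [lyapunovFn]
    have h7 : 0 ≤ (1 / 2 + β * (z.1 * z.2)) * z.1 ^ 2 / (1 + z.1 * z.2) ^ 2 := by positivity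
    have h8 : 0 ≤ (1 / 4 - α * (z.1 * z.2)) * z.2 ^ 4 / (1 + m * (z.1 * z.2)) ^ 4 := by positivity
    have h9 : 0 ≤ p * (z.1 ^ 2 * z.2 ^ 6 + z.2 ^ 10 / 5) := by positivity
    rcases ne_or_eq z.1 0 with h | h
    · have : 0 < (1 / 2 + β * (z.1 * z.2)) * z.1 ^ 2 / (1 + z.1 * z.2) ^ 2 := by positivity
      linarith
    · have h' : z.2 ≠ 0 := fun h' => hz0 (Prod.ext h h')
      have : 0 < (1 / 4 - α * (z.1 * z.2)) * z.2 ^ 4 / (1 + m * (z.1 * z.2)) ^ 4 := by positivity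
      linarith
  · intro z hz hz0
    have h1 := hP z hz
    have h2 := hQ z hz
    have h3 := sub_pos.2 (hB z hz)
    have h4 : lyapunovCrossNumerator m p α β (z.2 ^ 6) (z.1 * z.2) * (z.1 ^ 2 * z.2 ^ 4)
      / ((1 + z.1 * z.2) ^ 3 * (1 + m * (z.1 * z.2)) ^ 5) ≤ 0 :=
      div_nonpos_of_nonpos_of_nonneg
        (mul_nonpos_of_nonpos_of_nonneg (hN z hz).le (by positivity)) (by positivity)
    have h5 : 0 ≤ β * z.1 ^ 4 / (1 + z.1 * z.2) := by positivity
    have h6 : 0 ≤ (α - 2 * p * m * z.2 ^ 6 * (1 + m * (z.1 * z.2)) ^ 3) * z.2 ^ 8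
      / (1 + m * (z.1 * z.2)) ^ 3 := by positivity
    rw [lyapunovDot]
    rcases ne_or_eq z.1 0 with h | h
    · have : 0 < β * z.1 ^ 4 / (1 + z.1 * z.2) := by positivity
      linarith
    · have h' : z.2 ≠ 0 := fun h' => hz0 (Prod.ext h h')
      have : 0 < (α - 2 * p * m * z.2 ^ 6 * (1 + m * (z.1 * z.2)) ^ 3) * z.2 ^ 8
        / (1 + m * (z.1 * z.2)) ^ 3 := by positivity
      linarith

/-- Bacciotti's field agrees on a box with a bounded, globally Lipschitz field. -/
theorem exists_lipschitz_extension_bacciotti (m : ℝ) {A B : ℝ} (hA : 0 ≤ A) (hB : 0 ≤ B) :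
    ∃ (v : ℝ × ℝ → ℝ × ℝ) (K L : NNReal), LipschitzWith K v ∧ (∀ z, ‖v z‖ ≤ L) ∧
      ∀ z ∈ Icc (-A) A ×ˢ Icc (-B) B, v z = bacciotti m z := by
  have hsmooth : ContDiff ℝ 1 (bacciotti m) := by
    unfold bacciotti
    fun_prop
  have hcompact : IsCompact (Icc (-A) A ×ˢ Icc (-B) B) := isCompact_Icc.prod isCompact_Icc
  obtain ⟨K, hK⟩ := hsmooth.locallyLipschitz.locallyLipschitzOn.exists_lipschitzOnWith_of_compact
    hcompact
  obtain ⟨L, hL⟩ := hcompact.exists_bound_of_continuousOn hsmooth.continuous.continuousOn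
  let clamp : ℝ × ℝ → ℝ × ℝ := fun z => (max (min z.1 A) (-A), max (min z.2 B) (-B))
  have hclamp : ∀ z, clamp z ∈ Icc (-A) A ×ˢ Icc (-B) B := fun z =>
    ⟨⟨le_max_right _ _, max_le (min_le_right _ _) (by linarith)⟩,
      ⟨le_max_right _ _, max_le (min_le_right _ _) (by linarith)⟩⟩
  have hclamp_lip : LipschitzWith 1 clamp := by
    have h := ((LipschitzWith.prod_fst.min_const A).max_const (-A)).prodMk
      ((LipschitzWith.prod_snd.min_const B).max_const (-B))
    rwa [max_self] at h
  refine ⟨bacciotti m ∘ clamp, K * 1, L.toNNReal, ?_, fun z => ?_, fun z hz => ?_⟩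
  · rw [← lipschitzOnWith_univ]
    exact hK.comp hclamp_lip.lipschitzOnWith fun z _ => hclamp z
  · exact (hL _ (hclamp z)).trans (Real.le_coe_toNNReal L)
  · obtain ⟨⟨h1, h2⟩, h3, h4⟩ := hz
    simp [clamp, min_eq_left h2, min_eq_left h4, max_eq_left h1, max_eq_left h3]

theorem basin_of_box {m q a b p α β : ℝ} (hq : 0 < q) (hm : m = 3 / 5 - q ^ 6 / 125)
    (hq6 : q ^ 6 ≤ 25 / 2) (ha : 0 < a) (ha' : a ≤ 13 / 50) (hb : 0 < b) (hb' : b ≤ 23 / 40)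
    (hV : ∀ X Y : ℝ, |X| ≤ a → |Y| ≤ b → (|X| = a ∨ |Y| = b) → 0 < scaledV (q ^ 3) X Y)
    (hp : 0 < p) (hα : 0 ≤ α) (hα' : α ≤ 1 / 4) (hβ : 0 < β) (hβ' : β ≤ 1 / 2)
    (hN : ∀ s t : ℝ, 0 ≤ s → s ≤ b ^ 6 * q ^ 6 → t ^ 2 ≤ (a * b) ^ 2 * q ^ 6 →
      lyapunovCrossNumerator m p α β s t < 0)
    (hB : ∀ s t : ℝ, 0 ≤ s → s ≤ b ^ 6 * q ^ 6 → t ^ 2 ≤ (a * b) ^ 2 * q ^ 6 →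
      2 * p * m * s * (1 + m * t) ^ 3 < α) :
    Bornology.IsBounded (Um m) ∧
    ∀ z ∈ Um m, ∃ γ : ℝ → ℝ × ℝ, IsForwardSolution (bacciotti m) γ ∧ γ 0 = z ∧
      Tendsto γ atTop (nhds ((0, 0) : ℝ × ℝ)) := by
  have hm0 : 0 ≤ m := by linarith
  have hm1 : m ≤ 3 / 5 := by linarith [pow_pos hq 6]
  have hA : 0 < q ^ 2 * a := by positivity
  have hB' : 0 < q * b := by positivity
  set R : Set (ℝ × ℝ) := Icc (-(q ^ 2 * a)) (q ^ 2 * a) ×ˢ Icc (-(q * b)) (q * b) with hR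
  set I : Set (ℝ × ℝ) := Ioo (-(q ^ 2 * a)) (q ^ 2 * a) ×ˢ Ioo (-(q * b)) (q * b) with hI
  have hscale : ∀ z ∈ R, ∃ X Y : ℝ, |X| ≤ a ∧ |Y| ≤ b ∧ z.1 = q ^ 2 * X ∧ z.2 = q * Y := by
    rintro z ⟨h1, h2⟩
    have h1' := abs_le.2 h1
    have h2' := abs_le.2 h2
    refine ⟨z.1 / q ^ 2, z.2 / q, ?_, ?_, by field_simp, by field_simp⟩
    · rw [abs_div, abs_of_pos (by positivity : 0 < q ^ 2), div_le_iff₀' (by positivity)]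
      exact h1'
    · rw [abs_div, abs_of_pos hq, div_le_iff₀' hq]
      exact h2'
  have hRclosed : IsClosed R := isClosed_Icc.prod isClosed_Icc
  have hIopen : IsOpen I := isOpen_Ioo.prod isOpen_Ioo
  have hIR : I ⊆ R := prod_mono Ioo_subset_Icc_self Ioo_subset_Icc_self
  have hVI : ∀ z ∈ R, Vm m z ≤ 0 → z ∈ I := by
    intro z hz hVz
    obtain ⟨X, Y, hX, hY, h1, h2⟩ := hscale z hz
    have hVs : scaledV (q ^ 3) X Y ≤ 0 := by
      rw [show z = (q ^ 2 * X, q * Y) from Prod.ext h1 h2, Vm_scaled hq.le hm] at hVz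
      exact nonpos_of_mul_nonpos_right hVz (by positivity)
    have hX' : |X| < a := lt_of_le_of_ne hX fun h => (hV X Y hX hY (Or.inl h)).not_ge hVs
    have hY' : |Y| < b := lt_of_le_of_ne hY fun h => (hV X Y hX hY (Or.inr h)).not_ge hVs
    refine ⟨abs_lt.1 ?_, abs_lt.1 ?_⟩
    · rw [h1, abs_mul, abs_of_pos (by positivity : 0 < q ^ 2)]
      gcongr
    · rw [h2, abs_mul, abs_of_pos hq]
      gcongr
  have hUV : Um m ⊆ {z | Vm m z ≤ 0} := connectedComponentIn_subset _ _
  have h0V : Vm m (0, 0) ≤ 0 := by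
    have := Vm_scaled hq.le hm 0 0
    simp only [mul_zero] at this
    rw [this]
    refine mul_nonpos_of_nonneg_of_nonpos (by positivity) ?_
    norm_num [scaledV, scaledG0, scaledG1, scaledG2]
  have hUI : Um m ⊆ I := by
    refine isPreconnected_connectedComponentIn.subset_left_of_subset_union hIopen
      hRclosed.isOpen_compl (disjoint_compl_right_iff_subset.2 hIR) ?_
      ⟨(0, 0), mem_connectedComponentIn h0V, by constructor <;> constructor <;> simpa⟩
    intro z hz
    by_cases hzR : z ∈ R
    · exact Or.inl (hVI z hzR (hUV hz))
    · exact Or.inr hzR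
  refine ⟨((isCompact_Icc.prod isCompact_Icc).isBounded).subset (hUI.trans hIR), fun z hz => ?_⟩
  obtain ⟨v, K, L, hvK, hvL, hv⟩ := exists_lipschitz_extension_bacciotti m hA.le hB'.le
  obtain ⟨γ, hγ0, hγ⟩ := exists_forward_solution_of_lipschitzWith hvK hvL z
  have hdiv : ∀ w ∈ R, 2 / 3 * divBacciotti m w ≤ 10 / 3 * m * (q * b) ^ 4 := by
    rintro w ⟨-, h2⟩
    have h2' := abs_le.2 h2
    have h4 : w.2 ^ 4 ≤ (q * b) ^ 4 := by
      rw [← (by decide : Even 4).pow_abs]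
      gcongr
    rw [divBacciotti]
    nlinarith [sq_nonneg w.1, mul_le_mul_of_nonneg_left h4 hm0]
  have hder : ∀ w ∈ R, ∃ c ≤ 0, ∀ t ∈ Ici (0 : ℝ), γ t = w →
      HasDerivWithinAt (fun r => Vm m (γ r)) (2 / 3 * divBacciotti m w * Vm m w + c) (Ici 0) t := by
    intro w hw
    obtain ⟨X, Y, hX, hY, h1, h2⟩ := hscale w hw
    refine ⟨_, mul_nonpos_of_nonneg_of_nonpos (show 0 ≤ q ^ 14 * Y ^ 4 by positivity)
      (scaled_derivative_nonpos (e := q ^ 3) (by positivity) (by linarith [pow_mul q 3 2])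
        (hX.trans ha') (hY.trans hb')), ?_⟩
    rintro t ht rfl
    have h := hγ t ht
    rw [hv _ hw] at h
    exact hasDerivWithinAt_Vm hq.le hm h h1 h2
  choose! c hc0 hc using hder
  have hmem := forall_mem_of_barrier (C := 10 / 3 * m * (q * b) ^ 4)
    (V' := fun w => 2 / 3 * divBacciotti m w * Vm m w + c w)
    (fun t ht => (hγ t ht).continuousWithinAt) hRclosed hIopen hIR (continuous_Vm hq.le hm) hVI
    (hγ0 ▸ hIR (hUI hz)) (hγ0 ▸ hUV hz) (fun t ht htR => hc _ htR t ht rfl) fun w hw hVw => by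
      linarith [mul_le_mul_of_nonneg_right (hdiv w hw) hVw.le, hc0 w hw]
  have hsol : IsForwardSolution (bacciotti m) γ := fun t ht => by
    rw [← hv _ (hmem t ht).1]
    exact hγ t ht
  have hsq : ∀ w ∈ R, (w.1 * w.2) ^ 2 ≤ (a * b) ^ 2 * q ^ 6 ∧ w.2 ^ 6 ≤ b ^ 6 * q ^ 6 := by
    intro w hw
    obtain ⟨X, Y, hX, hY, h1, h2⟩ := hscale w hw
    have hXY : |X * Y| ≤ a * b := by
      rw [abs_mul]
      gcongr
    have hXY2 := sq_le_sq' (by linarith [neg_abs_le (X * Y)]) ((le_abs_self _).trans hXY)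
    have hY6 : Y ^ 6 ≤ b ^ 6 := by
      rw [← (by decide : Even 6).pow_abs]
      gcongr
    rw [h1, h2]
    constructor
    · calc (q ^ 2 * X * (q * Y)) ^ 2 = (X * Y) ^ 2 * q ^ 6 := by ring
        _ ≤ _ := by gcongr
    · rw [mul_pow, mul_comm]
      gcongr
  have hab : (a * b) ^ 2 * q ^ 6 ≤ (53 / 100) ^ 2 := by
    calc (a * b) ^ 2 * q ^ 6 ≤ (13 / 50 * (23 / 40)) ^ 2 * (25 / 2) := by gcongr
      _ ≤ _ := by norm_num
  exact ⟨γ, hsol, hγ0, tendsto_zero_of_mem_box hm0 hm1 hp hα hα' hβ hβ'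
    (fun w hw => abs_le_of_sq_le_sq ((hsq w hw).1.trans hab) (by norm_num))
    (fun w hw => hN _ _ (by positivity) (hsq w hw).2 (hsq w hw).1)
    (fun w hw => hB _ _ (by positivity) (hsq w hw).2 (hsq w hw).1) hsol fun t ht => (hmem t ht).1⟩

theorem bacciotti_basin_of_attraction (m : ℝ) (hm₁ : 0.5 < m) (hm₂ : m < 0.6) :
    Bornology.IsBounded (Um m) ∧
    ∀ p ∈ Um m, ∃ γ : ℝ → ℝ × ℝ, IsForwardSolution (bacciotti m) γ ∧ γ 0 = p ∧
      Tendsto γ atTop (nhds ((0, 0) : ℝ × ℝ)) := by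
  norm_num at hm₁ hm₂
  obtain ⟨δ, hδ⟩ : ∃ δ, δ = 3 - 5 * m := ⟨_, rfl⟩
  have hδ0 : 0 < δ := by linarith
  have hδ1 : δ ≤ 1 / 2 := by linarith
  have hmδ : m = (3 - δ) / 5 := by linarith
  obtain ⟨q, hq, hq6⟩ : ∃ q : ℝ, 0 < q ∧ q ^ 6 = 25 * δ :=
    ⟨(25 * δ) ^ ((6 : ℕ) : ℝ)⁻¹, by positivity,
      Real.rpow_inv_natCast_pow (by positivity) (by norm_num)⟩
  have hm : m = 3 / 5 - q ^ 6 / 125 := by linarith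
  have hq3 : (q ^ 3) ^ 2 = 25 * δ := by rw [← hq6]; ring
  rcases le_total δ (4 / 25) with h | h
  · refine basin_of_box (a := 23 / 100) (b := 11 / 20) (p := 1 / 10) (α := 13 / 100 * δ)
      (β := δ / 1000) hq hm (by linarith) (by norm_num) (by norm_num) (by norm_num) (by norm_num)
      (fun X Y _ hY hXY => scaledV_pos_on_frontier_small (by positivity)
        (abs_le_of_sq_le_sq' (by linarith) (by norm_num)).2 hY hXY)
      (by norm_num) (by linarith) (by linarith) (by linarith) (by linarith) ?_ ?_
    · intro s t hs0 hs ht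
      rw [hq6] at hs ht
      rw [hmδ]
      exact crossNumerator_neg_small hδ0 h hs0 (by linarith) (by linarith)
    · intro s t hs0 hs ht
      rw [hq6] at hs ht
      have ht' : |t| ≤ 254 / 1000 := abs_le_of_sq_le_sq (by linarith) (by norm_num)
      have hQ : 1 + m * t ≤ 116 / 100 := by nlinarith [(abs_le.1 ht').2]
      have hQ0 : 0 ≤ 1 + m * t := by nlinarith [(abs_le.1 ht').1]
      calc 2 * (1 / 10) * m * s * (1 + m * t) ^ 3
          ≤ 2 * (1 / 10) * (3 / 5) * (693 / 1000 * δ) * (116 / 100) ^ 3 := by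
            gcongr; linarith
        _ < 13 / 100 * δ := by linarith
  · refine basin_of_box (a := 13 / 50) (b := 23 / 40) (p := 1 / 50) (α := 42 / 1000 * δ)
      (β := δ / 1000) hq hm (by linarith) (by norm_num) (by norm_num) (by norm_num) (by norm_num)
      (fun X Y _ hY hXY => scaledV_pos_on_frontier_large (by positivity) (by linarith) hY hXY)
      (by norm_num) (by linarith) (by linarith) (by linarith) (by linarith) ?_ ?_
    · intro s t hs0 hs ht
      rw [hq6] at hs ht
      rw [hmδ]
      exact crossNumerator_neg_large h hδ1 hs0 (by linarith) (by linarith)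
    · intro s t hs0 hs ht
      rw [hq6] at hs ht
      have hmδ2 : m ^ 2 * δ ≤ 1 / 8 := by
        rw [hmδ]
        nlinarith [mul_nonneg (sub_nonneg.2 hδ1)
          (show 0 ≤ δ ^ 2 - 11 / 2 * δ + 25 / 4 by nlinarith [sq_nonneg δ])]
      have hmt : |m * t| ≤ 265 / 1000 := by
        refine abs_le_of_sq_le_sq ?_ (by norm_num)
        rw [mul_pow]
        nlinarith [mul_le_mul_of_nonneg_left ht (sq_nonneg m)]
      have hm' : m ≤ 568 / 1000 := by linarith
      have hQ : 1 + m * t ≤ 1265 / 1000 := by linarith [(abs_le.1 hmt).2]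
      have hQ0 : 0 ≤ 1 + m * t := by linarith [(abs_le.1 hmt).1]
      calc 2 * (1 / 50) * m * s * (1 + m * t) ^ 3
          ≤ 2 * (1 / 50) * (568 / 1000) * (904 / 1000 * δ) * (1265 / 1000) ^ 3 := by
            gcongr; linarith
        _ < 42 / 1000 * δ := by linarith

end
end

section
/- (Bendixson–Dulac criterion.) Let U ⊆ ℝ² be open, let X = (P,Q) be a C¹ vector field on U, let V : U → ℝ be C¹, and let k > 0. Define M(x,y) = ⟨∇V(x,y), X(x,y)⟩ − k·V(x,y)·div X(x,y). Assume: (1) M ≥ 0 on all of U, or M ≤ 0 on all of U; (2) no nonconstant solution of γ' = X(γ) has its image contained in {p ∈ U : M(p) = 0}; (3) every connected component of U \ {p : V(p) = 0} is simply connected. Then X has no periodic orbit whose image is contained in U. -/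
open Set Filter

noncomputable section

open MeasureTheory Topology

/-- The integral of `dz / (z - a)` along `γ` over the parameter interval `[0, T]`. -/
def windingIntegral (γ : ℝ → ℂ) (T : ℝ) (a : ℂ) : ℂ :=
  ∫ t in (0 : ℝ)..T, deriv γ t / (γ t - a)

lemma exp_integral_deriv_div_sub {γ : ℝ → ℂ} (hγ : ContDiff ℝ 1 γ) {a : ℂ} (ha : a ∉ range γ)
    (t : ℝ) :
    Complex.exp (∫ s in (0 : ℝ)..t, deriv γ s / (γ s - a)) * (γ 0 - a) = γ t - a := by
  have hne : ∀ s, γ s - a ≠ 0 := fun s h => ha ⟨s, sub_eq_zero.1 h⟩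
  have hcont : Continuous fun s => deriv γ s / (γ s - a) :=
    (hγ.continuous_deriv le_rfl).div (hγ.continuous.sub continuous_const) hne
  have hJ : ∀ s, HasDerivAt (fun t => ∫ s in (0 : ℝ)..t, deriv γ s / (γ s - a))
      (deriv γ s / (γ s - a)) s := fun s => (hcont.integral_hasStrictDerivAt 0 s).hasDerivAt
  have hd : ∀ s, HasDerivAt (fun t => Complex.exp (-∫ s in (0 : ℝ)..t, deriv γ s / (γ s - a))
      * (γ t - a)) 0 s := by
    intro s
    have h1 := ((hJ s).fun_neg.cexp).fun_mul
      (((hγ.differentiable one_ne_zero s).hasDerivAt).sub_const a)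
    refine h1.congr_deriv ?_
    have := hne s
    field_simp
    ring
  have hc := is_const_of_deriv_eq_zero (fun s => (hd s).differentiableAt)
    (fun s => (hd s).deriv) 0 t
  simp only [intervalIntegral.integral_same, neg_zero, Complex.exp_zero, one_mul] at hc
  rw [hc, ← mul_assoc, ← Complex.exp_add, add_neg_cancel, Complex.exp_zero, one_mul]

lemma exists_windingIntegral_eq {γ : ℝ → ℂ} (hγ : ContDiff ℝ 1 γ) {T : ℝ}
    (hT : Function.Periodic γ T) {a : ℂ} (ha : a ∉ range γ) :
    ∃ n : ℤ, windingIntegral γ T a = n * (2 * Real.pi * Complex.I) := by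
  have h := exp_integral_deriv_div_sub hγ ha T
  have h0 : γ T = γ 0 := by simpa using hT 0
  have hne : γ 0 - a ≠ 0 := fun h => ha ⟨0, sub_eq_zero.1 h⟩
  rw [h0] at h
  exact Complex.exp_eq_one_iff.1 (mul_right_cancel₀ hne (h.trans (one_mul _).symm))

lemma continuousOn_windingIntegral {γ : ℝ → ℂ} (hγ : ContDiff ℝ 1 γ) (T : ℝ) :
    ContinuousOn (windingIntegral γ T) (range γ)ᶜ := by
  rw [continuousOn_iff_continuous_domRestrict]
  refine intervalIntegral.continuous_parametric_intervalIntegral_of_continuous'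
    (f := fun (a : ((range γ)ᶜ : Set ℂ)) t => deriv γ t / (γ t - a)) ?_ 0 T
  refine Continuous.div ((hγ.continuous_deriv le_rfl).comp continuous_snd)
    ((hγ.continuous.comp continuous_snd).sub (continuous_subtype_val.comp continuous_fst)) ?_
  rintro ⟨a, t⟩ h
  exact a.2 ⟨t, sub_eq_zero.1 h⟩

lemma isDiscrete_range_intCast_mul (c : ℂ) :
    IsDiscrete (range fun n : ℤ => (n : ℂ) * c) := by
  have h : (range fun n : ℤ => (n : ℂ) * c) = (AddSubgroup.zmultiples c : Set ℂ) := by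
    ext z
    simp [AddSubgroup.mem_zmultiples_iff]
  rw [h, isDiscrete_iff_discreteTopology]
  exact inferInstanceAs (DiscreteTopology (AddSubgroup.zmultiples c))

lemma windingIntegral_eq_of_isPreconnected {γ : ℝ → ℂ} (hγ : ContDiff ℝ 1 γ) {T : ℝ}
    (hT : Function.Periodic γ T) {S : Set ℂ} (hS : IsPreconnected S) (hSγ : S ⊆ (range γ)ᶜ)
    {a b : ℂ} (ha : a ∈ S) (hb : b ∈ S) : windingIntegral γ T a = windingIntegral γ T b := by
  refine hS.constant_of_mapsTo (isDiscrete_range_intCast_mul (2 * Real.pi * Complex.I))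
    ((continuousOn_windingIntegral hγ T).mono hSγ) (fun z hz => ?_) ha hb
  obtain ⟨n, hn⟩ := exists_windingIntegral_eq hγ hT (hSγ hz)
  exact ⟨n, hn.symm⟩

lemma windingIntegral_eq_zero_of_isSimplyConnected {γ : ℝ → ℂ} (hγ : ContDiff ℝ 1 γ) {T : ℝ}
    (hT : Function.Periodic γ T) {S : Set ℂ} (hS : IsSimplyConnected S) (hSo : IsOpen S)
    (hγS : ∀ t, γ t ∈ S) {a : ℂ} (ha : a ∉ S) : windingIntegral γ T a = 0 := by
  obtain ⟨L, hLc, hL⟩ := Complex.exists_continuousOn_eqOn_exp_comp hS hSo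
    (g := fun z => z - a) (by fun_prop) (by
      rintro ⟨z, hz, h⟩
      rw [sub_eq_zero] at h
      exact ha (h ▸ hz))
  have haγ : a ∉ range γ := by
    rintro ⟨t, rfl⟩
    exact ha (hγS t)
  have hne : ∀ s, γ s - a ≠ 0 := fun s h => haγ ⟨s, sub_eq_zero.1 h⟩
  have hcont : Continuous fun s => deriv γ s / (γ s - a) :=
    (hγ.continuous_deriv le_rfl).div (hγ.continuous.sub continuous_const) hne
  have hJ : Continuous fun t => ∫ s in (0 : ℝ)..t, deriv γ s / (γ s - a) :=
    intervalIntegral.continuous_primitive (fun _ _ => hcont.intervalIntegrable _ _) 0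
  have hLγ : Continuous fun t => L (γ t) := by
    rw [← continuousOn_univ]
    exact hLc.comp hγ.continuous.continuousOn fun t _ => hγS t
  have hconst := isPreconnected_univ.constant_of_mapsTo
    (isDiscrete_range_intCast_mul (2 * Real.pi * Complex.I))
    (f := fun t => (∫ s in (0 : ℝ)..t, deriv γ s / (γ s - a)) + L (γ 0) - L (γ t))
    ((hJ.add continuous_const).sub hLγ).continuousOn (fun t _ => ?_) (mem_univ T) (mem_univ 0)
  · have h0 : γ T = γ 0 := by simpa using hT 0
    simpa [h0, windingIntegral] using hconst
  · have h1 := exp_integral_deriv_div_sub hγ haγ t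
    have h2 : Complex.exp (L (γ 0)) = γ 0 - a := hL (hγS 0)
    have h3 : Complex.exp (L (γ t)) = γ t - a := hL (hγS t)
    have h4 : Complex.exp ((∫ s in (0 : ℝ)..t, deriv γ s / (γ s - a)) + L (γ 0) - L (γ t)) = 1 := by
      rw [Complex.exp_sub, Complex.exp_add, h2, h1, h3, div_self (hne t)]
    obtain ⟨n, hn⟩ := Complex.exp_eq_one_iff.1 h4
    exact ⟨n, hn.symm⟩

/-- A `C¹` map on an open set agrees near a given compact subset with a compactly supported
`C¹` map. -/
lemma exists_contDiff_hasCompactSupport_eventuallyEq {E F : Type*} [NormedAddCommGroup E]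
    [NormedSpace ℝ E] [FiniteDimensional ℝ E] [NormedAddCommGroup F] [NormedSpace ℝ F]
    {W K : Set E} (hW : IsOpen W) (hK : IsCompact K) (hKW : K ⊆ W) {f : E → F}
    (hf : ContDiffOn ℝ 1 f W) :
    ∃ g : E → F, ContDiff ℝ 1 g ∧ HasCompactSupport g ∧ ∀ x ∈ K, g =ᶠ[𝓝 x] f := by
  obtain ⟨L, hL, hKL, hLW⟩ := exists_compact_between hK hW hKW
  obtain ⟨χ, h1, h0, -⟩ := exists_contMDiffMap_one_nhds_of_subset_interior (n := 1)
    (modelWithCornersSelf ℝ E) hK.isClosed hKL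
  have hχ : ContDiff ℝ 1 χ := contMDiff_iff_contDiff.1 χ.contMDiff
  have hsupp : ∀ x ∉ L, χ x • f x = 0 := fun x hx => by rw [h0 x hx, zero_smul]
  refine ⟨fun x => χ x • f x, ?_, HasCompactSupport.intro hL hsupp, fun x hx => ?_⟩
  · refine contDiff_iff_contDiffAt.2 fun x => ?_
    by_cases hx : x ∈ W
    · exact hχ.contDiffAt.smul (hf.contDiffAt (hW.mem_nhds hx))
    · refine (contDiffAt_const (c := (0 : F))).congr_of_eventuallyEq ?_
      filter_upwards [hL.isClosed.isOpen_compl.mem_nhds fun h => hx (hLW h)] with y hy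
      exact hsupp y hy
  · have h1x : ∀ᶠ y in 𝓝 x, χ y = 1 := h1.filter_mono (nhds_le_nhdsSet hx)
    filter_upwards [h1x] with y hy
    rw [hy, one_smul]

/-- Twice the Wirtinger derivative `∂f/∂z̄`. -/
def dbar (f : ℂ → ℂ) (w : ℂ) : ℂ := fderiv ℝ f w 1 + Complex.I * fderiv ℝ f w Complex.I

lemma continuous_dbar {f : ℂ → ℂ} (hf : ContDiff ℝ 1 f) : Continuous (dbar f) := by
  have := hf.continuous_fderiv one_ne_zero
  unfold dbar
  fun_prop

lemma hasCompactSupport_dbar {f : ℂ → ℂ} (hf : HasCompactSupport f) :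
    HasCompactSupport (dbar f) :=
  (hf.fderiv ℝ).mono fun w hw h => hw (by
    have : fderiv ℝ f w = 0 := h
    simp [dbar, this])

lemma exists_pos_forall_norm_gt_eq_zero {E : Type*} [Zero E] {f : ℂ → E}
    (hs : HasCompactSupport f) : ∃ R : ℝ, 0 < R ∧ ∀ w, R < ‖w‖ → f w = 0 := by
  obtain ⟨R, hR0, hR⟩ := hs.isCompact.isBounded.exists_pos_norm_le
  refine ⟨R, hR0, fun w hw => ?_⟩
  by_contra h
  exact absurd (hR w (subset_tsupport f h)) (not_le.2 hw)

lemma integral_dbar_div_self {f : ℂ → ℂ} (hf : ContDiff ℝ 1 f) (hs : HasCompactSupport f) :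
    ∫ w, dbar f w / w = -(2 * Real.pi) * f 0 := by
  obtain ⟨R, hR0, hR⟩ := exists_pos_forall_norm_gt_eq_zero hs
  obtain ⟨R', hR'0, hR'⟩ := exists_pos_forall_norm_gt_eq_zero (hs.fderiv ℝ)
  set c : ℝ → ℂ := fun θ => Real.cos θ + Real.sin θ * Complex.I with hc
  have hcn : ∀ r θ : ℝ, 0 ≤ r → ‖(r : ℂ) * c θ‖ = r := by
    intro r θ hr
    have : c θ = Complex.exp (θ * Complex.I) := by
      simp [hc, Complex.exp_mul_I]
    rw [norm_mul, this, Complex.norm_exp_ofReal_mul_I, mul_one, Complex.norm_real,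
      Real.norm_of_nonneg hr]
  have hcne : ∀ θ, c θ ≠ 0 := fun θ h => by
    have := hcn 1 θ zero_le_one
    simp [h] at this
  have hcc : Continuous c := by fun_prop
  have hfd := hf.continuous_fderiv one_ne_zero
  have hdiff : ∀ w, HasFDerivAt f (fderiv ℝ f w) w :=
    fun w => (hf.differentiable one_ne_zero w).hasFDerivAt
  set G : ℝ × ℝ → ℂ := fun p => fderiv ℝ f (p.1 * c p.2) (c p.2) with hG
  set H : ℝ × ℝ → ℂ := fun p => Complex.I * fderiv ℝ f (p.1 * c p.2) (Complex.I * c p.2) with hH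
  have hGc : Continuous G := by fun_prop
  have hHc : Continuous H := by fun_prop
  have hzero : ∀ p : ℝ × ℝ, R' < p.1 → fderiv ℝ f (p.1 * c p.2) = 0 := by
    intro p hp
    exact hR' _ (by rwa [hcn _ _ (hR'0.trans hp).le])
  have hint : ∀ F : ℝ × ℝ → ℂ, Continuous F → (∀ p : ℝ × ℝ, R' < p.1 → F p = 0) →
      IntegrableOn F (Ioi (0 : ℝ) ×ˢ Ioo (-Real.pi) Real.pi) (volume.prod volume) := by
    intro F hF hF0
    have h1 : IntegrableOn F (Icc (0 : ℝ) R' ×ˢ Icc (-Real.pi) Real.pi) (volume.prod volume) :=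
      hF.continuousOn.integrableOn_compact (isCompact_Icc.prod isCompact_Icc)
    refine h1.of_forall_sdiff_eq_zero (measurableSet_Ioi.prod measurableSet_Ioo) ?_
    rintro p ⟨⟨hp1, hp2⟩, hp3⟩
    refine hF0 p ?_
    by_contra hle
    exact hp3 ⟨⟨(mem_Ioi.1 hp1).le, not_lt.1 hle⟩, Ioo_subset_Icc_self hp2⟩
  have hGi := hint G hGc fun p hp => by simp [hG, hzero p hp]
  have hHi := hint H hHc fun p hp => by simp [hH, hzero p hp]
  rw [← Complex.integral_comp_polarCoord_symm]
  have h1 : ∀ p ∈ polarCoord.target, p.1 • (dbar f (Complex.polarCoord.symm p) /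
      Complex.polarCoord.symm p) = G p + H p := by
    rintro ⟨r, θ⟩ ⟨hr, -⟩
    have hr' : (r : ℂ) ≠ 0 := by exact_mod_cast (ne_of_gt hr : r ≠ 0)
    have e0 : Complex.polarCoord.symm (r, θ) = r * c θ := by simp [hc]
    have hne := hcne θ
    rw [e0, Complex.real_smul]
    have e1 : c θ = Real.cos θ • (1 : ℂ) + Real.sin θ • Complex.I := by
      simp [hc]
    have e2 : Complex.I * c θ = (-Real.sin θ) • (1 : ℂ) + Real.cos θ • Complex.I := by
      simp only [hc, Complex.real_smul, Complex.ofReal_neg]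
      linear_combination (Real.sin θ : ℂ) * Complex.I_mul_I
    have e3 : fderiv ℝ f (r * c θ) (c θ) = Real.cos θ * fderiv ℝ f (r * c θ) 1 +
        Real.sin θ * fderiv ℝ f (r * c θ) Complex.I := by
      conv_lhs => rw [e1]
      rw [map_add, map_smul, map_smul, ← e1, Complex.real_smul, Complex.real_smul]
    have e4 : fderiv ℝ f (r * c θ) (Complex.I * c θ) = -Real.sin θ * fderiv ℝ f (r * c θ) 1 +
        Real.cos θ * fderiv ℝ f (r * c θ) Complex.I := by
      rw [e2, map_add, map_smul, map_smul, Complex.real_smul, Complex.real_smul,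
        Complex.ofReal_neg]
    simp only [hG, hH, e3, e4, dbar]
    field_simp
    simp only [hc]
    have hsc : (Real.cos θ : ℂ) ^ 2 + (Real.sin θ : ℂ) ^ 2 = 1 := by
      exact_mod_cast Real.cos_sq_add_sin_sq θ
    linear_combination (-(fderiv ℝ f (r * (Real.cos θ + Real.sin θ * Complex.I)) 1) -
      Complex.I * fderiv ℝ f (r * (Real.cos θ + Real.sin θ * Complex.I)) Complex.I) * hsc +
      (Real.sin θ ^ 2 * (fderiv ℝ f (r * (Real.cos θ + Real.sin θ * Complex.I)) 1) -
      Real.cos θ * Real.sin θ *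
        fderiv ℝ f (r * (Real.cos θ + Real.sin θ * Complex.I)) Complex.I) * Complex.I_sq
  rw [setIntegral_congr_fun polarCoord.open_target.measurableSet h1, polarCoord_target,
    Measure.volume_eq_prod, integral_add hGi hHi, setIntegral_prod H hHi,
    ← Measure.prod_restrict, integral_prod_symm G (by rw [Measure.prod_restrict]; exact hGi)]
  have hHzero : ∀ r ∈ Ioi (0 : ℝ), ∫ θ in Ioo (-Real.pi) Real.pi, H (r, θ) = 0 := by
    intro r hr
    have hr' : (r : ℂ) ≠ 0 := by exact_mod_cast (ne_of_gt hr : r ≠ 0)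
    rw [← integral_Ioc_eq_integral_Ioo,
      ← intervalIntegral.integral_of_le (by linarith [Real.pi_pos])]
    have hd : ∀ θ ∈ uIcc (-Real.pi) Real.pi,
        HasDerivAt (fun θ : ℝ => Complex.I * ((r : ℂ)⁻¹ * f (r * c θ))) (H (r, θ)) θ := by
      intro θ _
      have hcd : HasDerivAt c (Complex.I * c θ) θ := by
        have := (((Real.hasDerivAt_cos θ).ofReal_comp).add
          (((Real.hasDerivAt_sin θ).ofReal_comp).mul_const Complex.I))
        refine this.congr_deriv ?_
        simp only [hc, Complex.ofReal_neg]
        linear_combination -(Real.sin θ : ℂ) * Complex.I_mul_I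
      have h2 := (hdiff (r * c θ)).comp_hasDerivAt θ (hcd.const_mul (r : ℂ))
      refine ((h2.const_mul (r : ℂ)⁻¹).const_mul Complex.I).congr_deriv ?_
      simp only [hH]
      have h3 : fderiv ℝ f (r * c θ) (r * (Complex.I * c θ)) =
          r * fderiv ℝ f (r * c θ) (Complex.I * c θ) := by
        rw [← Complex.real_smul (z := Complex.I * c θ), map_smul, Complex.real_smul]
      rw [h3, inv_mul_cancel_left₀ hr']
    rw [intervalIntegral.integral_eq_sub_of_hasDerivAt hd
      ((hHc.comp (Continuous.prodMk_right r)).intervalIntegrable _ _)]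
    simp [hc]
  rw [setIntegral_congr_fun measurableSet_Ioi hHzero]
  have hGval : ∀ θ ∈ Ioo (-Real.pi) Real.pi, ∫ r in Ioi (0 : ℝ), G (r, θ) = -f 0 := by
    intro θ _
    have hd : ∀ r ∈ Ici (0 : ℝ), HasDerivAt (fun r : ℝ => f (r * c θ)) (G (r, θ)) r := by
      intro r _
      have h2 := (hdiff (r * c θ)).comp_hasDerivAt r
        (((hasDerivAt_id r).ofReal_comp).mul_const (c θ))
      exact h2.congr_deriv (by simp [hG])
    have hi : IntegrableOn (fun r => G (r, θ)) (Ioi 0) := by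
      have h3 : IntegrableOn (fun r => G (r, θ)) (Icc (0 : ℝ) R') :=
        (hGc.comp (Continuous.prodMk_left θ)).continuousOn.integrableOn_compact isCompact_Icc
      refine h3.of_forall_sdiff_eq_zero measurableSet_Ioi ?_
      rintro r ⟨hr1, hr2⟩
      have : R' < r := by
        by_contra hle
        exact hr2 ⟨(mem_Ioi.1 hr1).le, not_lt.1 hle⟩
      simp [hG, hzero (r, θ) this]
    have ht : Tendsto (fun r : ℝ => f (r * c θ)) atTop (𝓝 0) := by
      refine tendsto_const_nhds.congr' ?_
      filter_upwards [eventually_gt_atTop R] with r hr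
      exact (hR _ (by rwa [hcn r θ (hR0.trans hr).le])).symm
    rw [integral_Ioi_of_hasDerivAt_of_tendsto' hd hi ht]
    simp
  rw [setIntegral_congr_fun measurableSet_Ioo hGval, setIntegral_const]
  rw [Measure.real, Real.volume_Ioo, ENNReal.toReal_ofReal (by linarith [Real.pi_pos])]
  rw [integral_zero, add_zero, Complex.real_smul]
  push_cast
  ring

/-- The Cauchy–Pompeiu formula for compactly supported functions. -/
lemma integral_dbar_div_sub {f : ℂ → ℂ} (hf : ContDiff ℝ 1 f) (hs : HasCompactSupport f) (z : ℂ) :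
    ∫ w, dbar f w / (w - z) = -(2 * Real.pi) * f z := by
  have h := integral_dbar_div_self (f := fun w => f (w + z)) (by fun_prop)
    (hs.comp_homeomorph (Homeomorph.addRight z))
  have h2 : ∀ w, dbar (fun w => f (w + z)) w = dbar f (w + z) := fun w => by
    simp [dbar, fderiv_comp_add_right]
  rw [zero_add] at h
  rw [← h, ← integral_add_right_eq_self _ z]
  simp [h2]

lemma integrable_indicator_closedBall_norm_inv (R : ℝ) :
    Integrable ((Metric.closedBall (0 : ℂ) R).indicator fun w => ‖w‖⁻¹) := by
  refine ⟨(Measurable.indicator (by fun_prop)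
    Metric.isClosed_closedBall.measurableSet).aestronglyMeasurable, ?_⟩
  rw [HasFiniteIntegral, ← Complex.lintegral_comp_polarCoord_symm]
  have hle : ∀ p ∈ polarCoord.target, ENNReal.ofReal p.1 •
      ‖(Metric.closedBall (0 : ℂ) R).indicator (fun w => ‖w‖⁻¹) (Complex.polarCoord.symm p)‖ₑ ≤
      (Icc (0 : ℝ) R ×ˢ Icc (-Real.pi) Real.pi).indicator 1 p := by
    rintro p ⟨hp1, hp2⟩
    have hp1' : 0 < p.1 := hp1
    have hn : ‖Complex.polarCoord.symm p‖ = p.1 := by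
      rw [Complex.norm_polarCoord_symm, abs_of_pos hp1']
    by_cases hR : p.1 ≤ R
    · have hmem : p ∈ Icc (0 : ℝ) R ×ˢ Icc (-Real.pi) Real.pi :=
        ⟨⟨hp1'.le, hR⟩, Ioo_subset_Icc_self hp2⟩
      rw [indicator_of_mem (by rwa [mem_closedBall_zero_iff, hn]), indicator_of_mem hmem, hn,
        Real.enorm_of_nonneg (inv_nonneg.2 hp1'.le), smul_eq_mul, ← ENNReal.ofReal_mul hp1'.le,
        mul_inv_cancel₀ hp1'.ne']
      simp
    · rw [indicator_of_notMem (by rwa [mem_closedBall_zero_iff, hn])]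
      simp
  refine (setLIntegral_mono' polarCoord.open_target.measurableSet hle).trans_lt ?_
  refine (setLIntegral_le_lintegral _ _).trans_lt ?_
  rw [lintegral_indicator_one (measurableSet_Icc.prod measurableSet_Icc)]
  exact (isCompact_Icc.prod isCompact_Icc).measure_lt_top

/-- The Green formula, with the winding number as density. -/
lemma integral_curve_eq_integral_dbar_mul_windingIntegral {f : ℂ → ℂ} (hf : ContDiff ℝ 1 f)
    (hs : HasCompactSupport f) {γ : ℝ → ℂ} (hγ : ContDiff ℝ 1 γ) {T : ℝ} (hT : 0 ≤ T) :
    2 * Real.pi * ∫ t in (0 : ℝ)..T, f (γ t) * deriv γ t =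
      ∫ w, dbar f w * windingIntegral γ T w := by
  have hdc := continuous_dbar hf
  have hγd := hγ.continuous_deriv le_rfl
  have hγc := hγ.continuous
  obtain ⟨R, hR0, hR⟩ := exists_pos_forall_norm_gt_eq_zero (hasCompactSupport_dbar hs)
  obtain ⟨C, hC⟩ := (hasCompactSupport_dbar hs).exists_bound_of_continuous hdc
  obtain ⟨B, hB⟩ := (isCompact_Icc (a := (0 : ℝ)) (b := T)).exists_bound_of_continuousOn
    hγc.continuousOn
  obtain ⟨D, hD⟩ := (isCompact_Icc (a := (0 : ℝ)) (b := T)).exists_bound_of_continuousOn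
    hγd.continuousOn
  have hC0 : 0 ≤ C := (norm_nonneg _).trans (hC 0)
  have hD0 : 0 ≤ D := (norm_nonneg _).trans (hD 0 ⟨le_rfl, hT⟩)
  set k : ℂ → ℝ := fun w => C * D *
    (Metric.closedBall (0 : ℂ) (R + B)).indicator (fun w => ‖w‖⁻¹) w with hk
  have hki : Integrable k := (integrable_indicator_closedBall_norm_inv (R + B)).const_mul (C * D)
  set F : ℝ → ℂ → ℂ := fun t w => dbar f w / (w - γ t) * deriv γ t with hF
  have hFb : ∀ t ∈ Icc (0 : ℝ) T, ∀ w, ‖F t w‖ ≤ k (w - γ t) := by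
    intro t ht w
    by_cases hw : ‖w‖ ≤ R
    · have hmem : w - γ t ∈ Metric.closedBall (0 : ℂ) (R + B) := by
        rw [mem_closedBall_zero_iff]
        exact (norm_sub_le _ _).trans (add_le_add hw (hB t ht))
      simp only [hF, hk]
      rw [indicator_of_mem hmem, norm_mul, norm_div, div_eq_mul_inv]
      calc ‖dbar f w‖ * ‖w - γ t‖⁻¹ * ‖deriv γ t‖ ≤ C * ‖w - γ t‖⁻¹ * D := by
            gcongr
            · exact hC w
            · exact hD t ht
        _ = C * D * ‖w - γ t‖⁻¹ := by ring
    · have h0 : F t w = 0 := by simp [hF, hR w (not_le.1 hw)]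
      rw [h0, norm_zero]
      exact mul_nonneg (mul_nonneg hC0 hD0) (indicator_nonneg (fun _ _ => by positivity) _)
  have hFm : Measurable (Function.uncurry F) := by
    simp only [hF, Function.uncurry_def]
    have := hdc.measurable
    have := hγc.measurable
    have := hγd.measurable
    fun_prop
  have hFi : Integrable (Function.uncurry F) ((volume.restrict (Ioc 0 T)).prod volume) := by
    have hmeas : AEStronglyMeasurable (Function.uncurry F)
        ((volume.restrict (Ioc 0 T)).prod volume) := hFm.aestronglyMeasurable
    have hinner : ∀ t ∈ Icc (0 : ℝ) T, Integrable (F t) := fun t ht =>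
      (hki.comp_sub_right (γ t)).mono' (hFm.comp measurable_prodMk_left).aestronglyMeasurable
        (ae_of_all _ (hFb t ht))
    refine (integrable_prod_iff hmeas).2 ⟨?_, ?_⟩
    · filter_upwards [ae_restrict_mem measurableSet_Ioc] with t ht
      exact hinner t (Ioc_subset_Icc_self ht)
    · refine Integrable.mono' (g := fun _ => ∫ w, k w) (integrable_const _)
        hmeas.norm.integral_prod_right' ?_
      filter_upwards [ae_restrict_mem measurableSet_Ioc] with t ht
      rw [Real.norm_of_nonneg (integral_nonneg fun _ => norm_nonneg _),
        ← integral_sub_right_eq_self k (γ t)]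
      exact integral_mono (hinner t (Ioc_subset_Icc_self ht)).norm (hki.comp_sub_right (γ t))
        (hFb t (Ioc_subset_Icc_self ht))
  have hswap := integral_integral_swap hFi
  have hl : ∀ t, ∫ w, F t w = -(2 * Real.pi) * (f (γ t) * deriv γ t) := by
    intro t
    simp only [hF]
    rw [integral_mul_const, integral_dbar_div_sub hf hs, mul_assoc]
  have hr : ∀ w, ∫ t in Ioc 0 T, F t w = -(dbar f w * windingIntegral γ T w) := by
    intro w
    rw [windingIntegral, intervalIntegral.integral_of_le hT, ← integral_const_mul, ← integral_neg]
    refine integral_congr_ae (ae_of_all _ fun t => ?_)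
    simp only [hF]
    rw [← neg_sub (γ t) w, div_neg]
    ring
  simp only [hl, hr, integral_neg, integral_const_mul] at hswap
  rw [intervalIntegral.integral_of_le hT]
  linear_combination -hswap

lemma volume_range_eq_zero_of_differentiable {γ : ℝ → ℂ} (hγ : Differentiable ℝ γ) :
    volume (range γ) = 0 := by
  have h1 : volume {z : ℂ | z.im = 0} = 0 := by
    have h2 : ({z : ℂ | z.im = 0} : Set ℂ) = (LinearMap.ker Complex.imLm : Set ℂ) := by
      ext z
      simp
    rw [h2]
    refine Measure.addHaar_submodule _ _ fun htop => ?_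
    have : Complex.I ∈ LinearMap.ker Complex.imLm := by simp [htop]
    simp at this
  have h3 := addHaar_image_eq_zero_of_differentiableOn_of_addHaar_eq_zero volume
    (f := fun z : ℂ => γ z.re)
    ((hγ.comp Complex.reCLM.differentiable).differentiableOn (s := {z : ℂ | z.im = 0})) h1
  refine measure_mono_null ?_ h3
  rintro _ ⟨t, rfl⟩
  exact ⟨t, by simp, by simp⟩

lemma Function.Periodic.deriv_of_periodic {γ : ℝ → ℂ} {T : ℝ} (hT : Function.Periodic γ T) :
    Function.Periodic (deriv γ) T := by
  intro t
  rw [← deriv_comp_add_const, show (fun x => γ (x + T)) = γ from funext hT]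

/-- Short normal segments to a simple closed regular curve meet the curve only at their
foot point. -/
lemma eventually_normal_notMem_range {γ : ℝ → ℂ} (hγ : ContDiff ℝ 1 γ) {T : ℝ} (hT0 : 0 < T)
    (hT : Function.Periodic γ T) (hreg : ∀ t, deriv γ t ≠ 0)
    (hsimple : ∀ s t, γ s = γ t → Function.Periodic γ (s - t)) :
    ∀ᶠ s : ℝ in 𝓝 0, s ≠ 0 → ∀ t, γ t + s * (Complex.I * deriv γ t) ∉ range γ := by
  have hγd := hγ.continuous_deriv le_rfl
  have hγc := hγ.continuous
  have key : ∀ᶠ s : ℝ in 𝓝 0, ∀ p ∈ Icc (0 : ℝ) T ×ˢ Icc (0 : ℝ) T,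
      s ≠ 0 → γ p.1 + s * (Complex.I * deriv γ p.1) ≠ γ p.2 := by
    refine (isCompact_Icc.prod isCompact_Icc).eventually_forall_of_forall_eventually ?_
    rintro ⟨t₀, t₁⟩ -
    by_cases heq : γ t₀ = γ t₁
    · have hper := hsimple t₀ t₁ heq
      set v := deriv γ t₀ with hv
      have hv0 : 0 < ‖v‖ := norm_pos_iff.2 (hreg t₀)
      have hstrict : HasStrictDerivAt γ v t₀ := hγ.contDiffAt.hasStrictDerivAt one_ne_zero
      have h1 := (hasStrictDerivAt_iff_hasStrictFDerivAt.1 hstrict).isLittleO.def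
        (c := ‖v‖ / 4) (by positivity)
      have ht : Tendsto (fun z : ℝ × ℝ × ℝ => (z.2.2 + (t₀ - t₁), z.2.1))
          (𝓝 (0, t₀, t₁)) (𝓝 (t₀, t₀)) := by
        have : Continuous fun z : ℝ × ℝ × ℝ => (z.2.2 + (t₀ - t₁), z.2.1) := by fun_prop
        simpa using this.tendsto (0, t₀, t₁)
      have h2 : ∀ᶠ z : ℝ × ℝ × ℝ in 𝓝 (0, t₀, t₁), ‖deriv γ z.2.1 - v‖ < ‖v‖ / 4 := by
        have hc : Continuous fun z : ℝ × ℝ × ℝ => ‖deriv γ z.2.1 - v‖ := by fun_prop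
        refine hc.continuousAt.eventually_lt continuousAt_const ?_
        simpa [hv] using hreg t₀
      filter_upwards [ht.eventually h1, h2] with ⟨s, t, t'⟩ h3 h4 hs h5
      dsimp only at h3 h4 h5
      rw [hper t'] at h3
      set d := t' + (t₀ - t₁) - t with hd
      have h6 : (d : ℂ) * v - s * (Complex.I * v) =
          s * (Complex.I * (deriv γ t - v)) - (γ t' - γ t - d * v) := by
        rw [← h5]
        ring
      have h7 : ‖γ t' - γ t - d * v‖ ≤ ‖v‖ / 4 * |d| := by
        simpa [Complex.real_smul] using h3
      have h8 : ‖(d : ℂ) * v - s * (Complex.I * v)‖ ≤ |s| * (‖v‖ / 4) + ‖v‖ / 4 * |d| := by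
        rw [h6]
        refine (norm_sub_le _ _).trans (add_le_add ?_ h7)
        rw [norm_mul, norm_mul, Complex.norm_I, one_mul, Complex.norm_real, Real.norm_eq_abs]
        gcongr
      have h9 : ‖(d : ℂ) * v - s * (Complex.I * v)‖ = ‖(d : ℂ) - s * Complex.I‖ * ‖v‖ := by
        rw [← norm_mul]
        congr 1
        ring
      have h10 : |d| ≤ ‖(d : ℂ) - s * Complex.I‖ := by
        simpa using Complex.abs_re_le_norm ((d : ℂ) - s * Complex.I)
      have h11 : |s| ≤ ‖(d : ℂ) - s * Complex.I‖ := by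
        simpa using Complex.abs_im_le_norm ((d : ℂ) - s * Complex.I)
      have h12 : 0 < |s| := abs_pos.2 hs
      rw [h9] at h8
      nlinarith
    · have hc : Continuous fun z : ℝ × ℝ × ℝ =>
          γ z.2.1 + z.1 * (Complex.I * deriv γ z.2.1) - γ z.2.2 := by fun_prop
      have h1 := hc.continuousAt (x := (0, t₀, t₁)).eventually_ne (y := 0) (by
        simpa [sub_eq_zero] using heq)
      filter_upwards [h1] with z hz _
      exact sub_ne_zero.1 hz
  filter_upwards [key] with s hs hs0 t
  rintro ⟨t', hut⟩
  have hpair : Function.Periodic (fun t => (γ t, deriv γ t)) T := fun t =>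
    Prod.ext (hT t) (hT.deriv_of_periodic t)
  obtain ⟨u, hu, hu'⟩ := hpair.exists_mem_Ico₀ hT0 t
  obtain ⟨u', hu1, hu1'⟩ := hT.exists_mem_Ico₀ hT0 t'
  rw [Prod.mk.injEq] at hu'
  refine hs (u, u') ⟨Ico_subset_Icc_self hu, Ico_subset_Icc_self hu1⟩ hs0 ?_
  simp only
  rw [← hu'.1, ← hu'.2, ← hu1', hut]

/-- From a point off a closed curve one can reach the curve along a normal segment. -/
lemma exists_normal_segment {γ : ℝ → ℂ} (hγ : ContDiff ℝ 1 γ) {T : ℝ} (hT0 : 0 < T)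
    (hT : Function.Periodic γ T) (hreg : ∀ t, deriv γ t ≠ 0) {z : ℂ} (hz : z ∉ range γ) :
    ∃ t s : ℝ, s ≠ 0 ∧ z = γ t + s * (Complex.I * deriv γ t) ∧
      ∀ r ∈ Ioc (0 : ℝ) 1, γ t + (r * s : ℝ) * (Complex.I * deriv γ t) ∉ range γ := by
  have hγc := hγ.continuous
  obtain ⟨t, -, ht⟩ := (isCompact_Icc (a := (0 : ℝ)) (b := T)).exists_isMinOn ⟨0, le_rfl, hT0.le⟩
    (f := fun t => ‖γ t - z‖ ^ 2) (by fun_prop)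
  have hmin : ∀ u, ‖γ t - z‖ ^ 2 ≤ ‖γ u - z‖ ^ 2 := by
    intro u
    obtain ⟨y, hy, hy'⟩ := hT.exists_mem_Ico₀ hT0 u
    rw [hy']
    exact ht (Ico_subset_Icc_self hy)
  have hd := (((hγ.differentiable one_ne_zero t).hasDerivAt).sub_const z).norm_sq
  have h0 := IsLocalMin.hasDerivAt_eq_zero (Eventually.of_forall hmin) hd
  set q := (z - γ t) / deriv γ t with hq
  have hq1 : z - γ t = q * deriv γ t := (div_mul_cancel₀ _ (hreg t)).symm
  have hqre : q.re = 0 := by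
    have hns : Complex.normSq (deriv γ t) ≠ 0 := by simpa using hreg t
    have h1 : γ t - z = -(q * deriv γ t) := by rw [← hq1]; ring
    rw [h1] at h0
    simp only [Complex.inner, map_neg, map_mul, Complex.mul_re, Complex.mul_im, Complex.neg_re,
      Complex.neg_im, Complex.conj_re, Complex.conj_im] at h0
    rw [Complex.normSq_apply] at hns
    refine (mul_eq_zero.1 (?_ : q.re * _ = 0)).resolve_right hns
    linear_combination -h0 / 2
  have hq2 : q = q.im * Complex.I := by
    apply Complex.ext <;> simp [hqre]
  have hz2 : z = γ t + q.im * (Complex.I * deriv γ t) := by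
    rw [← mul_assoc, ← hq2, ← hq1]
    ring
  have hzt : 0 < ‖γ t - z‖ := norm_pos_iff.2 fun h => hz ⟨t, sub_eq_zero.1 h⟩
  refine ⟨t, q.im, fun h => hz ⟨t, by simpa [h] using hz2.symm⟩, hz2, ?_⟩
  rintro r ⟨hr0, hr1⟩ ⟨u, hu⟩
  have h2 : γ u - z = (1 - r : ℝ) * (γ t - z) := by
    rw [hu]
    push_cast
    linear_combination -(r : ℂ) * hz2
  have h3 := hmin u
  rw [h2, norm_mul, Complex.norm_real, Real.norm_of_nonneg (by linarith), mul_pow] at h3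
  have h4 : 0 < ‖γ t - z‖ ^ 2 := by positivity
  have h5 : (1 - r) ^ 2 < 1 := by nlinarith
  nlinarith

lemma exists_windingIntegral_eq_zero_outside {γ : ℝ → ℂ} (hγ : ContDiff ℝ 1 γ) {T : ℝ}
    (hT0 : 0 < T) (hT : Function.Periodic γ T) :
    ∃ R : ℝ, (∀ t, γ t ∈ Metric.ball (0 : ℂ) R) ∧
      ∀ z ∉ Metric.ball (0 : ℂ) R, windingIntegral γ T z = 0 := by
  obtain ⟨B, hB⟩ := (isCompact_Icc (a := (0 : ℝ)) (b := T)).exists_bound_of_continuousOn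
    hγ.continuous.continuousOn
  have hB' : ∀ t, γ t ∈ Metric.ball (0 : ℂ) (B + 1) := by
    intro t
    obtain ⟨y, hy, hy'⟩ := hT.exists_mem_Ico₀ hT0 t
    rw [hy', mem_ball_zero_iff]
    linarith [hB y (Ico_subset_Icc_self hy)]
  refine ⟨B + 1, hB', fun z hz => ?_⟩
  have : ContractibleSpace (Metric.ball (0 : ℂ) (B + 1)) :=
    (convex_ball 0 (B + 1)).contractibleSpace ⟨_, hB' 0⟩
  have hsc : IsSimplyConnected (Metric.ball (0 : ℂ) (B + 1)) :=
    SimplyConnectedSpace.ofContractible _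
  exact windingIntegral_eq_zero_of_isSimplyConnected hγ hT hsc Metric.isOpen_ball hB' hz

/-- The winding integral of a simple closed regular curve takes at most one nonzero value `c`,
and this value is taken all along one side of the curve. -/
lemma exists_windingIntegral_eq_zero_or_eq {γ : ℝ → ℂ} (hγ : ContDiff ℝ 1 γ) {T : ℝ}
    (hT0 : 0 < T) (hT : Function.Periodic γ T) (hreg : ∀ t, deriv γ t ≠ 0)
    (hsimple : ∀ s t, γ s = γ t → Function.Periodic γ (s - t)) :
    ∃ (c : ℂ) (σ ε : ℝ), 0 < ε ∧
      (∀ z ∉ range γ, windingIntegral γ T z = 0 ∨ windingIntegral γ T z = c) ∧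
      ∀ t, ∀ s ∈ Ioo 0 ε, γ t + (σ * s : ℝ) * (Complex.I * deriv γ t) ∉ range γ ∧
        windingIntegral γ T (γ t + (σ * s : ℝ) * (Complex.I * deriv γ t)) = c := by
  obtain ⟨ε, hε, hnot⟩ := Metric.eventually_nhds_iff.1
    (eventually_normal_notMem_range hγ hT0 hT hreg hsimple)
  have hγd := hγ.continuous_deriv le_rfl
  have hγc := hγ.continuous
  set Φ : ℝ → ℝ × ℝ → ℂ := fun σ p => γ p.1 + (σ * p.2 : ℝ) * (Complex.I * deriv γ p.1) with hΦ
  have hoff : ∀ σ : ℝ, |σ| = 1 → ∀ p ∈ univ ×ˢ Ioo (0 : ℝ) ε, Φ σ p ∉ range γ := by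
    rintro σ hσ ⟨t, s⟩ ⟨-, hs0, hs⟩
    have hs0' : 0 < s := hs0
    have hσ0 : σ ≠ 0 := fun h => by simp [h] at hσ
    refine hnot ?_ (mul_ne_zero hσ0 hs0'.ne') t
    rw [Real.dist_eq, sub_zero, abs_mul, hσ, one_mul, abs_of_pos hs0']
    exact hs
  have hside : ∀ σ : ℝ, |σ| = 1 → ∀ p ∈ univ ×ˢ Ioo (0 : ℝ) ε, ∀ p' ∈ univ ×ˢ Ioo (0 : ℝ) ε,
      windingIntegral γ T (Φ σ p) = windingIntegral γ T (Φ σ p') := by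
    intro σ hσ p hp p' hp'
    have hΦc : Continuous (Φ σ) := by fun_prop
    refine windingIntegral_eq_of_isPreconnected hγ hT
      ((isPreconnected_univ.prod isPreconnected_Ioo).image (Φ σ) hΦc.continuousOn) ?_
      (mem_image_of_mem _ hp) (mem_image_of_mem _ hp')
    rintro _ ⟨p, hp, rfl⟩
    exact hoff σ hσ p hp
  have hp₀ : ((0 : ℝ), ε / 2) ∈ univ ×ˢ Ioo (0 : ℝ) ε := ⟨trivial, by simp [hε]⟩
  have hval : ∀ z ∉ range γ, windingIntegral γ T z = windingIntegral γ T (Φ 1 (0, ε / 2)) ∨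
      windingIntegral γ T z = windingIntegral γ T (Φ (-1) (0, ε / 2)) := by
    intro z hz
    obtain ⟨t, s, hs, hzt, hseg⟩ := exists_normal_segment hγ hT0 hT hreg hz
    have hs' : 0 < |s| := abs_pos.2 hs
    set r := min 1 (ε / (2 * |s|)) with hr
    have hr0 : 0 < r := lt_min one_pos (by positivity)
    have hrs : r * |s| < ε := by
      have h1 : r ≤ ε / (2 * |s|) := min_le_right _ _
      rw [le_div_iff₀ (by positivity)] at h1
      nlinarith
    have hc : Continuous fun r : ℝ => γ t + (r * s : ℝ) * (Complex.I * deriv γ t) := by fun_prop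
    have h1 := windingIntegral_eq_of_isPreconnected hγ hT
      (isPreconnected_Ioc.image _ hc.continuousOn) (by
        rintro _ ⟨r, hr, rfl⟩
        exact hseg r hr)
      (mem_image_of_mem _ (right_mem_Ioc.2 (zero_lt_one (α := ℝ))))
      (mem_image_of_mem _ (⟨hr0, min_le_left _ _⟩ : r ∈ Ioc (0 : ℝ) 1))
    rw [one_mul, ← hzt] at h1
    have hmem : (t, r * |s|) ∈ univ ×ˢ Ioo (0 : ℝ) ε := ⟨trivial, by positivity, hrs⟩
    rcases lt_or_gt_of_ne hs with hneg | hpos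
    · right
      rw [h1, ← hside (-1) (by simp) _ hmem _ hp₀]
      simp [hΦ, abs_of_neg hneg]
    · left
      rw [h1, ← hside 1 (by simp) _ hmem _ hp₀]
      simp [hΦ, abs_of_pos hpos]
  obtain ⟨R, hR, hR0⟩ := exists_windingIntegral_eq_zero_outside hγ hT0 hT
  have hfar : (R : ℂ) ∉ Metric.ball (0 : ℂ) R := by
    simp [le_abs_self]
  have hfar0 := hR0 _ hfar
  have hfarn : (R : ℂ) ∉ range γ := by
    rintro ⟨t, ht⟩
    exact hfar (ht ▸ hR t)
  rcases hval _ hfarn with h | h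
  · refine ⟨_, -1, ε, hε, fun z hz => ?_, fun t s hs => ⟨hoff (-1) (by simp) (t, s) ⟨trivial, hs⟩,
      hside (-1) (by simp) (t, s) ⟨trivial, hs⟩ _ hp₀⟩⟩
    rw [← hfar0, h]
    exact hval z hz
  · refine ⟨_, 1, ε, hε, fun z hz => ?_, fun t s hs => ⟨hoff 1 (by simp) (t, s) ⟨trivial, hs⟩,
      hside 1 (by simp) (t, s) ⟨trivial, hs⟩ _ hp₀⟩⟩
    rw [← hfar0, h]
    exact (hval z hz).symm

lemma vectorField_ne_zero_of_nonconstant {F : ℂ → ℂ} (hF : ContDiff ℝ 1 F)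
    (hFs : HasCompactSupport F) {γ : ℝ → ℂ} (hγ : ∀ t, HasDerivAt γ (F (γ t)) t)
    (hne : ¬ ∃ c, ∀ t, γ t = c) (t : ℝ) : F (γ t) ≠ 0 := by
  intro h
  obtain ⟨C, hC⟩ := hF.lipschitzWith_of_hasCompactSupport hFs one_ne_zero
  have := ODE_solution_unique_univ (v := fun _ => F) (s := fun _ => univ) (t₀ := t)
    (g := fun _ => γ t) (fun _ => hC.lipschitzOnWith) (fun t => ⟨hγ t, trivial⟩)
    (fun u => ⟨by simpa [h] using hasDerivAt_const u (γ t), trivial⟩) rfl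
  exact hne ⟨γ t, fun u => congrFun this u⟩

lemma periodic_sub_of_eq {F : ℂ → ℂ} (hF : ContDiff ℝ 1 F)
    (hFs : HasCompactSupport F) {γ : ℝ → ℂ} (hγ : ∀ t, HasDerivAt γ (F (γ t)) t)
    {s t : ℝ} (hst : γ s = γ t) : Function.Periodic γ (s - t) := by
  obtain ⟨C, hC⟩ := hF.lipschitzWith_of_hasCompactSupport hFs one_ne_zero
  have := ODE_solution_unique_univ (v := fun _ => F) (s := fun _ => univ) (t₀ := t)
    (f := fun u => γ (u + (s - t))) (g := γ) (fun _ => hC.lipschitzOnWith)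
    (fun u => ⟨(hγ (u + (s - t))).comp_add_const u (s - t), trivial⟩)
    (fun u => ⟨hγ u, trivial⟩) (by simpa using hst)
  exact fun u => congrFun this u

/-- If a rescaling of a planar vector field on a simply connected open set has divergence of
constant sign, then this divergence vanishes along every periodic orbit. -/
lemma re_dbar_eq_zero_of_periodic_orbit {W : Set ℂ} (hW : IsOpen W) (hWs : IsSimplyConnected W)
    {F : ℂ → ℂ} (hF : ContDiffOn ℝ 1 F W) {lam : ℂ → ℝ} (hlam : ContDiffOn ℝ 1 lam W)
    {γ : ℝ → ℂ} {T : ℝ} (hT0 : 0 < T) (hT : Function.Periodic γ T) (hγW : ∀ t, γ t ∈ W)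
    (hγ : ∀ t, HasDerivAt γ (F (γ t)) t) (hne : ¬ ∃ c, ∀ t, γ t = c)
    (hsign : (∀ z ∈ W, 0 ≤ (dbar (fun w => starRingEnd ℂ (lam w * F w)) z).re) ∨
      (∀ z ∈ W, (dbar (fun w => starRingEnd ℂ (lam w * F w)) z).re ≤ 0)) (t : ℝ) :
    (dbar (fun w => starRingEnd ℂ (lam w * F w)) (γ t)).re = 0 := by
  have hγc : Continuous γ := continuous_iff_continuousAt.2 fun t => (hγ t).continuousAt
  have hrange : IsCompact (range γ) := by
    have h1 : range γ = γ '' Icc 0 T := by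
      refine Subset.antisymm ?_ (image_subset_range _ _)
      rintro _ ⟨u, rfl⟩
      obtain ⟨y, hy, hy'⟩ := hT.exists_mem_Ico₀ hT0 u
      exact ⟨y, Ico_subset_Icc_self hy, hy'.symm⟩
    rw [h1]
    exact isCompact_Icc.image hγc
  obtain ⟨F₁, hF₁, hF₁s, hF₁F⟩ := exists_contDiff_hasCompactSupport_eventuallyEq hW hrange
    (range_subset_iff.2 hγW) hF
  have hF₁γ : ∀ t, F₁ (γ t) = F (γ t) := fun t => (hF₁F _ (mem_range_self t)).eq_of_nhds
  have hγ₁ : ∀ t, HasDerivAt γ (F₁ (γ t)) t := fun t => by rw [hF₁γ]; exact hγ t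
  have hderiv : deriv γ = fun t => F₁ (γ t) := funext fun t => (hγ₁ t).deriv
  have hγC : ContDiff ℝ 1 γ := by
    rw [contDiff_one_iff_deriv, hderiv]
    exact ⟨fun t => (hγ₁ t).differentiableAt, hF₁.continuous.comp hγc⟩
  have hreg : ∀ t, deriv γ t ≠ 0 := fun t => by
    rw [hderiv]
    exact vectorField_ne_zero_of_nonconstant hF₁ hF₁s hγ₁ hne t
  obtain ⟨c, σ, ε, hε, hval, hside⟩ := exists_windingIntegral_eq_zero_or_eq hγC hT0 hT hreg
    fun s t hst => periodic_sub_of_eq hF₁ hF₁s hγ₁ hst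
  have hnull : ∀ᵐ z : ℂ, z ∉ range γ :=
    measure_eq_zero_iff_ae_notMem.1
      (volume_range_eq_zero_of_differentiable (hγC.differentiable one_ne_zero))
  have hstar : ContDiff ℝ 1 (starRingEnd ℂ : ℂ → ℂ) := Complex.conjCLE.contDiff
  have hc0 : c ≠ 0 := by
    rintro rfl
    have h1 := integral_curve_eq_integral_dbar_mul_windingIntegral (hstar.comp hF₁)
      (hF₁s.comp_left (map_zero _)) hγC hT0.le
    have h2 : ∫ w, dbar (starRingEnd ℂ ∘ F₁) w * windingIntegral γ T w = 0 := by
      refine integral_eq_zero_of_ae ?_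
      filter_upwards [hnull] with z hz
      simp [(or_self_iff.1 (hval z hz))]
    have h3 : ∀ t, (starRingEnd ℂ ∘ F₁) (γ t) * deriv γ t =
        ((Complex.normSq (deriv γ t) : ℝ) : ℂ) := fun t => by
      rw [hderiv, Complex.normSq_eq_conj_mul_self, Function.comp_apply]
    have h4 : 0 < ∫ t in (0 : ℝ)..T, Complex.normSq (deriv γ t) :=
      intervalIntegral.intervalIntegral_pos_of_pos
        ((Complex.continuous_normSq.comp (hγC.continuous_deriv le_rfl)).intervalIntegrable _ _)
        (fun t => Complex.normSq_pos.2 (hreg t)) hT0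
    simp only [h3] at h1
    rw [h2, intervalIntegral.integral_ofReal] at h1
    have h5 : 2 * Real.pi * ∫ t in (0 : ℝ)..T, Complex.normSq (deriv γ t) = 0 := by
      exact_mod_cast h1
    have := Real.pi_pos
    exact absurd h5 (by positivity)
  have hcre : c.re = 0 := by
    obtain ⟨hn, hv⟩ := hside 0 (ε / 2) ⟨by positivity, by linarith⟩
    obtain ⟨n, hn⟩ := exists_windingIntegral_eq hγC hT hn
    rw [← hv, hn]
    simp
  have hcim : c.im ≠ 0 := fun h => hc0 (Complex.ext hcre h)
  have hwc := continuousOn_windingIntegral hγC T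
  have hopen : IsOpen (range γ)ᶜ := hrange.isClosed.isOpen_compl
  set D : Set ℂ := (range γ)ᶜ ∩ windingIntegral γ T ⁻¹' {0}ᶜ with hD
  have hDo : IsOpen D := hwc.isOpen_inter_preimage hopen isClosed_singleton.isOpen_compl
  have hDc : ∀ z ∈ D, windingIntegral γ T z = c := fun z hz => (hval z hz.1).resolve_left hz.2
  set K : Set ℂ := ((range γ)ᶜ ∩ windingIntegral γ T ⁻¹' {c}ᶜ)ᶜ with hK
  have hDK : D ⊆ K := fun z hz h => h.2 (hDc z hz)
  have hγK : ∀ t, γ t ∈ K := fun t h => h.1 (mem_range_self t)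
  have hKc : ∀ z ∈ K, z ∉ range γ → windingIntegral γ T z = c := by
    intro z hz hz'
    by_contra h
    exact hz ⟨hz', h⟩
  have hKcomp : IsCompact K := by
    obtain ⟨R, hR, hR0⟩ := exists_windingIntegral_eq_zero_outside hγC hT0 hT
    refine Metric.isCompact_of_isClosed_isBounded
      (hwc.isOpen_inter_preimage hopen isClosed_singleton.isOpen_compl).isClosed_compl
      ((Metric.isBounded_ball (x := (0 : ℂ)) (r := R)).subset fun z hz => ?_)
    by_contra hzR
    refine hc0 ?_
    rw [← hKc z hz ?_, hR0 z hzR]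
    rintro ⟨t, rfl⟩
    exact hzR (hR t)
  have hKW : K ⊆ W := by
    intro z hz
    by_contra hzW
    refine hc0 ?_
    rw [← hKc z hz ?_, windingIntegral_eq_zero_of_isSimplyConnected hγC hT hWs hW hγW hzW]
    rintro ⟨t, rfl⟩
    exact hzW (hγW t)
  have hY : ContDiffOn ℝ 1 (fun w => starRingEnd ℂ (lam w * F w)) W :=
    hstar.comp_contDiffOn ((Complex.ofRealCLM.contDiff.comp_contDiffOn hlam).mul hF)
  obtain ⟨f, hf, hfs, hfY⟩ := exists_contDiff_hasCompactSupport_eventuallyEq hW hKcomp hKW hY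
  have hdbar : ∀ z ∈ K, dbar f z = dbar (fun w => starRingEnd ℂ (lam w * F w)) z := by
    intro z hz
    simp only [dbar, (hfY z hz).fderiv_eq]
  have hdc := continuous_dbar hf
  have hdi : Integrable (dbar f) := hdc.integrable_of_hasCompactSupport (hasCompactSupport_dbar hfs)
  have hgreen := integral_curve_eq_integral_dbar_mul_windingIntegral hf hfs hγC hT0.le
  have hleft : ∀ t, f (γ t) * deriv γ t = ((lam (γ t) * Complex.normSq (F (γ t)) : ℝ) : ℂ) := by
    intro t
    rw [hderiv, (hfY _ (hγK t)).eq_of_nhds]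
    simp only [hF₁γ]
    rw [map_mul, Complex.conj_ofReal, Complex.ofReal_mul, Complex.normSq_eq_conj_mul_self]
    ring
  have hright : ∫ w, dbar f w * windingIntegral γ T w = (∫ w in D, dbar f w) * c := by
    rw [← integral_mul_const, ← integral_indicator hDo.measurableSet]
    refine integral_congr_ae ?_
    filter_upwards [hnull] with z hz
    by_cases hzD : z ∈ D
    · rw [indicator_of_mem hzD, hDc z hzD]
    · rw [indicator_of_notMem hzD]
      have : windingIntegral γ T z = 0 := by
        by_contra h
        exact hzD ⟨hz, h⟩
      rw [this, mul_zero]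
  have hre : ∫ w in D, (dbar f w).re = 0 := by
    simp only [hleft] at hgreen
    rw [hright, intervalIntegral.integral_ofReal] at hgreen
    have h1 := congrArg Complex.im hgreen
    simp only [Complex.mul_im, Complex.mul_re, Complex.ofReal_im, Complex.ofReal_re, hcre] at h1
    have h2 : (∫ w in D, dbar f w).re * c.im = 0 := by
      simpa using h1.symm
    have h3 := integral_re (𝕜 := ℂ) hdi.integrableOn (μ := volume.restrict D)
    simp only [RCLike.re_to_complex] at h3
    rw [h3]
    exact (mul_eq_zero.1 h2).resolve_right hcim
  have hrei : IntegrableOn (fun w => (dbar f w).re) D := hdi.re.integrableOn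
  have hrec : Continuous fun w => (dbar f w).re := Complex.continuous_re.comp hdc
  have hae : (fun w => (dbar f w).re) =ᵐ[volume.restrict D] 0 := by
    rcases hsign with h | h
    · refine (setIntegral_eq_zero_iff_of_nonneg_ae ?_ hrei).1 hre
      filter_upwards [ae_restrict_mem hDo.measurableSet] with z hz
      rw [hdbar z (hDK hz)]
      exact h z (hKW (hDK hz))
    · have h1 : (fun w => -(dbar f w).re) =ᵐ[volume.restrict D] 0 := by
        refine (setIntegral_eq_zero_iff_of_nonneg_ae ?_ hrei.neg).1 (by simp [integral_neg, hre])
        filter_upwards [ae_restrict_mem hDo.measurableSet] with z hz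
        show (0 : ℝ) ≤ -(dbar f z).re
        rw [hdbar z (hDK hz)]
        exact neg_nonneg.2 (h z (hKW (hDK hz)))
      filter_upwards [h1] with z hz
      simpa using hz
  have hzero := Measure.eqOn_open_of_ae_eq hae hDo hrec.continuousOn continuousOn_const
  rw [← hdbar _ (hγK t)]
  have hlim : Tendsto (fun s : ℝ => (dbar f (γ t + (σ * s : ℝ) * (Complex.I * deriv γ t))).re)
      (𝓝[>] 0) (𝓝 (dbar f (γ t)).re) := by
    have hcont : Continuous fun s : ℝ =>
        (dbar f (γ t + (σ * s : ℝ) * (Complex.I * deriv γ t))).re :=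
      hrec.comp (by fun_prop)
    simpa using (hcont.tendsto 0).mono_left nhdsWithin_le_nhds
  refine tendsto_nhds_unique hlim (tendsto_const_nhds.congr' ?_)
  filter_upwards [Ioo_mem_nhdsGT hε] with s hs
  obtain ⟨h1, h2⟩ := hside t s hs
  exact (hzero ⟨h1, by rw [mem_preimage, h2]; exact hc0⟩).symm

lemma re_dbar_conj_rescale {X : ℝ × ℝ → ℝ × ℝ} {V : ℝ × ℝ → ℝ} {k : ℝ} (hk : k ≠ 0) {z : ℂ}
    (hX : DifferentiableAt ℝ X (Complex.equivRealProdCLM z))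
    (hV : DifferentiableAt ℝ V (Complex.equivRealProdCLM z))
    (hV0 : V (Complex.equivRealProdCLM z) ≠ 0) :
    (dbar (fun w => starRingEnd ℂ
        ((Real.exp (-(1 / k) * Real.log (V (Complex.equivRealProdCLM w))) : ℝ) *
        Complex.equivRealProdCLM.symm (X (Complex.equivRealProdCLM w)))) z).re =
      -(Real.exp (-(1 / k) * Real.log (V (Complex.equivRealProdCLM z))) /
          (k * V (Complex.equivRealProdCLM z))) *
        (fderiv ℝ V (Complex.equivRealProdCLM z) (X (Complex.equivRealProdCLM z)) -
          k * V (Complex.equivRealProdCLM z) *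
          (fderiv ℝ (fun q => (X q).1) (Complex.equivRealProdCLM z) ((1 : ℝ), (0 : ℝ)) +
          fderiv ℝ (fun q => (X q).2) (Complex.equivRealProdCLM z) ((0 : ℝ), (1 : ℝ)))) := by
  set e := Complex.equivRealProdCLM with he
  have h1 : fderiv ℝ (fun q => (X q).1) (e z) = (ContinuousLinearMap.fst ℝ ℝ ℝ).comp
      (fderiv ℝ X (e z)) := hX.hasFDerivAt.fst.fderiv
  have h2 : fderiv ℝ (fun q => (X q).2) (e z) = (ContinuousLinearMap.snd ℝ ℝ ℝ).comp
      (fderiv ℝ X (e z)) := hX.hasFDerivAt.snd.fderiv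
  have hez : HasFDerivAt (fun w => e w) (e : ℂ →L[ℝ] ℝ × ℝ) z := e.hasFDerivAt
  have hXz := hX.hasFDerivAt.comp z hez
  have hVz := hV.hasFDerivAt.comp z hez
  have hl := ((hVz.log hV0).const_mul (-(1 / k))).exp
  have hF := (e.symm : ℝ × ℝ →L[ℝ] ℂ).hasFDerivAt.comp z hXz
  have hG := (Complex.conjCLE : ℂ →L[ℝ] ℂ).hasFDerivAt.comp z (hl.smul hF)
  have hfun : (fun w => starRingEnd ℂ ((Real.exp (-(1 / k) * Real.log (V (e w))) : ℝ) *
      e.symm (X (e w)))) = (Complex.conjCLE : ℂ →L[ℝ] ℂ) ∘ (fun w =>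
        Real.exp (-(1 / k) * Real.log ((V ∘ fun w => e w) w)) •
          ((e.symm : ℝ × ℝ →L[ℝ] ℂ) ∘ (X ∘ fun w => e w)) w) := by
    funext w
    simp [Complex.real_smul]
  rw [hfun, dbar]
  erw [hG.fderiv]
  have he1 : e 1 = (1, 0) := by simp [he, Complex.equivRealProdCLM_apply]
  have heI : e Complex.I = (0, 1) := by simp [he, Complex.equivRealProdCLM_apply]
  have hdec : fderiv ℝ V (e z) (X (e z)) = (X (e z)).1 * fderiv ℝ V (e z) (1, 0) +
      (X (e z)).2 * fderiv ℝ V (e z) (0, 1) := by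
    conv_lhs => rw [show X (e z) = (X (e z)).1 • ((1 : ℝ), (0 : ℝ)) +
      (X (e z)).2 • ((0 : ℝ), (1 : ℝ)) by ext <;> simp]
    simp only [map_add, map_smul, smul_eq_mul]
  rw [h1, h2, hdec]
  have hre : ∀ p, (e.symm p).re = p.1 := fun p => rfl
  have him : ∀ p, (e.symm p).im = p.2 := fun p => rfl
  simp only [Function.comp_apply]
  generalize Real.exp (-(1 / k) * Real.log (V (e z))) = r
  simp [he1, heI, hre, him]
  field_simp
  ring

/-- A function with derivative `m + k v d`, where `m` has constant sign, that vanishes at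
two points vanishes in between. -/
lemma eqOn_zero_of_hasDerivAt_add_mul {v m d : ℝ → ℝ} {k a b : ℝ} (hd : Continuous d)
    (hv : ∀ t, HasDerivAt v (m t + k * v t * d t) t) (hm : (∀ t, 0 ≤ m t) ∨ ∀ t, m t ≤ 0)
    (ha : v a = 0) (hb : v b = 0) {t : ℝ} (hat : a ≤ t) (htb : t ≤ b) : v t = 0 := by
  have hE : ∀ t, HasDerivAt (fun t => Real.exp (-(k * ∫ s in (0 : ℝ)..t, d s)))
      (Real.exp (-(k * ∫ s in (0 : ℝ)..t, d s)) * -(k * d t)) t := fun t =>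
    ((hd.integral_hasStrictDerivAt 0 t).hasDerivAt.const_mul k).neg.exp
  have hw : ∀ t, HasDerivAt (fun t => v t * Real.exp (-(k * ∫ s in (0 : ℝ)..t, d s)))
      (m t * Real.exp (-(k * ∫ s in (0 : ℝ)..t, d s))) t := fun t => by
    refine ((hv t).mul (hE t)).congr_deriv ?_
    ring
  have key : v t * Real.exp (-(k * ∫ s in (0 : ℝ)..t, d s)) = 0 := by
    rcases hm with hm | hm
    · have hmono := monotone_of_deriv_nonneg (fun t => (hw t).differentiableAt) fun t => by
        rw [(hw t).deriv]
        exact mul_nonneg (hm t) (Real.exp_pos _).le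
      have h1 := hmono hat
      have h2 := hmono htb
      simp only [ha, hb, zero_mul] at h1 h2
      exact le_antisymm h2 h1
    · have hmono := antitone_of_deriv_nonpos (fun t => (hw t).differentiableAt) fun t => by
        rw [(hw t).deriv]
        exact mul_nonpos_of_nonpos_of_nonneg (hm t) (Real.exp_pos _).le
      have h1 := hmono hat
      have h2 := hmono htb
      simp only [ha, hb, zero_mul] at h1 h2
      exact le_antisymm h1 h2
  exact (mul_eq_zero.1 key).resolve_right (Real.exp_pos _).ne'

lemma forall_pos_or_forall_neg_of_isPreconnected {α : Type*} [TopologicalSpace α] {s : Set α}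
    (hs : IsPreconnected s) {f : α → ℝ} (hf : ContinuousOn f s) (h0 : ∀ x ∈ s, f x ≠ 0) :
    (∀ x ∈ s, 0 < f x) ∨ ∀ x ∈ s, f x < 0 := by
  by_contra! h
  obtain ⟨⟨x, hx, hx'⟩, y, hy, hy'⟩ := h
  obtain ⟨w, hw, hw'⟩ := hs.intermediate_value hx hy hf ⟨hx', hy'⟩
  exact h0 w hw hw'

theorem bendixson_dulac_criterion
    (U : Set (ℝ × ℝ)) (hU : IsOpen U)
    (X : ℝ × ℝ → ℝ × ℝ) (hX : ContDiffOn ℝ 1 X U)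
    (V : ℝ × ℝ → ℝ) (hV : ContDiffOn ℝ 1 V U)
    (k : ℝ) (hk : 0 < k)
    (M : ℝ × ℝ → ℝ)
    (hM : ∀ p ∈ U, M p =
      fderiv ℝ V p (X p) -
        k * V p * (fderiv ℝ (fun q => (X q).1) p ((1 : ℝ), (0 : ℝ)) +
          fderiv ℝ (fun q => (X q).2) p ((0 : ℝ), (1 : ℝ))))
    (h1 : (∀ p ∈ U, 0 ≤ M p) ∨ (∀ p ∈ U, M p ≤ 0))
    (h2 : ∀ γ : ℝ → ℝ × ℝ, (∀ t, γ t ∈ U) →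
      (∀ t : ℝ, HasDerivAt γ (X (γ t)) t) → (¬ ∃ c : ℝ × ℝ, ∀ t, γ t = c) →
      ¬ (∀ t : ℝ, M (γ t) = 0))
    (h3 : ∀ p ∈ U \ {q : ℝ × ℝ | V q = 0},
      SimplyConnectedSpace (connectedComponentIn (U \ {q : ℝ × ℝ | V q = 0}) p)) :
    ¬ ∃ (γ : ℝ → ℝ × ℝ) (T : ℝ), 0 < T ∧ Function.Periodic γ T ∧
        (∀ t, γ t ∈ U) ∧ (∀ t : ℝ, HasDerivAt γ (X (γ t)) t) ∧
        ¬ ∃ c : ℝ × ℝ, ∀ t, γ t = c := by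
  rintro ⟨γ, T, hT0, hT, hγU, hγ, hne⟩
  refine h2 γ hγU hγ hne ?_
  have hγc : Continuous γ := continuous_iff_continuousAt.2 fun t => (hγ t).continuousAt
  have hXd : ∀ p ∈ U, DifferentiableAt ℝ X p := fun p hp =>
    (hX.differentiableOn one_ne_zero).differentiableAt (hU.mem_nhds hp)
  have hVd : ∀ p ∈ U, DifferentiableAt ℝ V p := fun p hp =>
    (hV.differentiableOn one_ne_zero).differentiableAt (hU.mem_nhds hp)
  have hv : ∀ t, HasDerivAt (fun t => V (γ t)) (fderiv ℝ V (γ t) (X (γ t))) t := fun t =>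
    (hVd _ (hγU t)).hasFDerivAt.comp_hasDerivAt t (hγ t)
  by_cases hV0 : ∃ t, V (γ t) = 0
  · obtain ⟨t₀, ht₀⟩ := hV0
    have hd : Continuous fun t => fderiv ℝ (fun q => (X q).1) (γ t) ((1 : ℝ), (0 : ℝ)) +
        fderiv ℝ (fun q => (X q).2) (γ t) ((0 : ℝ), (1 : ℝ)) := by
      have e1 := (hX.fst.continuousOn_fderiv_of_isOpen hU le_rfl).comp_continuous hγc hγU
      have e2 := (hX.snd.continuousOn_fderiv_of_isOpen hU le_rfl).comp_continuous hγc hγU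
      exact (e1.clm_apply continuous_const).add (e2.clm_apply continuous_const)
    have hVγ : ∀ t, V (γ t) = 0 := by
      intro t
      obtain ⟨y, hy, hy'⟩ := hT.exists_mem_Ico hT0 t t₀
      rw [hy']
      refine eqOn_zero_of_hasDerivAt_add_mul (v := fun t => V (γ t)) (m := fun t => M (γ t))
        (k := k) hd (fun t => (hv t).congr_deriv ?_)
        (h1.imp (fun h t => h _ (hγU t)) fun h t => h _ (hγU t)) ht₀
        (b := t₀ + T) (by simpa [hT t₀] using ht₀) hy.1 hy.2.le
      rw [hM _ (hγU t)]
      ring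
    intro t
    have : fderiv ℝ V (γ t) (X (γ t)) = 0 := by
      refine (hv t).unique ?_
      simp only [hVγ]
      exact hasDerivAt_const _ _
    rw [hM _ (hγU t), this, hVγ t]
    simp
  · push Not at hV0
    set S := U \ {q : ℝ × ℝ | V q = 0} with hS
    have hSo : IsOpen S := hV.continuousOn.isOpen_inter_preimage hU isOpen_compl_singleton
    have hγS : ∀ t, γ t ∈ S := fun t => ⟨hγU t, hV0 t⟩
    set W₀ := connectedComponentIn S (γ 0) with hW₀
    have hW₀S : W₀ ⊆ S := connectedComponentIn_subset _ _
    have hW₀o : IsOpen W₀ := hSo.connectedComponentIn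
    have hγW : ∀ t, γ t ∈ W₀ := fun t =>
      (isPreconnected_range hγc).subset_connectedComponentIn (mem_range_self 0)
        (range_subset_iff.2 hγS) (mem_range_self t)
    set e := Complex.equivRealProdCLM with he
    have hWs : IsSimplyConnected (e ⁻¹' W₀) :=
      (e.toHomeomorph.isSimplyConnected_preimage).2 (h3 _ (hγS 0))
    have hmaps : MapsTo e (e ⁻¹' W₀) U := fun z hz => (hW₀S hz).1
    have hF : ContDiffOn ℝ 1 (fun z => e.symm (X (e z))) (e ⁻¹' W₀) :=
      e.symm.contDiff.comp_contDiffOn (hX.comp e.contDiff.contDiffOn hmaps)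
    have hlam : ContDiffOn ℝ 1 (fun z => Real.exp (-(1 / k) * Real.log (V (e z)))) (e ⁻¹' W₀) :=
      (contDiffOn_const.mul ((hV.comp e.contDiff.contDiffOn hmaps).log
        fun z hz => (hW₀S hz).2)).exp
    have hdiv : ∀ z ∈ e ⁻¹' W₀, (dbar (fun w => starRingEnd ℂ
        ((Real.exp (-(1 / k) * Real.log (V (e w))) : ℝ) * e.symm (X (e w)))) z).re =
        -(Real.exp (-(1 / k) * Real.log (V (e z))) / (k * V (e z))) * M (e z) := by
      intro z hz
      rw [hM _ (hmaps hz)]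
      exact re_dbar_conj_rescale hk.ne' (hXd _ (hmaps hz)) (hVd _ (hmaps hz)) (hW₀S hz).2
    have hsgn := forall_pos_or_forall_neg_of_isPreconnected
      (isPreconnected_connectedComponentIn : IsPreconnected W₀)
      (hV.continuousOn.mono fun p hp => (hW₀S hp).1) fun p hp => (hW₀S hp).2
    have hcoef : (∀ p ∈ W₀, -(Real.exp (-(1 / k) * Real.log (V p)) / (k * V p)) < 0) ∨
        ∀ p ∈ W₀, 0 < -(Real.exp (-(1 / k) * Real.log (V p)) / (k * V p)) := by
      refine hsgn.imp (fun h p hp => ?_) fun h p hp => ?_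
      · exact neg_neg_of_pos (div_pos (Real.exp_pos _) (mul_pos hk (h p hp)))
      · exact neg_pos.2 (div_neg_of_pos_of_neg (Real.exp_pos _) (mul_neg_of_pos_of_neg hk (h p hp)))
    have hsign : (∀ z ∈ e ⁻¹' W₀, 0 ≤ (dbar (fun w => starRingEnd ℂ
        ((Real.exp (-(1 / k) * Real.log (V (e w))) : ℝ) * e.symm (X (e w)))) z).re) ∨
        ∀ z ∈ e ⁻¹' W₀, (dbar (fun w => starRingEnd ℂ
        ((Real.exp (-(1 / k) * Real.log (V (e w))) : ℝ) * e.symm (X (e w)))) z).re ≤ 0 := by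
      rcases h1 with h | h <;> rcases hcoef with hc | hc
      · exact Or.inr fun z hz => by
          rw [hdiv z hz]
          exact mul_nonpos_of_nonpos_of_nonneg (hc _ hz).le (h _ (hmaps hz))
      · exact Or.inl fun z hz => by
          rw [hdiv z hz]
          exact mul_nonneg (hc _ hz).le (h _ (hmaps hz))
      · exact Or.inl fun z hz => by
          rw [hdiv z hz]
          exact mul_nonneg_of_nonpos_of_nonpos (hc _ hz).le (h _ (hmaps hz))
      · exact Or.inr fun z hz => by
          rw [hdiv z hz]
          exact mul_nonpos_of_nonneg_of_nonpos (hc _ hz).le (h _ (hmaps hz))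
    intro t
    have hγe : ∀ t, e (e.symm (γ t)) = γ t := fun t => e.apply_symm_apply _
    have hmem : ∀ t, e.symm (γ t) ∈ e ⁻¹' W₀ := fun t => by
      rw [mem_preimage, hγe]
      exact hγW t
    have hz := re_dbar_eq_zero_of_periodic_orbit (hW₀o.preimage e.continuous) hWs hF hlam
      (γ := fun t => e.symm (γ t)) hT0 (fun t => congrArg e.symm (hT t)) hmem
      (fun t => by
        simp only [hγe]
        exact (e.symm : ℝ × ℝ →L[ℝ] ℂ).hasFDerivAt.comp_hasDerivAt t (hγ t))
      (fun ⟨c, hc⟩ => hne ⟨e c, fun t => by rw [← hc t, hγe]⟩) hsign t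
    rw [hdiv _ (hmem t), hγe] at hz
    refine (mul_eq_zero.1 hz).resolve_left ?_
    rcases hcoef with hc | hc
    · exact (hc _ (hγW t)).ne
    · exact (hc _ (hγW t)).ne'

end
end

section
/- Let U ⊆ ℝ² be open, let X be a C¹ vector field on U, let V : U → ℝ be C¹, let k ≠ 0, and set M = ⟨∇V, X⟩ − k·V·div X. If γ : ℝ → U is a T-periodic solution of γ' = X(γ) with V(γ(t)) ≠ 0 for all t, then ∫₀ᵀ M(γ(t))/V(γ(t)) dt = −k·∫₀ᵀ div X(γ(t)) dt. In particular, the characteristic exponent h(γ) = ∫₀ᵀ div X(γ(t)) dt equals −(1/k)·∫₀ᵀ (M/V)(γ(t)) dt, so its sign is the sign of −V·M along γ when M/V has constant sign. -/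
open Set Filter

noncomputable section

/-- The logarithmic derivative of a nowhere vanishing function along a periodic solution has zero
mean over a period. -/
theorem integral_logDeriv_along_periodic_solution {E : Type*} [NormedAddCommGroup E]
    [NormedSpace ℝ E] {U : Set E} (hU : IsOpen U) {X : E → E} {V : E → ℝ}
    (hV : ContDiffOn ℝ 1 V U) {γ : ℝ → E} {T : ℝ} (hmem : ∀ t, γ t ∈ U)
    (hsol : ∀ t, HasDerivAt γ (X (γ t)) t) (hper : Function.Periodic γ T)
    (hVne : ∀ t, V (γ t) ≠ 0)
    (hint : IntervalIntegrable (fun t => fderiv ℝ V (γ t) (X (γ t)) / V (γ t))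
      MeasureTheory.volume 0 T) :
    ∫ t in (0:ℝ)..T, fderiv ℝ V (γ t) (X (γ t)) / V (γ t) = 0 := by
  have hderiv : ∀ t, HasDerivAt (fun s => Real.log (V (γ s)))
      (fderiv ℝ V (γ t) (X (γ t)) / V (γ t)) t := fun t =>
    (((hV.differentiableOn one_ne_zero).differentiableAt
      (hU.mem_nhds (hmem t))).hasFDerivAt.comp_hasDerivAt t (hsol t)).log (hVne t)
  rw [intervalIntegral.integral_eq_sub_of_hasDerivAt (fun t _ => hderiv t) hint]
  have hT : γ T = γ 0 := by simpa using hper 0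
  rw [hT, sub_self]

theorem dulac_characteristic_exponent
    (U : Set (ℝ × ℝ)) (hU : IsOpen U)
    (X : ℝ × ℝ → ℝ × ℝ) (hX : ContDiffOn ℝ 1 X U)
    (V : ℝ × ℝ → ℝ) (hV : ContDiffOn ℝ 1 V U)
    (k : ℝ) (hk : k ≠ 0)
    (divX : ℝ × ℝ → ℝ)
    (hdiv : ∀ p ∈ U, divX p =
      fderiv ℝ (fun q => (X q).1) p ((1 : ℝ), (0 : ℝ)) +
        fderiv ℝ (fun q => (X q).2) p ((0 : ℝ), (1 : ℝ)))
    (M : ℝ × ℝ → ℝ)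
    (hM : ∀ p ∈ U, M p = fderiv ℝ V p (X p) - k * V p * divX p)
    (γ : ℝ → ℝ × ℝ) (T : ℝ) (hT : 0 < T)
    (hmem : ∀ t, γ t ∈ U)
    (hsol : ∀ t : ℝ, HasDerivAt γ (X (γ t)) t)
    (hper : Function.Periodic γ T)
    (hVne : ∀ t : ℝ, V (γ t) ≠ 0) :
    (∫ t in (0:ℝ)..T, M (γ t) / V (γ t)) = -k * ∫ t in (0:ℝ)..T, divX (γ t) ∧
    (∫ t in (0:ℝ)..T, divX (γ t)) = -(1 / k) * ∫ t in (0:ℝ)..T, M (γ t) / V (γ t) := by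
  have hγ : Continuous γ := continuous_iff_continuousAt.2 fun t => (hsol t).continuousAt
  have along {F : Type} [TopologicalSpace F] {f : ℝ × ℝ → F} (hf : ContinuousOn f U) :
      Continuous fun t => f (γ t) := hf.comp_continuous hγ hmem
  have hdivc : Continuous fun t => divX (γ t) := by
    have h₁ := along (hX.fst.continuousOn_fderiv_of_isOpen hU le_rfl)
    have h₂ := along (hX.snd.continuousOn_fderiv_of_isOpen hU le_rfl)
    simp only [hdiv _ (hmem _)]
    exact (h₁.clm_apply continuous_const).add (h₂.clm_apply continuous_const)
  have hlogc : Continuous fun t => fderiv ℝ V (γ t) (X (γ t)) / V (γ t) :=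
    ((along (hV.continuousOn_fderiv_of_isOpen hU le_rfl)).clm_apply
      (along hX.continuousOn)).div (along hV.continuousOn) hVne
  have hMV : ∀ t, M (γ t) / V (γ t) =
      fderiv ℝ V (γ t) (X (γ t)) / V (γ t) - k * divX (γ t) := fun t => by
    have := hVne t
    rw [hM _ (hmem t)]
    field_simp
  have key : (∫ t in (0:ℝ)..T, M (γ t) / V (γ t)) = -k * ∫ t in (0:ℝ)..T, divX (γ t) := by
    simp only [hMV]
    rw [intervalIntegral.integral_sub (hlogc.intervalIntegrable _ _)
        ((hdivc.const_mul k).intervalIntegrable _ _),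
      integral_logDeriv_along_periodic_solution hU hV hmem hsol hper hVne
        (hlogc.intervalIntegrable _ _),
      intervalIntegral.integral_const_mul]
    ring
  refine ⟨key, ?_⟩
  rw [key]
  field_simp

end
end

section
/- Let q ≥ 1 be an integer and let (Cs, Sn) : ℝ → ℝ² be the solution of the Cauchy problem Cs'(θ) = −Sn(θ), Sn'(θ) = Cs(θ)^{2q−1}, Cs(0) = 1, Sn(0) = 0 (the (1,q)-trigonometric functions). Then this solution is defined on all of ℝ and is periodic; let T denote its minimal period. For all natural numbers i, j: (i) if i or j is odd, then ∫₀ᵀ Sn(θ)ⁱ Cs(θ)ʲ dθ = 0; (ii) if i and j are both even, then ∫₀ᵀ Sn(θ)ⁱ Cs(θ)ʲ dθ = 2·Γ((i+1)/2)·Γ((j+1)/(2q)) / ( q^{(i+1)/2} · Γ((i+1)/2 + (j+1)/(2q)) ), where Γ is the Gamma function. -/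
open Real Filter Set

noncomputable section

open scoped NNReal

/-- A bounded Lipschitz autonomous vector field on a Banach space has global solutions. -/
lemma exists_forall_hasDerivAt_of_lipschitzWith_of_bounded {E : Type*} [NormedAddCommGroup E]
    [NormedSpace ℝ E] [CompleteSpace E] {f : E → E} {K L : ℝ≥0} (hf : LipschitzWith K f)
    (hL : ∀ x, ‖f x‖ ≤ L) (x₀ : E) :
    ∃ α : ℝ → E, α 0 = x₀ ∧ ∀ t, HasDerivAt α (f (α t)) t := by
  have hloc : ∀ r : ℝ≥0, ∃ α : ℝ → E, α 0 = x₀ ∧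
      ∀ t ∈ Ioo (-(r : ℝ)) r, HasDerivAt α (f (α t)) t := by
    intro r
    have hr : (0 : ℝ) ∈ Icc (-(r : ℝ)) r := by simp
    have hpl : IsPicardLindelof (fun _ ↦ f) (⟨0, hr⟩ : Icc (-(r : ℝ)) r) x₀ (L * r) 0 L K :=
      IsPicardLindelof.of_time_independent (fun x _ ↦ hL x) hf.lipschitzOnWith (by simp)
    obtain ⟨α, hα0, hα⟩ := hpl.exists_eq_forall_mem_Icc_hasDerivWithinAt₀
    exact ⟨α, hα0, fun t ht ↦ (hα t (Ioo_subset_Icc_self ht)).hasDerivAt (Icc_mem_nhds ht.1 ht.2)⟩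
  choose γ hγ0 hγ using hloc
  have hagree : ∀ r s : ℝ≥0, r ≤ s → EqOn (γ r) (γ s) (Ioo (-(r : ℝ)) r) := by
    intro r s hrs t ht
    have hr : (0 : ℝ) ∈ Ioo (-(r : ℝ)) r := by
      constructor <;> linarith [ht.1, ht.2]
    have hrs' : (r : ℝ) ≤ s := hrs
    exact ODE_solution_unique_of_mem_Ioo (v := fun _ ↦ f) (s := fun _ ↦ univ) (K := K)
      (fun _ _ ↦ hf.lipschitzOnWith) hr (fun u hu ↦ ⟨hγ r u hu, mem_univ _⟩)
      (fun u hu ↦ ⟨hγ s u ⟨by linarith [hu.1], by linarith [hu.2]⟩, mem_univ _⟩)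
      ((hγ0 r).trans (hγ0 s).symm) ht
  refine ⟨fun t ↦ γ (‖t‖₊ + 1) t, hγ0 _, fun t ↦ ?_⟩
  have hmem : t ∈ Ioo (-((‖t‖₊ + 2 : ℝ≥0) : ℝ)) (‖t‖₊ + 2 : ℝ≥0) := by
    simp only [NNReal.coe_add, coe_nnnorm, Real.norm_eq_abs, NNReal.coe_ofNat, mem_Ioo]
    constructor <;> linarith [neg_abs_le t, le_abs_self t]
  have heq : ∀ u, |u| < |t| + 1 → γ (‖u‖₊ + 1) u = γ (‖t‖₊ + 2) u := by
    intro u hu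
    refine hagree _ _ ?_ ?_
    · rw [← NNReal.coe_le_coe]
      simp only [NNReal.coe_add, coe_nnnorm, Real.norm_eq_abs, NNReal.coe_ofNat, NNReal.coe_one]
      linarith
    · simp only [NNReal.coe_add, coe_nnnorm, Real.norm_eq_abs, NNReal.coe_one, mem_Ioo]
      constructor <;> linarith [neg_abs_le u, le_abs_self u]
  have hev : (fun u ↦ γ (‖u‖₊ + 1) u) =ᶠ[nhds t] γ (‖t‖₊ + 2) := by
    have : ∀ᶠ u in nhds t, |u| < |t| + 1 :=
      continuous_abs.continuousAt.eventually_lt continuousAt_const (by simp)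
    exact this.mono heq
  have := (hγ (‖t‖₊ + 2) t hmem).congr_of_eventuallyEq hev
  rwa [← heq t (by simp)] at this

/-- The real beta integral in terms of the Gamma function. -/
lemma integral_Ioo_rpow_mul_one_sub_rpow {a b : ℝ} (ha : 0 < a) (hb : 0 < b) :
    ∫ x in Ioo (0 : ℝ) 1, x ^ (a - 1) * (1 - x) ^ (b - 1) =
      Real.Gamma a * Real.Gamma b / Real.Gamma (a + b) := by
  have h := Complex.betaIntegral_eq_Gamma_mul_div (a : ℂ) b (by simpa) (by simpa)
  rw [Complex.betaIntegral, intervalIntegral.integral_of_le zero_le_one,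
    MeasureTheory.integral_Ioc_eq_integral_Ioo] at h
  rw [← Complex.ofReal_inj, ← integral_complex_ofReal]
  rw [← Complex.ofReal_add] at h
  simp only [Complex.Gamma_ofReal] at h
  push_cast
  rw [← h]
  refine MeasureTheory.setIntegral_congr_fun measurableSet_Ioo fun x hx ↦ ?_
  rw [Complex.ofReal_cpow hx.1.le, Complex.ofReal_cpow (by linarith [hx.2])]
  push_cast
  rfl

/-- The energy level `1` solutions of the Hamiltonian system defining the `(1, q)`-trigonometric
functions. -/
structure IsUnitEnergySolution (q : ℕ) (C S : ℝ → ℝ) : Prop where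
  hasDerivAt_fst : ∀ θ, HasDerivAt C (-(S θ)) θ
  hasDerivAt_snd : ∀ θ, HasDerivAt S (C θ ^ (2 * q - 1)) θ
  energy : ∀ θ, C θ ^ (2 * q) + q * S θ ^ 2 = 1

lemma abs_le_one_of_energy_eq_one {q : ℕ} (hq : 1 ≤ q) {x y : ℝ}
    (h : x ^ (2 * q) + q * y ^ 2 = 1) : |x| ≤ 1 ∧ |y| ≤ 1 := by
  have hq' : (1 : ℝ) ≤ q := by exact_mod_cast hq
  have hx : 0 ≤ x ^ (2 * q) := (even_two_mul q).pow_nonneg x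
  constructor
  · have : |x| ^ (2 * q) ≤ 1 := by
      rw [(even_two_mul q).pow_abs]
      nlinarith [sq_nonneg y]
    exact (pow_le_one_iff_of_nonneg (abs_nonneg x) (by lia)).1 this
  · rw [← sq_le_one_iff_abs_le_one]
    nlinarith [sq_nonneg y]

/-- A scaled Hamiltonian flow conserves the energy. -/
lemma energy_eq_of_hasDerivAt {q : ℕ} {C S c : ℝ → ℝ}
    (hC : ∀ θ, HasDerivAt C (c θ * -(S θ)) θ)
    (hS : ∀ θ, HasDerivAt S (c θ * C θ ^ (2 * q - 1)) θ) (s t : ℝ) :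
    C s ^ (2 * q) + q * S s ^ 2 = C t ^ (2 * q) + q * S t ^ 2 := by
  have hd : ∀ θ, HasDerivAt (fun θ ↦ C θ ^ (2 * q) + q * S θ ^ 2) 0 θ := by
    intro θ
    refine (((hC θ).fun_pow (2 * q)).add (((hS θ).fun_pow 2).const_mul (q : ℝ))).congr_deriv ?_
    push_cast
    ring
  exact is_const_of_deriv_eq_zero (fun θ ↦ (hd θ).differentiableAt) (fun θ ↦ (hd θ).deriv) s t

namespace IsUnitEnergySolution

variable {q : ℕ} {C S C' S' : ℝ → ℝ}

lemma of_hasDerivAt (hC : ∀ θ, HasDerivAt C (-(S θ)) θ)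
    (hS : ∀ θ, HasDerivAt S (C θ ^ (2 * q - 1)) θ) (hC0 : C 0 = 1) (hS0 : S 0 = 0) :
    IsUnitEnergySolution q C S where
  hasDerivAt_fst := hC
  hasDerivAt_snd := hS
  energy θ := by
    rw [energy_eq_of_hasDerivAt (c := fun _ ↦ 1) (by simpa using hC) (by simpa using hS) θ 0]
    simp [hC0, hS0]

lemma exists_initial (hq : 1 ≤ q) :
    ∃ C S : ℝ → ℝ, IsUnitEnergySolution q C S ∧ C 0 = 1 ∧ S 0 = 0 := by
  let χ : ContDiffBump (0 : ℝ × ℝ) := ⟨1, 2, one_pos, one_lt_two⟩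
  let F : ℝ × ℝ → ℝ × ℝ := fun p ↦ χ p • (-p.2, p.1 ^ (2 * q - 1))
  have hF : ContDiff ℝ 1 F := χ.contDiff.smul (by fun_prop)
  have hFs : HasCompactSupport F := χ.hasCompactSupport.smul_right
  obtain ⟨K, hK⟩ := hF.lipschitzWith_of_hasCompactSupport hFs one_ne_zero
  obtain ⟨L, hL⟩ := hF.continuous.bounded_above_of_compact_support hFs
  obtain ⟨α, hα0, hα⟩ := exists_forall_hasDerivAt_of_lipschitzWith_of_bounded (L := L.toNNReal) hK
    (fun x ↦ (hL x).trans (Real.le_coe_toNNReal L)) (1, 0)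
  have h1 : ∀ θ, HasDerivAt (fun θ ↦ (α θ).1) (χ (α θ) * -(α θ).2) θ := fun θ ↦ (hα θ).fst
  have h2 : ∀ θ, HasDerivAt (fun θ ↦ (α θ).2) (χ (α θ) * (α θ).1 ^ (2 * q - 1)) θ :=
    fun θ ↦ (hα θ).snd
  have hE : ∀ θ, (α θ).1 ^ (2 * q) + q * (α θ).2 ^ 2 = 1 := fun θ ↦ by
    rw [energy_eq_of_hasDerivAt h1 h2 θ 0]
    simp [hα0]
  have hχ : ∀ θ, χ (α θ) = 1 := fun θ ↦ by
    refine χ.one_of_mem_closedBall ?_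
    rw [mem_closedBall_zero_iff]
    obtain ⟨hx, hy⟩ := abs_le_one_of_energy_eq_one hq (hE θ)
    exact max_le hx hy
  simp only [hχ, one_mul] at h1 h2
  exact ⟨_, _, ⟨h1, h2, hE⟩, by simp [hα0], by simp [hα0]⟩

/-- Unit energy solutions are determined by their values at one time. -/
lemma eq_of_eq_at (hq : 1 ≤ q) (h : IsUnitEnergySolution q C S)
    (h' : IsUnitEnergySolution q C' S') (t₀ : ℝ) (hC : C t₀ = C' t₀) (hS : S t₀ = S' t₀) (t : ℝ) :
    C t = C' t ∧ S t = S' t := by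
  let F : ℝ × ℝ → ℝ × ℝ := fun p ↦ (-p.2, p.1 ^ (2 * q - 1))
  have hF : ContDiff ℝ 1 F := by fun_prop
  obtain ⟨K, hK⟩ := hF.contDiffOn.exists_lipschitzOnWith one_ne_zero
    (convex_closedBall (0 : ℝ × ℝ) 1) (isCompact_closedBall 0 1)
  have key : ∀ {C S : ℝ → ℝ}, IsUnitEnergySolution q C S → ∀ t,
      HasDerivAt (fun t ↦ (C t, S t)) (F (C t, S t)) t ∧
        (C t, S t) ∈ Metric.closedBall (0 : ℝ × ℝ) 1 := by
    intro C S h t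
    refine ⟨(h.hasDerivAt_fst t).prodMk (h.hasDerivAt_snd t), ?_⟩
    rw [mem_closedBall_zero_iff]
    obtain ⟨hx, hy⟩ := abs_le_one_of_energy_eq_one hq (h.energy t)
    exact max_le hx hy
  have := congrFun (ODE_solution_unique_univ (v := fun _ ↦ F) (s := fun _ ↦ _) (fun _ ↦ hK)
    (key h) (key h') (t₀ := t₀) (by simp [hC, hS])) t
  simpa using this

/-- Time reversal `θ ↦ a - θ`. -/
lemma comp_sub_left (h : IsUnitEnergySolution q C S) (a : ℝ) :
    IsUnitEnergySolution q (fun θ ↦ C (a - θ)) (fun θ ↦ -S (a - θ)) where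
  hasDerivAt_fst θ := ((h.hasDerivAt_fst (a - θ)).comp_const_sub a θ).congr_deriv (by simp)
  hasDerivAt_snd θ := ((h.hasDerivAt_snd (a - θ)).comp_const_sub a θ).fun_neg.congr_deriv (by simp)
  energy θ := by simpa using h.energy (a - θ)

lemma neg (hq : 1 ≤ q) (h : IsUnitEnergySolution q C S) :
    IsUnitEnergySolution q (fun θ ↦ -C θ) (fun θ ↦ -S θ) where
  hasDerivAt_fst θ := (h.hasDerivAt_fst θ).fun_neg
  hasDerivAt_snd θ := (h.hasDerivAt_snd θ).fun_neg.congr_deriv <| by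
    rw [Odd.neg_pow ⟨q - 1, by lia⟩]
  energy θ := by simpa [(even_two_mul q).neg_pow] using h.energy θ

lemma continuous_fst (h : IsUnitEnergySolution q C S) : Continuous C :=
  continuous_iff_continuousAt.2 fun θ ↦ (h.hasDerivAt_fst θ).continuousAt

lemma continuous_snd (h : IsUnitEnergySolution q C S) : Continuous S :=
  continuous_iff_continuousAt.2 fun θ ↦ (h.hasDerivAt_snd θ).continuousAt

lemma snd_strictMonoOn (h : IsUnitEnergySolution q C S) {s : Set ℝ} (hs : Convex ℝ s)
    (hpos : ∀ θ ∈ interior s, 0 < C θ) : StrictMonoOn S s :=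
  strictMonoOn_of_deriv_pos hs h.continuous_snd.continuousOn fun θ hθ ↦ by
    rw [(h.hasDerivAt_snd θ).deriv]
    exact pow_pos (hpos θ hθ) _

lemma exists_fst_nonpos (h : IsUnitEnergySolution q C S) (hS0 : S 0 = 0) :
    ∃ t, 0 ≤ t ∧ C t ≤ 0 := by
  by_contra! hpos
  have hmono : StrictMonoOn S (Ici 0) :=
    h.snd_strictMonoOn (convex_Ici 0) fun θ hθ ↦ hpos θ (interior_subset hθ)
  have hS1 : 0 < S 1 := hS0 ▸ hmono self_mem_Ici (mem_Ici.2 zero_le_one) zero_lt_one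
  have hanti : AntitoneOn (fun θ ↦ C θ + S 1 * θ) (Ici 1) := by
    refine antitoneOn_of_hasDerivWithinAt_nonpos (f' := fun θ ↦ -S θ + S 1) (convex_Ici 1)
      (h.continuous_fst.add (by fun_prop)).continuousOn (fun θ _ ↦ ?_) fun θ hθ ↦ ?_
    · exact (((h.hasDerivAt_fst θ).add ((hasDerivAt_id θ).const_mul (S 1))).congr_deriv
        (by simp)).hasDerivWithinAt
    · have hθ1 : 1 ≤ θ := interior_subset hθ
      have := hmono.monotoneOn (mem_Ici.2 zero_le_one) (mem_Ici.2 (zero_le_one.trans hθ1)) hθ1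
      linarith
  have hC1 := hpos 1 zero_le_one
  have hdiv : 0 < C 1 / S 1 := div_pos hC1 hS1
  have hle := hanti (mem_Ici.2 le_rfl) (mem_Ici.2 (by linarith : 1 ≤ 1 + C 1 / S 1))
    (by linarith)
  have hp := hpos (1 + C 1 / S 1) (by linarith)
  simp only [mul_add, mul_div_cancel₀ _ hS1.ne'] at hle
  linarith

/-- The first zero of the first component. -/
lemma exists_first_zero (h : IsUnitEnergySolution q C S) (hC0 : C 0 = 1) (hS0 : S 0 = 0) :
    ∃ τ, 0 < τ ∧ C τ = 0 ∧ ∀ θ, 0 ≤ θ → θ < τ → 0 < C θ := by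
  have hivt : ∀ t, 0 ≤ t → C t ≤ 0 → ∃ u, 0 ≤ u ∧ u ≤ t ∧ C u = 0 := by
    intro t ht hCt
    obtain ⟨u, hu, hCu⟩ := intermediate_value_Icc' ht h.continuous_fst.continuousOn
      ⟨hCt, hC0 ▸ zero_le_one⟩
    exact ⟨u, hu.1, hu.2, hCu⟩
  let Z : Set ℝ := Ici 0 ∩ C ⁻¹' {0}
  have hZ : IsClosed Z := isClosed_Ici.inter (isClosed_singleton.preimage h.continuous_fst)
  have hne : Z.Nonempty := by
    obtain ⟨t, ht, hCt⟩ := h.exists_fst_nonpos hS0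
    obtain ⟨u, hu, -, hCu⟩ := hivt t ht hCt
    exact ⟨u, hu, hCu⟩
  have hbdd : BddBelow Z := ⟨0, fun t ht ↦ ht.1⟩
  obtain ⟨hτ, hCτ⟩ := hZ.csInf_mem hne hbdd
  refine ⟨sInf Z, lt_of_le_of_ne hτ fun h0 ↦ ?_, hCτ, fun θ h0 hlt ↦ ?_⟩
  · rw [mem_preimage, ← h0, hC0] at hCτ
    exact one_ne_zero hCτ
  · by_contra! hle
    obtain ⟨u, hu, hut, hCu⟩ := hivt θ h0 hle
    exact absurd (csInf_le hbdd ⟨hu, hCu⟩) (by linarith)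

lemma symm_zero (hq : 1 ≤ q) (h : IsUnitEnergySolution q C S) (hS0 : S 0 = 0) (θ : ℝ) :
    C (-θ) = C θ ∧ S (-θ) = -S θ := by
  have := h.eq_of_eq_at hq (h.comp_sub_left 0) 0 (by simp) (by simp [hS0]) θ
  simp only [zero_sub] at this
  exact ⟨this.1.symm, by linarith [this.2]⟩

lemma symm_of_fst_eq_zero (hq : 1 ≤ q) (h : IsUnitEnergySolution q C S) {τ : ℝ} (hτ : C τ = 0)
    (θ : ℝ) : C (2 * τ - θ) = -C θ ∧ S (2 * τ - θ) = S θ := by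
  have ht : 2 * τ - τ = τ := by ring
  have := h.eq_of_eq_at hq ((h.comp_sub_left (2 * τ)).neg hq) τ (by simp [ht, hτ])
    (by simp [ht]) θ
  exact ⟨by linarith [this.1], by linarith [this.2]⟩

lemma add_two_mul (hq : 1 ≤ q) (h : IsUnitEnergySolution q C S) (hS0 : S 0 = 0) {τ : ℝ}
    (hτ : C τ = 0) (θ : ℝ) : C (θ + 2 * τ) = -C θ ∧ S (θ + 2 * τ) = -S θ := by
  have h1 := h.symm_of_fst_eq_zero hq hτ (-θ)
  have h2 := h.symm_zero hq hS0 θ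
  rw [h2.1, h2.2, show 2 * τ - -θ = θ + 2 * τ by ring] at h1
  exact h1

lemma periodic (hq : 1 ≤ q) (h : IsUnitEnergySolution q C S) (hS0 : S 0 = 0) {τ : ℝ}
    (hτ : C τ = 0) : Function.Periodic C (4 * τ) ∧ Function.Periodic S (4 * τ) := by
  have h2 := h.add_two_mul hq hS0 hτ
  constructor <;> intro θ <;> rw [show θ + 4 * τ = (θ + 2 * τ) + 2 * τ by ring]
  · rw [(h2 _).1, (h2 _).1, neg_neg]
  · rw [(h2 _).2, (h2 _).2, neg_neg]

lemma snd_pos (h : IsUnitEnergySolution q C S) (hS0 : S 0 = 0) {τ : ℝ}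
    (hpos : ∀ θ, 0 ≤ θ → θ < τ → 0 < C θ) {θ : ℝ} (h0 : 0 < θ) (hθ : θ ≤ τ) : 0 < S θ := by
  have hmono : StrictMonoOn S (Icc 0 τ) :=
    h.snd_strictMonoOn (convex_Icc 0 τ) fun u hu ↦ by
      rw [interior_Icc] at hu
      exact hpos u hu.1.le hu.2
  exact hS0 ▸ hmono ⟨le_rfl, h0.le.trans hθ⟩ ⟨h0.le, hθ⟩ h0

lemma le_of_periodic (hq : 1 ≤ q) (h : IsUnitEnergySolution q C S) (hC0 : C 0 = 1)
    (hS0 : S 0 = 0) {τ : ℝ} (hτ : C τ = 0) (hpos : ∀ θ, 0 ≤ θ → θ < τ → 0 < C θ) {T : ℝ}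
    (hT : 0 < T) (hCT : Function.Periodic C T) (hST : Function.Periodic S T) : 4 * τ ≤ T := by
  by_contra! hlt
  have hC : C T = 1 := by rw [← hC0, ← hCT 0, zero_add]
  have hS : S T = 0 := by rw [← hS0, ← hST 0, zero_add]
  have hS2 : ∀ θ, 0 < θ → θ < 2 * τ → 0 < S θ := by
    intro θ h0 hθ
    rcases le_total θ τ with hle | hle
    · exact h.snd_pos hS0 hpos h0 hle
    · rw [← (h.symm_of_fst_eq_zero hq hτ θ).2]
      exact h.snd_pos hS0 hpos (by linarith) (by linarith)
  have hadd := h.add_two_mul hq hS0 hτ (T - 2 * τ)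
  rw [sub_add_cancel, hC, hS] at hadd
  rcases lt_trichotomy T (2 * τ) with hT2 | hT2 | hT2
  · exact (hS2 T hT hT2).ne' hS
  · have := hadd.1
    rw [hT2, sub_self, hC0] at this
    norm_num at this
  · have := hS2 (T - 2 * τ) (by linarith) (by linarith)
    linarith [hadd.2]

lemma integral_eq_zero_of_odd (hq : 1 ≤ q) (h : IsUnitEnergySolution q C S) (hS0 : S 0 = 0) {τ : ℝ}
    (hτ : C τ = 0) {i j : ℕ} (hij : Odd i ∨ Odd j) :
    ∫ θ in (0 : ℝ)..4 * τ, S θ ^ i * C θ ^ j = 0 := by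
  obtain ⟨hCp, hSp⟩ := h.periodic hq hS0 hτ
  have hp : Function.Periodic (fun θ ↦ S θ ^ i * C θ ^ j) (4 * τ) := fun θ ↦ by
    simp only [hCp θ, hSp θ]
  have key : ∀ a, (∀ θ, S (a - θ) ^ i * C (a - θ) ^ j = -(S θ ^ i * C θ ^ j)) →
      ∫ θ in (0 : ℝ)..4 * τ, S θ ^ i * C θ ^ j = 0 := by
    intro a ha
    have h1 := intervalIntegral.integral_comp_sub_left (a := 0) (b := 4 * τ)
      (fun θ ↦ S θ ^ i * C θ ^ j) a
    have h2 := hp.intervalIntegral_add_eq (a - 4 * τ) 0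
    simp only [ha, intervalIntegral.integral_neg, sub_zero] at h1
    rw [sub_add_cancel, zero_add] at h2
    linarith
  rcases Nat.even_or_odd j with hj | hj
  · have hi : Odd i := hij.resolve_right (Nat.not_odd_iff_even.2 hj)
    refine key 0 fun θ ↦ ?_
    obtain ⟨h1, h2⟩ := h.symm_zero hq hS0 θ
    rw [zero_sub, h1, h2, hi.neg_pow, neg_mul]
  · refine key (2 * τ) fun θ ↦ ?_
    obtain ⟨h1, h2⟩ := h.symm_of_fst_eq_zero hq hτ θ
    rw [h1, h2, hj.neg_pow, mul_neg]

lemma integral_eq_four_mul (hq : 1 ≤ q) (h : IsUnitEnergySolution q C S) (hS0 : S 0 = 0) {τ : ℝ}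
    (hτ : C τ = 0) {i j : ℕ} (hi : Even i) (hj : Even j) :
    ∫ θ in (0 : ℝ)..4 * τ, S θ ^ i * C θ ^ j = 4 * ∫ θ in (0 : ℝ)..τ, S θ ^ i * C θ ^ j := by
  have hcont : Continuous fun θ ↦ S θ ^ i * C θ ^ j :=
    (h.continuous_snd.pow i).mul (h.continuous_fst.pow j)
  have hp : Function.Periodic (fun θ ↦ S θ ^ i * C θ ^ j) (2 * τ) := fun θ ↦ by
    obtain ⟨h1, h2⟩ := h.add_two_mul hq hS0 hτ θ
    simp only [h1, h2, hi.neg_pow, hj.neg_pow]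
  have h1 := intervalIntegral.integral_comp_sub_left (a := 0) (b := τ)
    (fun θ ↦ S θ ^ i * C θ ^ j) (2 * τ)
  simp only [(h.symm_of_fst_eq_zero hq hτ _).1, (h.symm_of_fst_eq_zero hq hτ _).2, hj.neg_pow,
    sub_zero, show 2 * τ - τ = τ by ring] at h1
  have h2 := hp.intervalIntegral_add_eq (2 * τ) 0
  rw [zero_add, show 2 * τ + 2 * τ = 4 * τ by ring] at h2
  rw [← intervalIntegral.integral_add_adjacent_intervals (hcont.intervalIntegrable 0 (2 * τ))
    (hcont.intervalIntegrable (2 * τ) (4 * τ)), h2,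
    ← intervalIntegral.integral_add_adjacent_intervals (hcont.intervalIntegrable 0 τ)
    (hcont.intervalIntegrable τ (2 * τ)), ← h1]
  ring

lemma abs_deriv_mul_beta_integrand (hq : 1 ≤ q) {x y : ℝ} (hx : 0 < x) (hy : 0 < y)
    (hE : x ^ (2 * q) + q * y ^ 2 = 1) (i j : ℕ) :
    |((2 * q : ℕ) : ℝ) * x ^ (2 * q - 1) * -y| *
        ((x ^ (2 * q)) ^ (((j : ℝ) + 1) / (2 * q) - 1) *
          (1 - x ^ (2 * q)) ^ (((i : ℝ) + 1) / 2 - 1)) =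
      2 * (q : ℝ) ^ (((i : ℝ) + 1) / 2) * (y ^ i * x ^ j) := by
  have hq0 : (0 : ℝ) < q := by exact_mod_cast hq
  have hx2 : (x ^ (2 * q - 1) : ℝ) * (x ^ (2 * q)) ^ (((j : ℝ) + 1) / (2 * q) - 1) = x ^ j := by
    rw [← rpow_natCast, ← rpow_natCast, ← rpow_mul hx.le, ← rpow_add hx, ← rpow_natCast]
    congr 1
    push_cast [Nat.cast_sub (show 1 ≤ 2 * q by lia)]
    field_simp
    ring
  have hy2 : y * (1 - x ^ (2 * q)) ^ (((i : ℝ) + 1) / 2 - 1) * q =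
      (q : ℝ) ^ (((i : ℝ) + 1) / 2) * y ^ i := by
    rw [show 1 - x ^ (2 * q) = q * y ^ 2 by linarith, mul_rpow hq0.le (by positivity),
      ← rpow_natCast y 2, ← rpow_mul hy.le, ← rpow_natCast y i, rpow_sub_one hq0.ne',
      show ((2 : ℕ) : ℝ) * (((i : ℝ) + 1) / 2 - 1) = i - 1 by push_cast; ring,
      rpow_sub_one hy.ne']
    field_simp
  rw [mul_neg, abs_neg, abs_of_pos (by positivity), ← hx2]
  push_cast
  linear_combination (2 * x ^ (2 * q - 1) * (x ^ (2 * q)) ^ (((j : ℝ) + 1) / (2 * q) - 1)) * hy2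

lemma beta_eq_integral (hq : 1 ≤ q) (h : IsUnitEnergySolution q C S) (hC0 : C 0 = 1)
    (hS0 : S 0 = 0) {τ : ℝ} (h0τ : 0 < τ) (hτ : C τ = 0)
    (hpos : ∀ θ, 0 ≤ θ → θ < τ → 0 < C θ) (i j : ℕ) :
    Real.Gamma (((j : ℝ) + 1) / (2 * q)) * Real.Gamma (((i : ℝ) + 1) / 2) /
        Real.Gamma (((j : ℝ) + 1) / (2 * q) + ((i : ℝ) + 1) / 2) =
      2 * (q : ℝ) ^ (((i : ℝ) + 1) / 2) * ∫ θ in (0 : ℝ)..τ, S θ ^ i * C θ ^ j := by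
  have hq0 : (0 : ℝ) < q := by exact_mod_cast hq
  have hd : ∀ θ, HasDerivAt (fun θ ↦ C θ ^ (2 * q))
      (((2 * q : ℕ) : ℝ) * C θ ^ (2 * q - 1) * -(S θ)) θ := fun θ ↦
    (h.hasDerivAt_fst θ).fun_pow (2 * q)
  have hcont : Continuous fun θ ↦ C θ ^ (2 * q) := h.continuous_fst.pow _
  have hCpos : ∀ θ ∈ Ioo 0 τ, 0 < C θ := fun θ hθ ↦ hpos θ hθ.1.le hθ.2
  have hSpos : ∀ θ ∈ Ioo 0 τ, 0 < S θ := fun θ hθ ↦ h.snd_pos hS0 hpos hθ.1 hθ.2.le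
  have hanti : StrictAntiOn (fun θ ↦ C θ ^ (2 * q)) (Icc 0 τ) := by
    refine strictAntiOn_of_deriv_neg (convex_Icc 0 τ) hcont.continuousOn fun θ hθ ↦ ?_
    rw [interior_Icc] at hθ
    have := hCpos θ hθ
    have := hSpos θ hθ
    rw [(hd θ).deriv, mul_neg, neg_lt_zero]
    have : 0 < 2 * q := by lia
    positivity
  have himage : (fun θ ↦ C θ ^ (2 * q)) '' Ioo 0 τ = Ioo 0 1 := by
    refine Subset.antisymm ?_ ?_
    · rintro _ ⟨θ, hθ, rfl⟩
      have := hCpos θ hθ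
      have := hSpos θ hθ
      refine ⟨by positivity, ?_⟩
      have : 0 < q * S θ ^ 2 := by positivity
      simp only
      linarith [h.energy θ]
    · have := intermediate_value_Ioo' h0τ.le (f := fun θ ↦ C θ ^ (2 * q)) hcont.continuousOn
      simpa [hC0, hτ, show q ≠ 0 by lia] using this
  rw [← integral_Ioo_rpow_mul_one_sub_rpow (by positivity) (by positivity), ← himage,
    MeasureTheory.integral_image_eq_integral_abs_deriv_smul measurableSet_Ioo
      (fun θ _ ↦ (hd θ).hasDerivWithinAt) (hanti.injOn.mono Ioo_subset_Icc_self),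
    intervalIntegral.integral_of_le h0τ.le, MeasureTheory.integral_Ioc_eq_integral_Ioo,
    ← MeasureTheory.integral_const_mul]
  exact MeasureTheory.setIntegral_congr_fun measurableSet_Ioo fun θ hθ ↦
    abs_deriv_mul_beta_integrand hq (hCpos θ hθ) (hSpos θ hθ) (h.energy θ) i j

end IsUnitEnergySolution

theorem generalized_trig_integrals (q : ℕ) (hq : 1 ≤ q) :
    (∃ Cs Sn : ℝ → ℝ,
      (∀ θ : ℝ, HasDerivAt Cs (-(Sn θ)) θ) ∧
      (∀ θ : ℝ, HasDerivAt Sn (Cs θ ^ (2 * q - 1)) θ) ∧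
      Cs 0 = 1 ∧ Sn 0 = 0) ∧
    ∀ Cs Sn : ℝ → ℝ,
      (∀ θ : ℝ, HasDerivAt Cs (-(Sn θ)) θ) →
      (∀ θ : ℝ, HasDerivAt Sn (Cs θ ^ (2 * q - 1)) θ) →
      Cs 0 = 1 → Sn 0 = 0 →
      ∃ T : ℝ, 0 < T ∧ Function.Periodic Cs T ∧ Function.Periodic Sn T ∧
        (∀ T' : ℝ, 0 < T' → Function.Periodic Cs T' → Function.Periodic Sn T' →
          T ≤ T') ∧
        (∀ i j : ℕ, (Odd i ∨ Odd j) →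
          (∫ θ in (0:ℝ)..T, Sn θ ^ i * Cs θ ^ j) = 0) ∧
        (∀ i j : ℕ, Even i → Even j →
          (∫ θ in (0:ℝ)..T, Sn θ ^ i * Cs θ ^ j) =
            2 * Real.Gamma (((i : ℝ) + 1) / 2) *
              Real.Gamma (((j : ℝ) + 1) / (2 * (q : ℝ))) /
              ((q : ℝ) ^ (((i : ℝ) + 1) / 2) *
                Real.Gamma (((i : ℝ) + 1) / 2 + ((j : ℝ) + 1) / (2 * (q : ℝ))))) := by
  refine ⟨?_, fun Cs Sn hC hS hC0 hS0 ↦ ?_⟩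
  · obtain ⟨C, S, h, hC0, hS0⟩ := IsUnitEnergySolution.exists_initial hq
    exact ⟨C, S, h.hasDerivAt_fst, h.hasDerivAt_snd, hC0, hS0⟩
  have h := IsUnitEnergySolution.of_hasDerivAt hC hS hC0 hS0
  obtain ⟨τ, h0τ, hτ, hpos⟩ := h.exists_first_zero hC0 hS0
  obtain ⟨hCp, hSp⟩ := h.periodic hq hS0 hτ
  refine ⟨4 * τ, by positivity, hCp, hSp, fun T hT hCT hST ↦
    h.le_of_periodic hq hC0 hS0 hτ hpos hT hCT hST,
    fun i j hij ↦ h.integral_eq_zero_of_odd hq hS0 hτ hij, fun i j hi hj ↦ ?_⟩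
  have hq0 : (0 : ℝ) < q := by exact_mod_cast hq
  have hqpow : (0 : ℝ) < (q : ℝ) ^ (((i : ℝ) + 1) / 2) := rpow_pos_of_pos hq0 _
  have hbeta := h.beta_eq_integral hq hC0 hS0 h0τ hτ hpos i j
  have hΓ : 0 < Real.Gamma (((i : ℝ) + 1) / 2 + ((j : ℝ) + 1) / (2 * q)) :=
    Real.Gamma_pos_of_pos (by positivity)
  rw [add_comm (((j : ℝ) + 1) / (2 * q)), div_eq_iff hΓ.ne'] at hbeta
  rw [h.integral_eq_four_mul hq hS0 hτ hi hj, eq_div_iff (by positivity)]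
  linear_combination -2 * hbeta

end
end

section
/- Let (Cs, Sn) : ℝ → ℝ² be the solution of Cs'(θ) = −Sn(θ), Sn'(θ) = Cs(θ)³, Cs(0) = 1, Sn(0) = 0 (the (1,2)-trigonometric functions). Then for every θ ∈ ℝ: ∫₀^θ Cs(ψ)⁸ dψ = (6·Sn(θ)·Cs(θ)⁵ + 10·Sn(θ)·Cs(θ) + 5θ)/21, and ∫₀^θ Sn(ψ)⁴ dψ = (−Sn(θ)³·Cs(θ) − Sn(θ)·Cs(θ) + θ)/7. -/
open Real Filter Set

noncomputable section

/-- The energy of the Hamiltonian system is conserved. -/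
theorem pow_four_add_two_mul_sq_eq_one {Cs Sn : ℝ → ℝ}
    (hCs : ∀ θ : ℝ, HasDerivAt Cs (-(Sn θ)) θ)
    (hSn : ∀ θ : ℝ, HasDerivAt Sn (Cs θ ^ 3) θ)
    (hCs0 : Cs 0 = 1) (hSn0 : Sn 0 = 0) (θ : ℝ) :
    Cs θ ^ 4 + 2 * Sn θ ^ 2 = 1 := by
  have hderiv (x : ℝ) : HasDerivAt (fun y => Cs y ^ 4 + 2 * Sn y ^ 2) 0 x := by
    refine (((hCs x).fun_pow 4).fun_add (((hSn x).fun_pow 2).const_mul 2)).congr_deriv ?_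
    norm_num
    ring
  have h := is_const_of_deriv_eq_zero (fun x => (hderiv x).differentiableAt)
    (fun x => (hderiv x).deriv) θ 0
  simpa [hCs0, hSn0] using h

theorem one_two_trig_integrals (Cs Sn : ℝ → ℝ)
    (hCs : ∀ θ : ℝ, HasDerivAt Cs (-(Sn θ)) θ)
    (hSn : ∀ θ : ℝ, HasDerivAt Sn (Cs θ ^ 3) θ)
    (hCs0 : Cs 0 = 1) (hSn0 : Sn 0 = 0) :
    ∀ θ : ℝ,
      (∫ ψ in (0:ℝ)..θ, Cs ψ ^ 8) =
        (6 * Sn θ * Cs θ ^ 5 + 10 * Sn θ * Cs θ + 5 * θ) / 21 ∧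
      (∫ ψ in (0:ℝ)..θ, Sn ψ ^ 4) =
        (-(Sn θ ^ 3 * Cs θ) - Sn θ * Cs θ + θ) / 7 := by
  intro θ
  have energy := pow_four_add_two_mul_sq_eq_one hCs hSn hCs0 hSn0
  have hCs_cont : Continuous Cs :=
    continuous_iff_continuousAt.mpr fun x => (hCs x).continuousAt
  have hSn_cont : Continuous Sn :=
    continuous_iff_continuousAt.mpr fun x => (hSn x).continuousAt
  constructor
  · have hderiv (x : ℝ) : HasDerivAt
        (fun y => (6 * Sn y * Cs y ^ 5 + 10 * Sn y * Cs y + 5 * y) / 21) (Cs x ^ 8) x := by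
      refine ((((((hSn x).const_mul 6).fun_mul ((hCs x).fun_pow 5)).fun_add
        (((hSn x).const_mul 10).fun_mul (hCs x))).fun_add
        ((hasDerivAt_id' x).const_mul 5)).div_const 21).congr_deriv ?_
      norm_num
      linear_combination (-(15 * Cs x ^ 4 + 5) / 21) * energy x
    rw [intervalIntegral.integral_eq_sub_of_hasDerivAt (fun x _ => hderiv x)
      ((hCs_cont.pow 8).intervalIntegrable 0 θ)]
    simp [hSn0]
  · have hderiv (x : ℝ) : HasDerivAt
        (fun y => (-(Sn y ^ 3 * Cs y) - Sn y * Cs y + y) / 7) (Sn x ^ 4) x := by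
      refine ((((((hSn x).fun_pow 3).fun_mul (hCs x)).fun_neg.fun_sub
        ((hSn x).fun_mul (hCs x))).fun_add (hasDerivAt_id' x)).div_const 7).congr_deriv ?_
      norm_num
      linear_combination (-(3 * Sn x ^ 2 + 1) / 7) * energy x
    rw [intervalIntegral.integral_eq_sub_of_hasDerivAt (fun x _ => hderiv x)
      ((hSn_cont.pow 4).intervalIntegrable 0 θ)]
    simp [hSn0]

end
end
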